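/- Fix τ > 0, δ ∈ (0, τ/10), and ε, D > 0. Then there exists N₀ such that for all N ≥ N₀, all integers d with N^τ ≤ d ≤ N/2 and dN even, and all z = E + iη in the spectral domain D_δ, the uniform random d-regular graph satisfies ℙ( max_{i,j} |G_{ij}(z) − δ_{ij} m(z)| ≥ N^ε ( (Nη)^{−1/4} + d^{−1/4} ) ) ≤ N^{−D}. -/

import Mathlib

open MeasureTheory Filter Matrix
open scoped ENNReal NNReal

noncomputable section

/-- `A` is the adjacency matrix of a `d`-regular graph on `N` vertices:
a symmetric `{0,1}`-matrix with zero diagonal and all row sums equal to `d`. -/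
def IsAdjMat (N d : ℕ) (A : Matrix (Fin N) (Fin N) ℝ) : Prop :=
  A.IsSymm ∧ (∀ i, A i i = 0) ∧ (∀ i j, A i j = 0 ∨ A i j = 1) ∧ ∀ i, ∑ j, A i j = d

/-- probability of an event under the uniform measure on `d`-regular graphs on `N` vertices. -/
def PrReg (N d : ℕ) (E : Matrix (Fin N) (Fin N) ℝ → Prop) : ℝ :=
  (Nat.card {A : Matrix (Fin N) (Fin N) ℝ // IsAdjMat N d A ∧ E A} : ℝ) /
    (Nat.card {A : Matrix (Fin N) (Fin N) ℝ // IsAdjMat N d A} : ℝ)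

/-- expectation of `F` under the uniform measure on `d`-regular graphs on `N` vertices. -/
def Ereg (N d : ℕ) (F : Matrix (Fin N) (Fin N) ℝ → ℝ) : ℝ :=
  (∑ᶠ A : {A : Matrix (Fin N) (Fin N) ℝ // IsAdjMat N d A}, F A.1) /
    (Nat.card {A : Matrix (Fin N) (Fin N) ℝ // IsAdjMat N d A} : ℝ)

/-- the `k`-th largest eigenvalue (`1`-based indexing) of a symmetric matrix. -/
def eigval {N : ℕ} (A : Matrix (Fin N) (Fin N) ℝ) (k : ℕ) : ℝ :=
  if hA : A.IsHermitian then
    if h : k - 1 < N then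
      hA.eigenvalues (Tuple.sort hA.eigenvalues (Fin.rev ⟨k - 1, h⟩))
    else 0
  else 0

/-- `q = √(d(N-d)/N)`. -/
def qval (N d : ℕ) : ℝ := Real.sqrt ((d : ℝ) * ((N : ℝ) - (d : ℝ)) / (N : ℝ))

/-- the projection `P⊥ = I - e eᵀ` (complex version). -/
def Pperp (N : ℕ) : Matrix (Fin N) (Fin N) ℂ := 1 - Matrix.of fun _ _ => (N : ℂ)⁻¹

/-- the projection `P⊥ = I - e eᵀ` (real version). -/
def PperpR (N : ℕ) : Matrix (Fin N) (Fin N) ℝ := 1 - Matrix.of fun _ _ => (N : ℝ)⁻¹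

/-- the Green function `G(z) = P⊥ (q⁻¹𝒜 - z)⁻¹ P⊥`. -/
def greenM (N d : ℕ) (A : Matrix (Fin N) (Fin N) ℝ) (z : ℂ) : Matrix (Fin N) (Fin N) ℂ :=
  Pperp N * (((qval N d : ℝ) : ℂ)⁻¹ • A.map Complex.ofReal - z • 1)⁻¹ * Pperp N

/-- the normalized trace `Ḡ(z) = N⁻¹ Tr G(z)`. -/
def gbar (N d : ℕ) (A : Matrix (Fin N) (Fin N) ℝ) (z : ℂ) : ℂ :=
  (N : ℂ)⁻¹ * (greenM N d A z).trace

/-- the Stieltjes transform of the semicircle density `ϱ(x) = (2π)⁻¹ √((4-x²)₊)`. -/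
def mSC (z : ℂ) : ℂ :=
  ∫ x in (-2 : ℝ)..2, ((Real.sqrt (4 - x ^ 2) / (2 * Real.pi) : ℝ) : ℂ) / ((x : ℂ) - z)

/-- `(Δ_{ij})_{xy} = δ_{ix}δ_{jy} + δ_{iy}δ_{jx}`. -/
def Dmat (N : ℕ) (i j : Fin N) : Matrix (Fin N) (Fin N) ℝ :=
  Matrix.of fun x y =>
    (if i = x ∧ j = y then (1 : ℝ) else 0) + (if i = y ∧ j = x then (1 : ℝ) else 0)

/-- `ξ_{ij}^{kl} = Δ_{ij} + Δ_{kl} - Δ_{ik} - Δ_{jl}`. -/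
def xiMat (N : ℕ) (i j k l : Fin N) : Matrix (Fin N) (Fin N) ℝ :=
  Dmat N i j + Dmat N k l - Dmat N i k - Dmat N j l

/-- `χ_{ij}^{kl}(𝒜) = 𝒜_{ij}(1-𝒜_{ik})𝒜_{kl}(1-𝒜_{jl})`. -/
def chi (N : ℕ) (A : Matrix (Fin N) (Fin N) ℝ) (i j k l : Fin N) : ℝ :=
  A i j * (1 - A i k) * A k l * (1 - A j l)

/-- `𝓜_{ij}(F(𝒜)) = max_{k,l} |F(𝒜 + ξ_{ij}^{kl})|`. -/
def Mmax (N : ℕ) (i j : Fin N) (F : Matrix (Fin N) (Fin N) ℝ → ℝ)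
    (A : Matrix (Fin N) (Fin N) ℝ) : ℝ :=
  ⨆ p : Fin N × Fin N, |F (A + xiMat N i j p.1 p.2)|

instance matMS (N : ℕ) : MeasurableSpace (Matrix (Fin N) (Fin N) ℝ) :=
  show MeasurableSpace (Fin N → Fin N → ℝ) from inferInstance

/-- the GOE: push-forward of independent centered Gaussians with variance `(1+δ_{ij})/N`
on the upper triangle under the symmetrization map. -/
def goeMeasure (N : ℕ) : Measure (Matrix (Fin N) (Fin N) ℝ) :=
  Measure.map (fun f => Matrix.of fun i j => if i ≤ j then f (i, j) else f (j, i))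
    (Measure.pi fun p : Fin N × Fin N =>
      ProbabilityTheory.gaussianReal 0 (if p.1 = p.2 then 2 / N else 1 / N))

/-- the uniform probability measure on `d`-regular graphs on `N` vertices, as a measure. -/
def uniformReg (N d : ℕ) : Measure (Matrix (Fin N) (Fin N) ℝ) :=
  (Nat.card {A : Matrix (Fin N) (Fin N) ℝ // IsAdjMat N d A} : ℝ≥0∞)⁻¹ •
    Measure.sum fun A : {A : Matrix (Fin N) (Fin N) ℝ // IsAdjMat N d A} =>
      Measure.dirac A.1

/-- the matrix flow `A(t) = e^{-t/2} q⁻¹𝒜 + √(1-e^{-t}) W`, where `W = P⊥ H P⊥`. -/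
def flowMat (N d : ℕ) (A H : Matrix (Fin N) (Fin N) ℝ) (t : ℝ) : Matrix (Fin N) (Fin N) ℝ :=
  Real.exp (-t / 2) • ((qval N d)⁻¹ • A) +
    Real.sqrt (1 - Real.exp (-t)) • (PperpR N * H * PperpR N)

/-- the Green function of the matrix flow, `G(t;z) = P⊥ (A(t) - z)⁻¹ P⊥`. -/
def greenFlow (N d : ℕ) (A H : Matrix (Fin N) (Fin N) ℝ) (t : ℝ) (z : ℂ) :
    Matrix (Fin N) (Fin N) ℂ :=
  Pperp N * ((flowMat N d A H t).map Complex.ofReal - z • 1)⁻¹ * Pperp N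

/-- the normalized trace of the Green function of the flow. -/
def gbarFlow (N d : ℕ) (A H : Matrix (Fin N) (Fin N) ℝ) (t : ℝ) (z : ℂ) : ℂ :=
  (N : ℂ)⁻¹ * (greenFlow N d A H t z).trace

namespace RandomRegular

theorem finite_setOf_isAdjMat (N d : ℕ) : {A | IsAdjMat N d A}.Finite := by
  have h : (Set.pi Set.univ fun _ : Fin N => Set.pi Set.univ fun _ : Fin N =>
      ({0, 1} : Set ℝ)).Finite :=
    Set.Finite.pi fun _ => Set.Finite.pi fun _ => by simp
  refine h.subset fun A hA => ?_
  simp only [Set.mem_pi, Set.mem_univ, forall_true_left, Set.mem_insert_iff,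
    Set.mem_singleton_iff]
  exact fun i j => hA.2.2.1 i j

/-- The finite set of adjacency matrices of `d`-regular graphs on `N` vertices. -/
def graphs (N d : ℕ) : Finset (Matrix (Fin N) (Fin N) ℝ) :=
  (finite_setOf_isAdjMat N d).toFinset

theorem mem_graphs {N d : ℕ} {A : Matrix (Fin N) (Fin N) ℝ} :
    A ∈ graphs N d ↔ IsAdjMat N d A := by
  simp [graphs]

open Classical in
theorem PrReg_eq (N d : ℕ) (E : Matrix (Fin N) (Fin N) ℝ → Prop) :
    PrReg N d E = (((graphs N d).filter E).card : ℝ) / ((graphs N d).card : ℝ) := by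
  have h1 : Nat.card {A : Matrix (Fin N) (Fin N) ℝ // IsAdjMat N d A ∧ E A} =
      ((graphs N d).filter E).card :=
    Nat.subtype_card _ fun A => by simp [mem_graphs]
  have h2 : Nat.card {A : Matrix (Fin N) (Fin N) ℝ // IsAdjMat N d A} = (graphs N d).card :=
    Nat.subtype_card _ fun A => mem_graphs
  rw [PrReg, h1, h2]

section Switching

variable {N d : ℕ} {A : Matrix (Fin N) (Fin N) ℝ}

open Classical in
/-- The neighbours of `i` other than `l` that are not neighbours of `l`. -/
def nb (A : Matrix (Fin N) (Fin N) ℝ) (i l : Fin N) : Finset (Fin N) :=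
  Finset.univ.filter fun j => A i j = 1 ∧ A l j = 0 ∧ l ≠ j

theorem mem_nb {i l j : Fin N} : j ∈ nb A i l ↔ A i j = 1 ∧ A l j = 0 ∧ l ≠ j := by
  simp [nb]

variable {E : Type*} [AddCommGroup E] [Module ℝ E]

theorem sum_nb (hA : IsAdjMat N d A) (i l : Fin N) (v : Fin N → E) :
    ∑ j ∈ nb A i l, v j = ∑ j, (A i j * (1 - A l j)) • v j - A i l • v l := by
  classical
  have h : A i l • v l = ∑ j, if l = j then A i l • v l else 0 := by simp
  rw [h, ← Finset.sum_sub_distrib, nb, Finset.sum_filter]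
  refine Finset.sum_congr rfl fun j _ => ?_
  have h0 := hA.2.1 l
  rcases hA.2.2.1 i j with h1 | h1 <;> rcases hA.2.2.1 l j with h2 | h2 <;>
    by_cases h3 : l = j <;> simp_all

theorem card_nb (hA : IsAdjMat N d A) (i l : Fin N) :
    ((nb A i l).card : ℝ) = d - ∑ j, A i j * A l j - A i l := by
  have h := sum_nb hA i l (fun _ => (1 : ℝ))
  simp only [Finset.sum_const, smul_eq_mul, mul_one, nsmul_eq_mul] at h
  rw [h, ← hA.2.2.2 i, ← Finset.sum_sub_distrib]
  congr 1
  exact Finset.sum_congr rfl fun j _ => by ring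

theorem card_nb_comm (hA : IsAdjMat N d A) (i l : Fin N) :
    (nb A i l).card = (nb A l i).card := by
  have h : ((nb A i l).card : ℝ) = (nb A l i).card := by
    rw [card_nb hA, card_nb hA, hA.1.apply i l]
    simp_rw [mul_comm]
  exact_mod_cast h

theorem card_nb_le (hA : IsAdjMat N d A) (i l : Fin N) : ((nb A i l).card : ℝ) ≤ d := by
  have h1 : ∀ x y, 0 ≤ A x y := fun x y => by rcases hA.2.2.1 x y with h | h <;> simp [h]
  have h2 : 0 ≤ ∑ j, A i j * A l j := Finset.sum_nonneg fun j _ => mul_nonneg (h1 _ _) (h1 _ _)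
  linarith [card_nb hA i l, h1 i l]

/-- The switching replacing the edges `ij`, `kl` by `ik`, `jl`. -/
def switch (A : Matrix (Fin N) (Fin N) ℝ) (i l j k : Fin N) : Matrix (Fin N) (Fin N) ℝ :=
  A - xiMat N i j k l

theorem switch_switch (i l j k : Fin N) : switch (switch A i l j k) i l k j = A := by
  ext x y
  simp only [switch, xiMat, Dmat, Matrix.sub_apply, Matrix.add_apply, Matrix.of_apply]
  ring

theorem ne_of_mem_nb (hA : IsAdjMat N d A) {i l j k : Fin N} (hj : j ∈ nb A i l)
    (hk : k ∈ nb A l i) : i ≠ j ∧ l ≠ k ∧ i ≠ k ∧ l ≠ j ∧ j ≠ k ∧ i ≠ l := by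
  rw [mem_nb] at hj hk
  have h0 := hA.2.1
  refine ⟨?_, ?_, hk.2.2, hj.2.2, ?_, ?_⟩ <;> rintro rfl <;> simp_all <;> linarith

theorem switch_apply (hA : IsAdjMat N d A) {i l j k : Fin N} (hj : j ∈ nb A i l)
    (hk : k ∈ nb A l i) (x y : Fin N) :
    switch A i l j k x y =
      if (x = i ∧ y = j) ∨ (x = j ∧ y = i) ∨ (x = l ∧ y = k) ∨ (x = k ∧ y = l) then 0 else
      if (x = i ∧ y = k) ∨ (x = k ∧ y = i) ∨ (x = l ∧ y = j) ∨ (x = j ∧ y = l) then 1 else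
      A x y := by
  obtain ⟨h1, h2, h3, h4, h5, h6⟩ := ne_of_mem_nb hA hj hk
  rw [mem_nb] at hj hk
  have hs := fun a b => hA.1.apply a b
  simp only [switch, xiMat, Dmat, Matrix.sub_apply, Matrix.add_apply, Matrix.of_apply]
  by_cases a1 : x = i
  · subst a1
    by_cases b1 : y = j
    · subst b1; simp_all [eq_comm]
    · by_cases b2 : y = k
      · subst b2; simp_all [eq_comm]
      · simp_all [eq_comm]
  · by_cases a2 : x = j
    · subst a2
      by_cases b1 : y = i
      · subst b1; simp_all [eq_comm]
      · by_cases b2 : y = l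
        · subst b2; simp_all [eq_comm]
        · simp_all [eq_comm]
    · by_cases a3 : x = k
      · subst a3
        by_cases b1 : y = i
        · subst b1; simp_all [eq_comm]
        · by_cases b2 : y = l
          · subst b2; simp_all [eq_comm]
          · simp_all [eq_comm]
      · by_cases a4 : x = l
        · subst a4
          by_cases b1 : y = j
          · subst b1; simp_all [eq_comm]
          · by_cases b2 : y = k
            · subst b2; simp_all [eq_comm]
            · simp_all [eq_comm]
        · simp_all [eq_comm]

theorem sum_Dmat_row (i j x : Fin N) :
    ∑ y, Dmat N i j x y = (if i = x then 1 else 0) + (if j = x then 1 else 0) := by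
  simp only [Dmat, Matrix.of_apply, Finset.sum_add_distrib]
  congr 1
  · by_cases h : i = x <;> simp [h]
  · by_cases h : j = x <;> simp [h]

theorem isAdjMat_switch (hA : IsAdjMat N d A) {i l j k : Fin N} (hj : j ∈ nb A i l)
    (hk : k ∈ nb A l i) : IsAdjMat N d (switch A i l j k) := by
  have hap := switch_apply hA hj hk
  obtain ⟨h1, h2, h3, h4, h5, h6⟩ := ne_of_mem_nb hA hj hk
  refine ⟨?_, ?_, ?_, ?_⟩
  · refine Matrix.IsSymm.ext fun x y => ?_
    have h := hA.1.apply x y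
    rw [hap, hap, h]
    refine if_congr (by tauto) rfl (if_congr (by tauto) rfl rfl)
  · intro x
    rw [hap, if_neg, if_neg, hA.2.1] <;> grind
  · intro x y
    rw [hap]
    have := hA.2.2.1 x y
    split_ifs <;> simp_all
  · intro x
    simp only [switch, xiMat, Matrix.sub_apply, Matrix.add_apply, Finset.sum_sub_distrib,
      Finset.sum_add_distrib, sum_Dmat_row, hA.2.2.2 x]
    ring

theorem mem_nb_switch (hA : IsAdjMat N d A) {i l j k : Fin N} (hj : j ∈ nb A i l)
    (hk : k ∈ nb A l i) :
    k ∈ nb (switch A i l j k) i l ∧ j ∈ nb (switch A i l j k) l i := by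
  have hap := switch_apply hA hj hk
  obtain ⟨h1, h2, h3, h4, h5, h6⟩ := ne_of_mem_nb hA hj hk
  rw [mem_nb, mem_nb, hap, hap, hap, hap]
  grind

theorem card_nb_switch (hA : IsAdjMat N d A) {i l j k : Fin N} (hj : j ∈ nb A i l)
    (hk : k ∈ nb A l i) : (nb (switch A i l j k) i l).card = (nb A i l).card := by
  have hap := switch_apply hA hj hk
  obtain ⟨h1, h2, h3, h4, h5, h6⟩ := ne_of_mem_nb hA hj hk
  have h : nb (switch A i l j k) i l = insert k ((nb A i l).erase j) := by
    ext y
    rw [Finset.mem_insert, Finset.mem_erase, mem_nb, mem_nb, hap, hap]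
    grind
  rw [h, Finset.card_insert_of_notMem, Finset.card_erase_add_one hj]
  rw [mem_nb] at hk
  simp [mem_nb, hk]

/-- The weighted sum over all switchings at the vertex `i`. -/
def wsum (A : Matrix (Fin N) (Fin N) ℝ) (i : Fin N) (f : Fin N → Fin N → Fin N → E) : E :=
  ∑ l, ((nb A i l).card : ℝ)⁻¹ • ∑ j ∈ nb A i l, ∑ k ∈ nb A l i, f l j k

theorem sum_wsum_switch (i : Fin N)
    (Φ : Matrix (Fin N) (Fin N) ℝ → Matrix (Fin N) (Fin N) ℝ → Fin N → Fin N → E) :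
    ∑ A ∈ graphs N d, wsum A i (fun l j k => Φ A (switch A i l j k) j k) =
      ∑ A ∈ graphs N d, wsum A i (fun l j k => Φ (switch A i l j k) A k j) := by
  simp only [wsum]
  rw [Finset.sum_comm, Finset.sum_comm (s := graphs N d)]
  refine Finset.sum_congr rfl fun l _ => ?_
  simp_rw [Finset.smul_sum, ← Finset.sum_product']
  rw [Finset.sum_sigma', Finset.sum_sigma']
  refine Finset.sum_bij' (fun p _ => ⟨switch p.1 i l p.2.1 p.2.2, (p.2.2, p.2.1)⟩)
    (fun p _ => ⟨switch p.1 i l p.2.1 p.2.2, (p.2.2, p.2.1)⟩) ?_ ?_ ?_ ?_ ?_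
  · rintro ⟨A, j, k⟩ h
    simp only [Finset.mem_sigma, Finset.mem_product, mem_graphs] at h ⊢
    exact ⟨isAdjMat_switch h.1 h.2.1 h.2.2, mem_nb_switch h.1 h.2.1 h.2.2⟩
  · rintro ⟨A, j, k⟩ h
    simp only [Finset.mem_sigma, Finset.mem_product, mem_graphs] at h ⊢
    exact ⟨isAdjMat_switch h.1 h.2.1 h.2.2, mem_nb_switch h.1 h.2.1 h.2.2⟩
  · rintro ⟨A, j, k⟩ h
    simp [switch_switch]
  · rintro ⟨A, j, k⟩ h
    simp [switch_switch]
  · rintro ⟨A, j, k⟩ h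
    simp only [Finset.mem_sigma, Finset.mem_product, mem_graphs] at h
    simp only [switch_switch, card_nb_switch h.1 h.2.1 h.2.2]

end Switching

section WeightedSums

variable {N d : ℕ} {A : Matrix (Fin N) (Fin N) ℝ} {i : Fin N}

theorem _root_.IsAdjMat.nonneg (hA : IsAdjMat N d A) (x y : Fin N) : 0 ≤ A x y := by
  rcases hA.2.2.1 x y with h | h <;> simp [h]

theorem _root_.IsAdjMat.le_one (hA : IsAdjMat N d A) (x y : Fin N) : A x y ≤ 1 := by
  rcases hA.2.2.1 x y with h | h <;> simp [h]

theorem _root_.IsAdjMat.col_sum (hA : IsAdjMat N d A) (y : Fin N) : ∑ x, A x y = d := by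
  rw [← hA.2.2.2 y]
  exact Finset.sum_congr rfl fun x _ => hA.1.apply y x

section Module

variable {E : Type*} [AddCommGroup E] [Module ℝ E]

theorem wsum_congr {f g : Fin N → Fin N → Fin N → E}
    (h : ∀ l, ∀ j ∈ nb A i l, ∀ k ∈ nb A l i, f l j k = g l j k) : wsum A i f = wsum A i g := by
  unfold wsum
  refine Finset.sum_congr rfl fun l _ => ?_
  congr 1
  exact Finset.sum_congr rfl fun j hj => Finset.sum_congr rfl fun k hk => h l j hj k hk

theorem wsum_add (f g : Fin N → Fin N → Fin N → E) :
    wsum A i (fun l j k => f l j k + g l j k) = wsum A i f + wsum A i g := by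
  simp only [wsum, Finset.sum_add_distrib, smul_add]

theorem wsum_sub (f g : Fin N → Fin N → Fin N → E) :
    wsum A i (fun l j k => f l j k - g l j k) = wsum A i f - wsum A i g := by
  simp only [wsum, Finset.sum_sub_distrib, smul_sub]

theorem wsum_left (v : Fin N → Fin N → E) (hA : IsAdjMat N d A) :
    wsum A i (fun l j _ => v l j) = ∑ l, ∑ j ∈ nb A i l, v l j := by
  unfold wsum
  refine Finset.sum_congr rfl fun l _ => ?_
  simp only [Finset.sum_const, ← card_nb_comm hA i l]
  rw [← Finset.smul_sum, ← Nat.cast_smul_eq_nsmul ℝ, smul_smul]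
  by_cases h : (nb A i l).card = 0
  · rw [Finset.card_eq_zero] at h
    simp [h]
  · rw [inv_mul_cancel₀ (by exact_mod_cast h), one_smul]

theorem wsum_right (v : Fin N → Fin N → E) (hA : IsAdjMat N d A) :
    wsum A i (fun l _ k => v l k) = ∑ l, ∑ k ∈ nb A l i, v l k := by
  unfold wsum
  refine Finset.sum_congr rfl fun l _ => ?_
  simp only [Finset.sum_const]
  rw [← Nat.cast_smul_eq_nsmul ℝ, smul_smul]
  by_cases h : (nb A i l).card = 0
  · have h' := h
    rw [card_nb_comm hA, Finset.card_eq_zero] at h'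
    simp [h']
  · rw [inv_mul_cancel₀ (by exact_mod_cast h), one_smul]

theorem wsum_sub_eq (hA : IsAdjMat N d A) (v : Fin N → E) :
    wsum A i (fun _ j k => v j - v k) =
      (N : ℝ) • ∑ j, A i j • v j - (d : ℝ) • ∑ j, v j - ∑ j, A i j • v j + (d : ℝ) • v i := by
  rw [wsum_sub, wsum_left (fun _ j => v j) hA, wsum_right (fun _ k => v k) hA,
    ← Finset.sum_sub_distrib]
  have h : ∀ l, ∑ j ∈ nb A i l, v j - ∑ k ∈ nb A l i, v k =
      (∑ j, A i j • v j - ∑ j, A l j • v j) - A i l • v l + A l i • v i := by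
    intro l
    rw [sum_nb hA, sum_nb hA]
    have : ∑ j, (A i j * (1 - A l j)) • v j - ∑ j, (A l j * (1 - A i j)) • v j =
        ∑ j, A i j • v j - ∑ j, A l j • v j := by
      rw [← Finset.sum_sub_distrib, ← Finset.sum_sub_distrib]
      refine Finset.sum_congr rfl fun j _ => ?_
      rw [← sub_smul, ← sub_smul]
      congr 1
      ring
    rw [← this]
    abel
  simp_rw [h]
  rw [Finset.sum_add_distrib, Finset.sum_sub_distrib, Finset.sum_sub_distrib, ← Finset.sum_smul,
    hA.col_sum, Finset.sum_comm (f := fun l j => A l j • v j)]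
  simp_rw [← Finset.sum_smul, hA.col_sum, ← Finset.smul_sum]
  simp [← Nat.cast_smul_eq_nsmul ℝ]

end Module

theorem wsum_mul_left (c : ℝ) (f : Fin N → Fin N → Fin N → ℝ) :
    wsum A i (fun l j k => c * f l j k) = c * wsum A i f := by
  simp only [wsum, ← Finset.mul_sum, smul_eq_mul]
  rw [Finset.mul_sum]
  exact Finset.sum_congr rfl fun l _ => by ring

theorem wsum_mul_right_complex (f : Fin N → Fin N → Fin N → ℂ) (c : ℂ) :
    wsum A i (fun l j k => f l j k * c) = wsum A i f * c := by
  simp only [wsum, ← Finset.sum_mul, ← smul_mul_assoc]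

theorem wsum_le {f g : Fin N → Fin N → Fin N → ℝ}
    (h : ∀ l, ∀ j ∈ nb A i l, ∀ k ∈ nb A l i, f l j k ≤ g l j k) : wsum A i f ≤ wsum A i g := by
  unfold wsum
  refine Finset.sum_le_sum fun l _ => ?_
  simp only [smul_eq_mul]
  gcongr with j hj k hk
  exact h l j hj k hk

theorem norm_wsum_le (f : Fin N → Fin N → Fin N → ℂ) :
    ‖wsum A i f‖ ≤ wsum A i (fun l j k => ‖f l j k‖) := by
  unfold wsum
  refine (norm_sum_le _ _).trans (Finset.sum_le_sum fun l _ => ?_)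
  rw [norm_smul, Real.norm_of_nonneg (by positivity), smul_eq_mul]
  gcongr
  exact (norm_sum_le _ _).trans (Finset.sum_le_sum fun j _ => norm_sum_le _ _)

theorem norm_wsum_le_of {f : Fin N → Fin N → Fin N → ℂ} {g : Fin N → Fin N → Fin N → ℝ}
    (h : ∀ l, ∀ j ∈ nb A i l, ∀ k ∈ nb A l i, ‖f l j k‖ ≤ g l j k) :
    ‖wsum A i f‖ ≤ wsum A i g :=
  (norm_wsum_le f).trans (wsum_le h)

theorem sum_nb_le (hA : IsAdjMat N d A) (l m : Fin N) {v : Fin N → ℝ} (hv : ∀ k, 0 ≤ v k) :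
    ∑ k ∈ nb A l m, v k ≤ ∑ k, A l k * v k := by
  rw [sum_nb hA]
  simp only [smul_eq_mul]
  have h : ∑ k, A l k * (1 - A m k) * v k ≤ ∑ k, A l k * v k := by
    refine Finset.sum_le_sum fun k _ => ?_
    have := mul_nonneg (mul_nonneg (hA.nonneg l k) (hA.nonneg m k)) (hv k)
    linarith
  linarith [mul_nonneg (hA.nonneg l m) (hv m)]

theorem wsum_right_le (hA : IsAdjMat N d A) {v : Fin N → ℝ} (hv : ∀ k, 0 ≤ v k) :
    wsum A i (fun _ _ k => v k) ≤ d * ∑ k, v k := by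
  rw [wsum_right (fun _ k => v k) hA]
  calc ∑ l, ∑ k ∈ nb A l i, v k ≤ ∑ l, ∑ k, A l k * v k :=
        Finset.sum_le_sum fun l _ => sum_nb_le hA l i hv
    _ = d * ∑ k, v k := by
        rw [Finset.sum_comm, Finset.mul_sum]
        exact Finset.sum_congr rfl fun k _ => by rw [← Finset.sum_mul, hA.col_sum]

theorem wsum_mid_le (hA : IsAdjMat N d A) {v : Fin N → ℝ} (hv : ∀ k, 0 ≤ v k) :
    wsum A i (fun l _ _ => v l) ≤ d * ∑ k, v k := by
  rw [wsum_right (fun l _ => v l) hA, Finset.mul_sum]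
  refine Finset.sum_le_sum fun l _ => ?_
  rw [Finset.sum_const, nsmul_eq_mul]
  exact mul_le_mul_of_nonneg_right (card_nb_le hA l i) (hv l)

theorem wsum_const_le (hA : IsAdjMat N d A) {c : ℝ} (hc : 0 ≤ c) :
    wsum A i (fun _ _ _ => c) ≤ N * d * c := by
  refine (wsum_mid_le (v := fun _ => c) hA fun _ => hc).trans (le_of_eq ?_)
  simp
  ring

theorem wsum_ite_left_le (hA : IsAdjMat N d A) (x : Fin N) :
    wsum A i (fun _ j _ => if j = x then (1 : ℝ) else 0) ≤ N := by
  rw [wsum_left (fun _ j => if j = x then (1 : ℝ) else 0) hA]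
  calc ∑ l, ∑ j ∈ nb A i l, (if j = x then (1 : ℝ) else 0) ≤ ∑ _l : Fin N, (1 : ℝ) := by
        refine Finset.sum_le_sum fun l _ => ?_
        rw [Finset.sum_ite_eq']
        split_ifs <;> norm_num
    _ = N := by simp

theorem wsum_ite_right_le (hA : IsAdjMat N d A) (x : Fin N) :
    wsum A i (fun _ _ k => if k = x then (1 : ℝ) else 0) ≤ N := by
  rw [wsum_right (fun _ k => if k = x then (1 : ℝ) else 0) hA]
  calc ∑ l, ∑ k ∈ nb A l i, (if k = x then (1 : ℝ) else 0) ≤ ∑ _l : Fin N, (1 : ℝ) := by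
        refine Finset.sum_le_sum fun l _ => ?_
        rw [Finset.sum_ite_eq']
        split_ifs <;> norm_num
    _ = N := by simp

/-- A bound for sums over pairs of vertices from the two neighbourhoods being switched, in terms
of row sums `R` and row sums of squares `Q` of the summand. -/
theorem wsum_pair_le (hA : IsAdjMat N d A) (hd : 1 ≤ d) {w : Fin N → Fin N → ℝ} {R Q : ℝ}
    (hw : ∀ k j, 0 ≤ w k j) (hR : ∀ j, ∑ k, w k j ≤ R) (hQ : ∀ j, ∑ k, w k j ^ 2 ≤ Q) :
    wsum A i (fun _ j k => w k j) ≤ 4 * d * R + 3 * d * √(d * Q) := by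
  have hd' : (1 : ℝ) ≤ d := by exact_mod_cast hd
  have hQ0 : 0 ≤ Q := (Finset.sum_nonneg fun k _ => sq_nonneg _).trans (hQ i)
  set c : Fin N → ℝ := fun l => ∑ j, A i j * A l j + A i l with hc
  have hc0 : ∀ l, 0 ≤ c l := fun l => add_nonneg
    (Finset.sum_nonneg fun j _ => mul_nonneg (hA.nonneg _ _) (hA.nonneg _ _)) (hA.nonneg _ _)
  have hs : ∀ l, ((nb A i l).card : ℝ) = d - c l := fun l => by rw [card_nb hA, hc]; ring
  have hterm : ∀ l, ((nb A i l).card : ℝ)⁻¹ • ∑ j ∈ nb A i l, ∑ k ∈ nb A l i, w k j ≤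
      4 / d * (∑ j, A i j * ∑ k, A l k * w k j) + √(d * Q) * (4 / (3 * d) * c l) := by
    intro l
    have hS0 : 0 ≤ ∑ j ∈ nb A i l, ∑ k ∈ nb A l i, w k j :=
      Finset.sum_nonneg fun j _ => Finset.sum_nonneg fun k _ => hw k j
    have hS1 : ∑ j ∈ nb A i l, ∑ k ∈ nb A l i, w k j ≤ ∑ j, A i j * ∑ k, A l k * w k j := by
      refine (sum_nb_le hA i l fun j => Finset.sum_nonneg fun k _ => hw k j).trans ?_
      exact Finset.sum_le_sum fun j _ => mul_le_mul_of_nonneg_left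
        (sum_nb_le hA l i fun k => hw k j) (hA.nonneg _ _)
    have hT0 : 0 ≤ ∑ j, A i j * ∑ k, A l k * w k j := hS0.trans hS1
    have hsq0 : 0 ≤ √(d * Q) := Real.sqrt_nonneg _
    rw [smul_eq_mul]
    by_cases hgood : (d : ℝ) / 4 ≤ (nb A i l).card
    · have h1 : ((nb A i l).card : ℝ)⁻¹ ≤ 4 / d := by
        rw [inv_le_comm₀ (by linarith) (by positivity)]
        rw [inv_div]
        exact hgood
      have h2 : 0 ≤ √(d * Q) * (4 / (3 * d) * c l) := by
        have := hc0 l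
        positivity
      have h3 := mul_le_mul h1 hS1 hS0 (by positivity)
      linarith
    · push Not at hgood
      have h1 : 1 ≤ 4 / (3 * d) * c l := by
        rw [hs] at hgood
        rw [div_mul_eq_mul_div, le_div_iff₀ (by positivity)]
        linarith
      have h2 : ((nb A i l).card : ℝ)⁻¹ * ∑ j ∈ nb A i l, ∑ k ∈ nb A l i, w k j ≤ √(d * Q) := by
        have h3 : ∀ j, ∑ k ∈ nb A l i, w k j ≤ √(d * Q) := by
          intro j
          refine Real.le_sqrt_of_sq_le ?_
          refine (sq_sum_le_card_mul_sum_sq).trans ?_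
          refine mul_le_mul (card_nb_le hA l i) ?_ (Finset.sum_nonneg fun k _ => sq_nonneg _)
            (by positivity)
          exact (Finset.sum_le_sum_of_subset_of_nonneg (Finset.subset_univ _)
            fun k _ _ => sq_nonneg _).trans (hQ j)
        by_cases h0 : (nb A i l).card = 0
        · rw [h0, Nat.cast_zero, _root_.inv_zero, zero_mul]
          exact hsq0
        · have h0' : (0 : ℝ) < (nb A i l).card := by exact_mod_cast Nat.pos_of_ne_zero h0
          rw [inv_mul_le_iff₀ h0']
          refine (Finset.sum_le_sum fun j _ => h3 j).trans ?_
          simp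
      have h4 : 0 ≤ 4 / d * (∑ j, A i j * ∑ k, A l k * w k j) := by positivity
      nlinarith
  unfold wsum
  refine (Finset.sum_le_sum fun l _ => hterm l).trans ?_
  rw [Finset.sum_add_distrib, ← Finset.mul_sum, ← Finset.mul_sum, ← Finset.mul_sum]
  have hsumc : ∑ l, c l = d * d + d := by
    rw [hc, Finset.sum_add_distrib, hA.2.2.2, Finset.sum_comm]
    simp_rw [← Finset.mul_sum, hA.col_sum, ← Finset.sum_mul, hA.2.2.2]
  have hsum1 : ∑ l, ∑ j, A i j * ∑ k, A l k * w k j ≤ d * (d * R) := by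
    rw [Finset.sum_comm]
    simp_rw [← Finset.mul_sum]
    have : ∀ j, ∑ l, ∑ k, A l k * w k j = d * ∑ k, w k j := by
      intro j
      rw [Finset.sum_comm, Finset.mul_sum]
      exact Finset.sum_congr rfl fun k _ => by rw [← Finset.sum_mul, hA.col_sum]
    simp_rw [this]
    rw [← hA.2.2.2 i, Finset.sum_mul]
    refine Finset.sum_le_sum fun j _ => mul_le_mul_of_nonneg_left ?_ (hA.nonneg _ _)
    rw [hA.2.2.2 i]
    exact mul_le_mul_of_nonneg_left (hR j) (by positivity)
  rw [hsumc]
  have h5 : 4 / (d : ℝ) * ∑ l, ∑ j, A i j * ∑ k, A l k * w k j ≤ 4 * d * R := by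
    refine (mul_le_mul_of_nonneg_left hsum1 (by positivity)).trans (le_of_eq ?_)
    field_simp
  have h6 : 4 / (3 * (d : ℝ)) * (d * d + d) ≤ 3 * d := by
    rw [div_mul_eq_mul_div, div_le_iff₀ (by positivity)]
    nlinarith
  have h7 := mul_le_mul_of_nonneg_left h6 (Real.sqrt_nonneg (d * Q))
  linarith

end WeightedSums

section Green

variable {N d : ℕ} {A B : Matrix (Fin N) (Fin N) ℝ} {q : ℝ} {z w : ℂ}
  {G H : Matrix (Fin N) (Fin N) ℂ}

/-- The equations characterising the Green function of `q⁻¹ A` on the complement of constants. -/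
structure IsGreen (q : ℝ) (A : Matrix (Fin N) (Fin N) ℝ) (z : ℂ)
    (G : Matrix (Fin N) (Fin N) ℂ) : Prop where
  symm : Gᵀ = G
  sum_row : ∀ x, ∑ y, G x y = 0
  mul_eq : A.map Complex.ofReal * G = (q : ℂ) • (Pperp N + z • G)

theorem Pperp_apply (x y : Fin N) : Pperp N x y = (if x = y then 1 else 0) - (N : ℂ)⁻¹ := by
  simp [Pperp, Matrix.one_apply]

theorem Pperp_transpose : (Pperp N)ᵀ = Pperp N := by
  ext x y
  simp [Pperp_apply, eq_comm]

theorem sum_Pperp (x : Fin N) : ∑ y, Pperp N x y = 0 := by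
  have : (N : ℂ) ≠ 0 := by
    have := x.pos
    exact_mod_cast this.ne'
  simp [Pperp_apply, this]

open scoped ComplexOrder in
theorem isUnit_sub_smul_one (hA : A.IsSymm) (c : ℝ) (hz : z.im ≠ 0) :
    IsUnit ((c : ℂ) • A.map Complex.ofReal - z • (1 : Matrix (Fin N) (Fin N) ℂ)) := by
  rw [← Matrix.mulVec_injective_iff_isUnit]
  set S : Matrix (Fin N) (Fin N) ℂ := (c : ℂ) • A.map Complex.ofReal with hS
  have hSh : Sᴴ = S := by
    ext x y
    simp [hS, Matrix.conjTranspose_apply, hA.apply x y]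
  have key : ∀ v : Fin N → ℂ, (S - z • 1) *ᵥ v = 0 → v = 0 := by
    intro v hv
    have h1 : S *ᵥ v = z • v := by
      rw [Matrix.sub_mulVec, Matrix.smul_mulVec (b := z), Matrix.one_mulVec] at hv
      exact sub_eq_zero.mp hv
    have h2 : star v ⬝ᵥ (S *ᵥ v) = z * (star v ⬝ᵥ v) := by
      rw [h1, dotProduct_smul, smul_eq_mul]
    have h3 : star (star v ⬝ᵥ (S *ᵥ v)) = star v ⬝ᵥ (S *ᵥ v) := by
      rw [← Matrix.star_dotProduct, Matrix.star_mulVec, hSh, ← Matrix.dotProduct_mulVec]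
    have h4 : star (star v ⬝ᵥ v) = star v ⬝ᵥ v := by
      rw [← Matrix.star_dotProduct]
    rw [h2, star_mul', h4] at h3
    by_contra hne
    have h5 : star v ⬝ᵥ v ≠ 0 := fun h => hne (dotProduct_star_self_eq_zero.mp h)
    have h6 := mul_right_cancel₀ h5 h3
    exact hz (Complex.conj_eq_iff_im.mp h6)
  intro v w hvw
  have := key (v - w) (by rw [Matrix.mulVec_sub]; exact sub_eq_zero.mpr hvw)
  exact sub_eq_zero.mp this

theorem Pperp_comm (hA : IsAdjMat N d A) :
    A.map Complex.ofReal * Pperp N = Pperp N * A.map Complex.ofReal := by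
  have e1 : (Matrix.of fun _ _ => (N : ℂ)⁻¹ : Matrix (Fin N) (Fin N) ℂ) * A.map Complex.ofReal =
      A.map Complex.ofReal * Matrix.of fun _ _ => (N : ℂ)⁻¹ := by
    ext x y
    simp only [Matrix.mul_apply, Matrix.of_apply, Matrix.map_apply]
    rw [← Finset.mul_sum, ← Finset.sum_mul, ← Complex.ofReal_sum, ← Complex.ofReal_sum,
      hA.2.2.2, hA.col_sum, mul_comm]
  rw [Pperp, Matrix.mul_sub, Matrix.sub_mul, e1, Matrix.mul_one, Matrix.one_mul]

theorem Pperp_mul_Pperp : Pperp N * Pperp N = Pperp N := by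
  ext x y
  have h : (N : ℂ) ≠ 0 := by exact_mod_cast x.pos.ne'
  rw [Matrix.mul_apply]
  simp only [Pperp_apply, sub_mul, mul_sub, Finset.sum_sub_distrib]
  simp
  field_simp
  ring

theorem isGreen_greenM (hA : IsAdjMat N d A) (hq : 0 < qval N d) (hz : z.im ≠ 0) :
    IsGreen (qval N d) A z (greenM N d A z) := by
  set q := qval N d
  set S : Matrix (Fin N) (Fin N) ℂ := ((q : ℂ)⁻¹ • A.map Complex.ofReal - z • 1) with hS
  have hu : IsUnit S := by
    have := isUnit_sub_smul_one (N := N) hA.1 (q⁻¹) hz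
    rwa [Complex.ofReal_inv] at this
  have hdet : IsUnit S.det := (Matrix.isUnit_iff_isUnit_det S).mp hu
  have hG : greenM N d A z = Pperp N * S⁻¹ * Pperp N := rfl
  have hq' : (q : ℂ) ≠ 0 := by exact_mod_cast hq.ne'
  have hST : Sᵀ = S := by
    rw [hS, Matrix.transpose_sub, Matrix.transpose_smul, Matrix.transpose_smul,
      Matrix.transpose_one, ← Matrix.transpose_map, hA.1.eq]
  refine ⟨?_, fun x => ?_, ?_⟩
  · rw [hG, Matrix.transpose_mul, Matrix.transpose_mul, Pperp_transpose,
      Matrix.transpose_nonsing_inv, hST, Matrix.mul_assoc]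
  · rw [hG]
    simp only [Matrix.mul_apply (M := Pperp N * S⁻¹)]
    rw [Finset.sum_comm]
    simp [← Finset.mul_sum, sum_Pperp]
  · have h1 : A.map Complex.ofReal = (q : ℂ) • (S + z • 1) := by
      rw [hS, sub_add_cancel, smul_smul, mul_inv_cancel₀ hq', one_smul]
    rw [hG, ← Matrix.mul_assoc, ← Matrix.mul_assoc, Pperp_comm hA, h1]
    simp only [Matrix.mul_smul, Matrix.smul_mul, Matrix.mul_add, Matrix.add_mul, Matrix.mul_one]
    rw [Matrix.mul_nonsing_inv_cancel_right _ _ hdet, Pperp_mul_Pperp]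

namespace IsGreen

theorem comm (hG : IsGreen q A z G) (x y : Fin N) : G x y = G y x := by
  conv_lhs => rw [← hG.symm]
  rfl

theorem sum_col (hG : IsGreen q A z G) (y : Fin N) : ∑ x, G x y = 0 := by
  simp_rw [fun x => hG.comm x y]
  exact hG.sum_row y

theorem mul_apply (hG : IsGreen q A z G) (x y : Fin N) :
    ∑ j, (A x j : ℂ) * G j y = q * ((if x = y then 1 else 0) - (N : ℂ)⁻¹ + z * G x y) := by
  have := congr_fun (congr_fun hG.mul_eq x) y
  simpa [Matrix.mul_apply, Pperp_apply] using this

theorem mul_Pperp (hG : IsGreen q A z G) : G * Pperp N = G := by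
  rw [Pperp, Matrix.mul_sub, Matrix.mul_one]
  have : G * (Matrix.of fun _ _ => (N : ℂ)⁻¹) = 0 := by
    ext x y
    simp [Matrix.mul_apply, ← Finset.sum_mul, hG.sum_row]
  rw [this, sub_zero]

theorem Pperp_mul (hG : IsGreen q A z G) : Pperp N * G = G := by
  rw [← Matrix.transpose_transpose (Pperp N * G), Matrix.transpose_mul, hG.symm, Pperp_transpose,
    hG.mul_Pperp, hG.symm]

theorem eq_mul (hA : A.IsSymm) (hG : IsGreen q A z G) :
    G * A.map Complex.ofReal = (q : ℂ) • (Pperp N + z • G) := by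
  rw [← Matrix.transpose_transpose (G * _), Matrix.transpose_mul, hG.symm, ← Matrix.transpose_map,
    hA.eq, hG.mul_eq, Matrix.transpose_smul, Matrix.transpose_add, Matrix.transpose_smul, hG.symm,
    Pperp_transpose]

/-- Resolvent identity. -/
theorem sub_eq (hA : A.IsSymm) (hq : q ≠ 0) (hG : IsGreen q A z G) (hH : IsGreen q B w H) :
    G - H = (z - w) • (G * H) + (q : ℂ)⁻¹ • (G * (B - A).map Complex.ofReal * H) := by
  have hq' : (q : ℂ) ≠ 0 := by exact_mod_cast hq
  have h1 : (B - A).map Complex.ofReal = B.map Complex.ofReal - A.map Complex.ofReal := by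
    ext; simp
  rw [h1, Matrix.mul_sub, Matrix.sub_mul, Matrix.mul_assoc, hH.mul_eq, hG.eq_mul hA,
    Matrix.smul_mul, Matrix.mul_smul, ← smul_sub, smul_smul, inv_mul_cancel₀ hq', one_smul,
    Matrix.mul_add, Matrix.add_mul, hG.mul_Pperp, hH.Pperp_mul, Matrix.mul_smul, Matrix.smul_mul,
    sub_smul]
  abel

theorem sub_eq_mul (hA : A.IsSymm) (hq : q ≠ 0) (hG : IsGreen q A z G) (hH : IsGreen q A w H) :
    G - H = (z - w) • (G * H) := by
  have h0 : ((0 : Matrix (Fin N) (Fin N) ℝ).map Complex.ofReal) = 0 := by ext; simp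
  rw [hG.sub_eq hA hq hH, sub_self, h0, Matrix.mul_zero, Matrix.zero_mul, smul_zero, add_zero]

theorem conj (hG : IsGreen q A z G) : IsGreen q A (starRingEnd ℂ z) (G.map (starRingEnd ℂ)) := by
  refine ⟨?_, fun x => ?_, ?_⟩
  · rw [← Matrix.transpose_map, hG.symm]
  · simp only [Matrix.map_apply, ← map_sum, hG.sum_row, map_zero]
  · ext x y
    have := congr_arg (starRingEnd ℂ) (hG.mul_apply x y)
    simp only [map_sum, map_mul, map_add, map_sub, Complex.conj_ofReal, map_inv₀, map_natCast,
      apply_ite (starRingEnd ℂ), map_one, map_zero] at this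
    simpa [Matrix.mul_apply, Pperp_apply] using this

/-- Ward identity. -/
theorem ward (hA : A.IsSymm) (hq : q ≠ 0) (hG : IsGreen q A z G) (x : Fin N) :
    z.im * ∑ y, ‖G x y‖ ^ 2 = (G x x).im := by
  have h := congr_fun (congr_fun (hG.sub_eq_mul hA hq hG.conj) x) x
  simp only [Matrix.sub_apply, Matrix.map_apply, Matrix.smul_apply,
    smul_eq_mul, Matrix.mul_apply] at h
  have h2 : ∀ y, G x y * starRingEnd ℂ (G y x) = ((‖G x y‖ ^ 2 : ℝ) : ℂ) := fun y => by
    rw [hG.comm y x, Complex.mul_conj, Complex.normSq_eq_norm_sq]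
  simp only [h2, Complex.sub_conj, ← Complex.ofReal_sum] at h
  have h3 := congr_arg Complex.im h
  simp only [Complex.re_ofReal_mul, Complex.I_im,
    Complex.mul_im, Complex.ofReal_im, Complex.ofReal_re, Complex.I_re, mul_zero, mul_one,
    add_zero] at h3
  linarith

theorem sum_sq_le (hA : A.IsSymm) (hq : q ≠ 0) (hz : 0 < z.im) (hG : IsGreen q A z G)
    (x : Fin N) : ∑ y, ‖G x y‖ ^ 2 ≤ ‖G x x‖ / z.im := by
  rw [le_div_iff₀ hz, mul_comm, hG.ward hA hq]
  exact (le_abs_self _).trans (Complex.abs_im_le_norm _)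

theorem norm_le_inv (hA : A.IsSymm) (hq : q ≠ 0) (hz : 0 < z.im) (hG : IsGreen q A z G)
    (x y : Fin N) : ‖G x y‖ ≤ z.im⁻¹ := by
  have h1 : ∀ y, ‖G x y‖ ^ 2 ≤ ‖G x x‖ / z.im := fun y =>
    (Finset.single_le_sum (f := fun y => ‖G x y‖ ^ 2) (fun _ _ => sq_nonneg _)
      (Finset.mem_univ y)).trans (hG.sum_sq_le hA hq hz x)
  have h2 : ‖G x x‖ ≤ z.im⁻¹ := by
    have h := h1 x
    rw [div_eq_mul_inv, sq] at h
    by_contra! hlt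
    have hp : 0 < ‖G x x‖ := lt_trans (inv_pos.mpr hz) hlt
    exact absurd (le_of_mul_le_mul_left h hp) (not_le.mpr hlt)
  have h3 : ‖G x y‖ ^ 2 ≤ z.im⁻¹ ^ 2 := by
    refine (h1 y).trans ?_
    rw [div_eq_mul_inv, sq]
    exact mul_le_mul_of_nonneg_right h2 (inv_nonneg.mpr hz.le)
  exact (sq_le_sq₀ (norm_nonneg _) (inv_nonneg.mpr hz.le)).mp h3

theorem sum_mul_norm_le (hA : A.IsSymm) (hB : B.IsSymm) (hq : q ≠ 0) (hz : 0 < z.im)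
    (hw : 0 < w.im) (hG : IsGreen q A z G) (hH : IsGreen q B w H) (x y : Fin N) :
    ‖(G * H) x y‖ ≤ √(‖G x x‖ / z.im) * √(‖H y y‖ / w.im) := by
  rw [Matrix.mul_apply]
  refine (norm_sum_le _ _).trans ?_
  simp only [norm_mul]
  refine (Real.sum_mul_le_sqrt_mul_sqrt _ _ _).trans ?_
  gcongr
  · exact hG.sum_sq_le hA hq hz x
  · simp_rw [fun i => hH.comm i y]
    exact hH.sum_sq_le hB hq hw y

theorem norm_le_of_smaller_im (hA : A.IsSymm) (hq : q ≠ 0) {Γ M : ℝ} (hw : 0 < w.im)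
    (hre : z.re = w.re) (him : w.im ≤ z.im) (hM : z.im ≤ M * w.im)
    (hG : IsGreen q A z G) (hH : IsGreen q A w H) (hΓ : ∀ x y, ‖G x y‖ ≤ Γ) (x y : Fin N) :
    ‖H x y‖ ≤ (2 + M) * Γ := by
  have hz : 0 < z.im := lt_of_lt_of_le hw him
  have hΓ0 : 0 ≤ Γ := (norm_nonneg _).trans (hΓ x x)
  have hM1 : 1 ≤ M := by
    by_contra! h
    nlinarith
  have h1 : ∀ x y, ‖H x y‖ ≤ Γ + √(M * Γ * ‖H y y‖) := by
    intro x y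
    have h := congr_fun (congr_fun (hG.sub_eq_mul hA hq hH) x) y
    simp only [Matrix.sub_apply, Matrix.smul_apply, smul_eq_mul] at h
    have h2 : H x y = G x y - (z - w) * (G * H) x y := by rw [← h]; ring
    have h3 : ‖z - w‖ = z.im - w.im := by
      have : z - w = ((z.im - w.im : ℝ) : ℂ) * Complex.I := by
        apply Complex.ext <;> simp [hre]
      rw [this, norm_mul, Complex.norm_I, mul_one, Complex.norm_real, Real.norm_eq_abs,
        abs_of_nonneg (sub_nonneg.mpr him)]
    rw [h2]
    refine (norm_sub_le _ _).trans (add_le_add (hΓ x y) ?_)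
    rw [norm_mul, h3]
    have h4 := hG.sum_mul_norm_le hA hA hq hz hw hH x y
    calc (z.im - w.im) * ‖(G * H) x y‖
        ≤ z.im * (√(‖G x x‖ / z.im) * √(‖H y y‖ / w.im)) := by
          gcongr
          linarith
      _ = √(z.im ^ 2 * (‖G x x‖ / z.im * (‖H y y‖ / w.im))) := by
          rw [Real.sqrt_mul (sq_nonneg _), Real.sqrt_sq hz.le, Real.sqrt_mul (by positivity)]
      _ ≤ √(M * Γ * ‖H y y‖) := by
          apply Real.sqrt_le_sqrt
          have : z.im ^ 2 * (‖G x x‖ / z.im * (‖H y y‖ / w.im)) =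
              (z.im / w.im) * ‖G x x‖ * ‖H y y‖ := by
            field_simp
          rw [this]
          gcongr
          · rwa [div_le_iff₀ hw]
          · exact hΓ x x
  have h2 : ‖H y y‖ ≤ (2 + M) * Γ := by
    have h := h1 y y
    have h3 : √(M * Γ * ‖H y y‖) ≤ (M * Γ + ‖H y y‖) / 2 := by
      apply Real.sqrt_le_iff.mpr
      constructor
      · positivity
      · nlinarith [sq_nonneg (M * Γ - ‖H y y‖)]
    linarith
  refine (h1 x y).trans ?_
  have h3 : √(M * Γ * ‖H y y‖) ≤ (1 + M) * Γ := by
    apply Real.sqrt_le_iff.mpr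
    constructor
    · positivity
    · have : M * Γ * ‖H y y‖ ≤ M * Γ * ((2 + M) * Γ) := by gcongr
      nlinarith [sq_nonneg Γ]
  linarith

end IsGreen

end Green

section Perturbation

/-- The standing numerical assumptions: `K` is the a priori bound on the Green function entries
and `ψ` is the error parameter. -/
structure Params (N d : ℕ) (z : ℂ) (K ψ : ℝ) : Prop where
  one_le_d : 1 ≤ d
  two_d_le : 2 * d ≤ N
  im_pos : 0 < z.im
  le_K : 1 + ‖z‖ ≤ K
  K_le : 16 * K ≤ qval N d
  psi_nonneg : 0 ≤ ψ
  psi_le : ψ ≤ 1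
  eta_psi : 1 ≤ N * z.im * ψ ^ 2
  d_psi : 1 ≤ d * ψ ^ 2

namespace Params

variable {N d : ℕ} {z : ℂ} {K ψ : ℝ}

theorem one_le_K (h : Params N d z K ψ) : 1 ≤ K := by linarith [h.le_K, norm_nonneg z]

theorem q_ge (h : Params N d z K ψ) : 16 ≤ qval N d := by linarith [h.K_le, h.one_le_K]

theorem q_pos (h : Params N d z K ψ) : 0 < qval N d := by linarith [h.q_ge]

theorem d_ge (h : Params N d z K ψ) : (1 : ℝ) ≤ d := by exact_mod_cast h.one_le_d

theorem N_ge (h : Params N d z K ψ) : 2 * (d : ℝ) ≤ N := by exact_mod_cast h.two_d_le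

theorem N_pos (h : Params N d z K ψ) : (0 : ℝ) < N := by linarith [h.N_ge, h.d_ge]

theorem N_sub_pos (h : Params N d z K ψ) : (0 : ℝ) < N - d := by linarith [h.N_ge, h.d_ge]

theorem N_mul_q_sq (h : Params N d z K ψ) : (N : ℝ) * qval N d ^ 2 = d * (N - d) := by
  have h1 := h.N_sub_pos
  rw [qval, Real.sq_sqrt (by have := h.N_pos; positivity)]
  have := h.N_pos.ne'
  field_simp

theorem q_sq_le (h : Params N d z K ψ) : qval N d ^ 2 ≤ d := by
  have := h.N_mul_q_sq
  have h1 := h.N_pos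
  have h2 := h.d_ge
  refine le_of_mul_le_mul_left ?_ h1
  rw [this]
  nlinarith

theorem d_le_q_sq (h : Params N d z K ψ) : (d : ℝ) ≤ 2 * qval N d ^ 2 := by
  have := h.N_mul_q_sq
  have h1 := h.N_pos
  have h2 := h.d_ge
  have h3 := h.N_ge
  refine le_of_mul_le_mul_left ?_ h1
  nlinarith

theorem psi_pos (h : Params N d z K ψ) : 0 < ψ := by
  rcases h.psi_nonneg.eq_or_lt with h0 | h0
  · have := h.d_psi
    rw [← h0] at this
    norm_num at this
  · exact h0

theorem one_le_q_psi (h : Params N d z K ψ) : 1 ≤ 2 * qval N d * ψ := by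
  have h1 : 1 ^ 2 ≤ (2 * qval N d * ψ) ^ 2 := by
    nlinarith [h.d_le_q_sq, h.d_psi, sq_nonneg ψ, sq_nonneg (qval N d * ψ)]
  exact (sq_le_sq₀ zero_le_one (by have := h.q_pos; have := h.psi_pos; positivity)).mp h1

theorem q_le (h : Params N d z K ψ) : qval N d ≤ N * ψ := by
  have hd := h.d_ge
  have h1 : qval N d ^ 2 ≤ (d * ψ) ^ 2 := by
    nlinarith [h.q_sq_le, h.d_psi]
  have h2 := (sq_le_sq₀ h.q_pos.le (by have := h.psi_pos; positivity)).mp h1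
  have h3 : d * ψ ≤ N * ψ := mul_le_mul_of_nonneg_right (by linarith [h.N_ge]) h.psi_nonneg
  linarith

theorem one_le_N_psi (h : Params N d z K ψ) : 1 ≤ N * ψ := by linarith [h.q_le, h.q_ge]

theorem inv_im_le (h : Params N d z K ψ) : z.im⁻¹ ≤ N * ψ ^ 2 := by
  rw [inv_le_iff_one_le_mul₀ h.im_pos]
  linarith [h.eta_psi]

end Params

variable {N d : ℕ} {A : Matrix (Fin N) (Fin N) ℝ} {z : ℂ} {K ψ : ℝ} {i l j k : Fin N}
  {G H : Matrix (Fin N) (Fin N) ℂ}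

theorem sum_Dmat_mul (a b : Fin N) (u v : Fin N → ℂ) :
    ∑ y, (∑ x, u x * (Dmat N a b x y : ℂ)) * v y = u a * v b + u b * v a := by
  have h : ∀ y, (∑ x, u x * (Dmat N a b x y : ℂ)) * v y =
      (if b = y then u a * v b else 0) + (if a = y then u b * v a else 0) := by
    intro y
    simp only [Dmat, Matrix.of_apply]
    push_cast
    simp only [mul_add, Finset.sum_add_distrib, add_mul]
    congr 1
    · by_cases hb : b = y
      · subst hb; simp [apply_ite Complex.ofReal]
      · simp [hb]
    · by_cases ha : a = y
      · subst ha; simp [apply_ite Complex.ofReal]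
      · simp [ha]
  simp [h, Finset.sum_add_distrib]

theorem switch_sub_apply {q : ℝ} (hA : A.IsSymm) (hq : q ≠ 0) (hG : IsGreen q A z G)
    (hH : IsGreen q (switch A i l j k) z H) (x y : Fin N) :
    G x y - H x y = -((q : ℂ)⁻¹ * ((G x i - G x l) * (H j y - H k y) +
      (G x j - G x k) * (H i y - H l y))) := by
  have h := congr_fun (congr_fun (hG.sub_eq hA hq hH) x) y
  have h1 : (switch A i l j k - A).map Complex.ofReal =
      (Dmat N i k).map Complex.ofReal + (Dmat N j l).map Complex.ofReal -
      (Dmat N i j).map Complex.ofReal - (Dmat N k l).map Complex.ofReal := by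
    ext a b
    simp only [switch, xiMat, Matrix.map_apply, Matrix.sub_apply, Matrix.add_apply]
    push_cast
    ring
  have h2 : ∀ a b : Fin N, (G * (Dmat N a b).map Complex.ofReal * H) x y =
      G x a * H b y + G x b * H a y := fun a b => by
    simp only [Matrix.mul_apply, Matrix.map_apply]
    exact sum_Dmat_mul a b (fun t => G x t) (fun t => H t y)
  rw [h1] at h
  simp only [Matrix.mul_sub, Matrix.mul_add, Matrix.add_mul, Matrix.sub_mul, Matrix.sub_apply,
    Matrix.add_apply, Matrix.smul_apply, smul_eq_mul, h2, sub_self, zero_mul, zero_add] at h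
  rw [h]
  ring

theorem norm_mul_sub_le {a b c e : ℂ} {r s t u : ℝ} (ha : ‖a‖ ≤ r) (hb : ‖b‖ ≤ s) (hc : ‖c‖ ≤ t)
    (he : ‖e‖ ≤ u) : ‖(a - b) * (c - e)‖ ≤ (r + s) * (t + u) := by
  rw [norm_mul]
  have h1 := (norm_sub_le a b).trans (add_le_add ha hb)
  have h2 := (norm_sub_le c e).trans (add_le_add hc he)
  have : 0 ≤ r + s := (norm_nonneg _).trans h1
  gcongr

theorem norm_neg_inv_mul {q : ℝ} (hq : 0 < q) (w : ℂ) : ‖-((q : ℂ)⁻¹ * w)‖ = q⁻¹ * ‖w‖ := by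
  rw [norm_neg, norm_mul, norm_inv, Complex.norm_real, Real.norm_of_nonneg hq.le]

theorem norm_switch_le {q : ℝ} (hA : A.IsSymm) (hq : 0 < q) (hK : 16 * K ≤ q)
    (hG : IsGreen q A z G) (hH : IsGreen q (switch A i l j k) z H) (hGK : ∀ x y, ‖G x y‖ ≤ K)
    (x y : Fin N) : ‖H x y‖ ≤ 2 * K := by
  obtain ⟨m, -, hm⟩ := Finset.exists_max_image Finset.univ (fun x => ‖H x y‖) ⟨x, Finset.mem_univ x⟩
  set h := ‖H m y‖ with hh
  have hmax : ∀ a, ‖H a y‖ ≤ h := fun a => hm a (Finset.mem_univ a)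
  have e := switch_sub_apply hA hq.ne' hG hH m y
  have h1 : ‖G m y - H m y‖ ≤ q⁻¹ * (8 * K * h) := by
    rw [e, norm_neg_inv_mul hq]
    refine mul_le_mul_of_nonneg_left ((norm_add_le _ _).trans ?_) (inv_nonneg.mpr hq.le)
    have h2 := norm_mul_sub_le (hGK m i) (hGK m l) (hmax j) (hmax k)
    have h3 := norm_mul_sub_le (hGK m j) (hGK m k) (hmax i) (hmax l)
    linarith
  have h2 : q⁻¹ * (8 * K * h) ≤ h / 2 := by
    rw [inv_mul_le_iff₀ hq]
    nlinarith [norm_nonneg (H m y)]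
  have h3 : h ≤ ‖G m y‖ + ‖G m y - H m y‖ := by
    have := norm_sub_le (G m y) (G m y - H m y)
    rwa [sub_sub_cancel] at this
  linarith [hmax x, hGK m y]

theorem norm_sub_switch_le {q : ℝ} (hA : A.IsSymm) (hq : 0 < q) (hK : 16 * K ≤ q)
    (hG : IsGreen q A z G) (hH : IsGreen q (switch A i l j k) z H) (hGK : ∀ x y, ‖G x y‖ ≤ K)
    (x y : Fin N) : ‖G x y - H x y‖ ≤ q⁻¹ * (16 * K ^ 2) := by
  have hHK := norm_switch_le hA hq hK hG hH hGK
  rw [switch_sub_apply hA hq.ne' hG hH, norm_neg_inv_mul hq]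
  refine mul_le_mul_of_nonneg_left ((norm_add_le _ _).trans ?_) (inv_nonneg.mpr hq.le)
  have h2 := norm_mul_sub_le (hGK x i) (hGK x l) (hHK j y) (hHK k y)
  have h3 := norm_mul_sub_le (hGK x j) (hGK x k) (hHK i y) (hHK l y)
  linarith

theorem IsGreen.sum_norm_le (h : Params N d z K ψ) (hA : A.IsSymm)
    (hG : IsGreen (qval N d) A z G) (hGK : ∀ x y, ‖G x y‖ ≤ K) (x : Fin N) :
    ∑ y, ‖G x y‖ ^ 2 ≤ K * (N * ψ ^ 2) ∧ ∑ y, ‖G x y‖ ≤ N * K * ψ := by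
  have hN := h.N_pos
  have hψ := h.psi_pos
  have hK := h.one_le_K
  have h1 : ∑ y, ‖G x y‖ ^ 2 ≤ K * (N * ψ ^ 2) := by
    refine (hG.sum_sq_le hA h.q_pos.ne' h.im_pos x).trans ?_
    rw [div_eq_mul_inv]
    have := h.inv_im_le
    gcongr
    · have := h.im_pos; positivity
    · exact hGK x x
  refine ⟨h1, ?_⟩
  have h2 : (∑ y, ‖G x y‖) ^ 2 ≤ (N * K * ψ) ^ 2 := by
    have h3 := sq_sum_le_card_mul_sum_sq (s := Finset.univ) (f := fun y => ‖G x y‖)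
    rw [Finset.card_univ, Fintype.card_fin] at h3
    have h4 : (N : ℝ) * (K * (N * ψ ^ 2)) ≤ (N * K * ψ) ^ 2 := by
      have : (N * K * ψ) ^ 2 = (N : ℝ) * (K * (N * ψ ^ 2)) * K := by ring
      rw [this]
      exact le_mul_of_one_le_right (by positivity) hK
    nlinarith
  exact (sq_le_sq₀ (Finset.sum_nonneg fun _ _ => norm_nonneg _) (by positivity)).mp h2

theorem sum_norm_diag_sub_le (h : Params N d z K ψ) (hA : A.IsSymm)
    (hA' : (switch A i l j k).IsSymm)
    (hG : IsGreen (qval N d) A z G) (hH : IsGreen (qval N d) (switch A i l j k) z H)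
    (hGK : ∀ x y, ‖G x y‖ ≤ K) :
    ∑ m, ‖G m m - H m m‖ ≤ (qval N d)⁻¹ * (16 * K * N * ψ ^ 2) := by
  have hHK := norm_switch_le hA h.q_pos h.K_le hG hH hGK
  have hN := h.N_pos
  have hK := h.one_le_K
  have hη := h.im_pos
  have key : ∀ a b, ∑ m, ‖G m a‖ * ‖H b m‖ ≤ 2 * K * (N * ψ ^ 2) := by
    intro a b
    have h1 := hG.sum_sq_le hA h.q_pos.ne' h.im_pos a
    have h2 := hH.sum_sq_le hA' h.q_pos.ne' h.im_pos b
    have h3 : ∀ m, ‖G m a‖ * ‖H b m‖ ≤ ‖G a m‖ ^ 2 / 2 + ‖H b m‖ ^ 2 / 2 := fun m => by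
      rw [hG.comm m a]
      nlinarith [sq_nonneg (‖G a m‖ - ‖H b m‖)]
    refine (Finset.sum_le_sum fun m _ => h3 m).trans ?_
    rw [Finset.sum_add_distrib, ← Finset.sum_div, ← Finset.sum_div]
    have h4 : ‖G a a‖ / z.im ≤ K * (N * ψ ^ 2) := by
      rw [div_eq_mul_inv]
      exact mul_le_mul (hGK a a) h.inv_im_le (by positivity) (by linarith)
    have h5 : ‖H b b‖ / z.im ≤ 2 * K * (N * ψ ^ 2) := by
      rw [div_eq_mul_inv]
      exact mul_le_mul (hHK b b) h.inv_im_le (by positivity) (by linarith)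
    have h6 : 0 ≤ K * (N * ψ ^ 2) := by positivity
    linarith
  have h1 : ∀ m, ‖G m m - H m m‖ ≤ (qval N d)⁻¹ *
      (‖G m i‖ * ‖H j m‖ + ‖G m i‖ * ‖H k m‖ + ‖G m l‖ * ‖H j m‖ + ‖G m l‖ * ‖H k m‖ +
      (‖G m j‖ * ‖H i m‖ + ‖G m j‖ * ‖H l m‖ + ‖G m k‖ * ‖H i m‖ + ‖G m k‖ * ‖H l m‖)) := by
    intro m
    rw [switch_sub_apply hA h.q_pos.ne' hG hH, norm_neg_inv_mul h.q_pos]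
    refine mul_le_mul_of_nonneg_left ((norm_add_le _ _).trans ?_) (inv_nonneg.mpr h.q_pos.le)
    have h2 := norm_mul_sub_le (le_refl ‖G m i‖) (le_refl ‖G m l‖) (le_refl ‖H j m‖)
      (le_refl ‖H k m‖)
    have h3 := norm_mul_sub_le (le_refl ‖G m j‖) (le_refl ‖G m k‖) (le_refl ‖H i m‖)
      (le_refl ‖H l m‖)
    nlinarith
  refine (Finset.sum_le_sum fun m _ => h1 m).trans ?_
  rw [← Finset.mul_sum]
  refine mul_le_mul_of_nonneg_left ?_ (inv_nonneg.mpr h.q_pos.le)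
  simp only [Finset.sum_add_distrib]
  linarith [key i j, key i k, key l j, key l k, key j i, key j l, key k i, key k l]

end Perturbation

section Expansion

variable {N d : ℕ}

/-- The average of the diagonal of `G` over the non-neighbours of `i`. -/
def diagAvg (d : ℕ) (A : Matrix (Fin N) (Fin N) ℝ) (G : Matrix (Fin N) (Fin N) ℂ) (i : Fin N) : ℂ :=
  ((N : ℂ) - d)⁻¹ * ∑ k, (1 - (A i k : ℂ)) * G k k

/-- The error in the self-consistent equation for `G i x`. -/
def selfErr (d : ℕ) (z : ℂ) (A : Matrix (Fin N) (Fin N) ℝ) (G : Matrix (Fin N) (Fin N) ℂ)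
    (i x : Fin N) : ℂ :=
  (if i = x then 1 else 0) - (N : ℂ)⁻¹ + z * G i x + diagAvg d A G i * G i x

/-- The rescaled difference between the neighbourhood average and the full average of the
diagonal of `G`. -/
def diagDev (d : ℕ) (A : Matrix (Fin N) (Fin N) ℝ) (G : Matrix (Fin N) (Fin N) ℂ) (i : Fin N) : ℂ :=
  ((N : ℂ) - d)⁻¹ * (∑ k, (A i k : ℂ) * G k k - (d : ℂ) / N * ∑ k, G k k)

variable {A : Matrix (Fin N) (Fin N) ℝ} {z : ℂ} {K ψ : ℝ} {i : Fin N}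
  {G : Matrix (Fin N) (Fin N) ℂ}
  {Γ : Matrix (Fin N) (Fin N) ℝ → Matrix (Fin N) (Fin N) ℂ}

theorem sum_one_sub (hA : IsAdjMat N d A) (i : Fin N) : ∑ k, (1 - A i k) = N - d := by
  rw [Finset.sum_sub_distrib, hA.2.2.2]
  simp

theorem norm_one_sub (hA : IsAdjMat N d A) (i k : Fin N) : ‖(1 - (A i k : ℂ))‖ = 1 - A i k := by
  rw [← Complex.ofReal_one, ← Complex.ofReal_sub, Complex.norm_real,
    Real.norm_of_nonneg (sub_nonneg.mpr (hA.le_one i k))]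

theorem norm_ofReal_entry (hA : IsAdjMat N d A) (i k : Fin N) : ‖(A i k : ℂ)‖ = A i k := by
  rw [Complex.norm_real, Real.norm_of_nonneg (hA.nonneg i k)]

theorem norm_N_sub_inv (h : Params N d z K ψ) : ‖((N : ℂ) - d)⁻¹‖ = (N - d : ℝ)⁻¹ := by
  have : ((N : ℂ) - d) = ((N - d : ℝ) : ℂ) := by push_cast; ring
  rw [norm_inv, this, Complex.norm_real, Real.norm_of_nonneg h.N_sub_pos.le]

theorem norm_diagAvg_le (h : Params N d z K ψ) (hA : IsAdjMat N d A)
    (hGK : ∀ x y, ‖G x y‖ ≤ K) (i : Fin N) : ‖diagAvg d A G i‖ ≤ K := by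
  rw [diagAvg, norm_mul, norm_N_sub_inv h, inv_mul_le_iff₀ h.N_sub_pos, ← sum_one_sub hA i,
    Finset.sum_mul]
  refine norm_sum_le_of_le _ fun k _ => ?_
  rw [norm_mul, norm_one_sub hA]
  exact mul_le_mul_of_nonneg_left (hGK k k) (sub_nonneg.mpr (hA.le_one i k))

theorem norm_rowSum_le (h : Params N d z K ψ) (hG : IsGreen (qval N d) A z G)
    (hGK : ∀ x y, ‖G x y‖ ≤ K) (x y : Fin N) :
    ‖∑ j, (A x j : ℂ) * G j y‖ ≤ qval N d * K ^ 2 := by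
  rw [hG.mul_apply, norm_mul, Complex.norm_real, Real.norm_of_nonneg h.q_pos.le]
  refine mul_le_mul_of_nonneg_left ?_ h.q_pos.le
  have hN : (1 : ℝ) ≤ N := by linarith [h.N_ge, h.d_ge]
  have h1 : ‖((if x = y then 1 else 0) - (N : ℂ)⁻¹ : ℂ)‖ ≤ 1 := by
    have e : ((if x = y then 1 else 0) - (N : ℂ)⁻¹ : ℂ) =
        (((if x = y then 1 else 0) - (N : ℝ)⁻¹ : ℝ) : ℂ) := by
      split_ifs <;> push_cast <;> ring
    rw [e, Complex.norm_real, Real.norm_eq_abs, abs_le]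
    have h2 : (N : ℝ)⁻¹ ≤ 1 := inv_le_one_of_one_le₀ hN
    have h3 : 0 ≤ (N : ℝ)⁻¹ := by positivity
    split_ifs <;> constructor <;> linarith
  refine (norm_add_le _ _).trans ?_
  rw [norm_mul]
  have h4 : ‖z‖ * ‖G x y‖ ≤ ‖z‖ * K := mul_le_mul_of_nonneg_left (hGK x y) (norm_nonneg _)
  nlinarith [h.le_K, h.one_le_K, norm_nonneg z]

theorem wsum_diag_mul (h : Params N d z K ψ) (hA : IsAdjMat N d A) (x : Fin N) :
    wsum A i (fun _ _ k => (qval N d : ℂ)⁻¹ * (G k k * G i x)) =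
      N * qval N d * (diagAvg d A G i * G i x) -
        (qval N d : ℂ)⁻¹ * (d * (G i i * G i x)) := by
  have hq : (qval N d : ℂ) ≠ 0 := by exact_mod_cast h.q_pos.ne'
  have hNd : ((N : ℂ) - d) ≠ 0 := by
    have := h.N_sub_pos.ne'
    exact_mod_cast this
  have e1 : wsum A i (fun _ _ k => G k k) =
      d * (((N : ℂ) - d) * diagAvg d A G i) - d * G i i := by
    rw [wsum_right (fun _ k => G k k) hA]
    simp_rw [sum_nb hA]
    rw [Finset.sum_sub_distrib, Finset.sum_comm, diagAvg, mul_inv_cancel_left₀ hNd, Finset.mul_sum]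
    congr 1
    · refine Finset.sum_congr rfl fun k _ => ?_
      rw [← Finset.sum_smul, ← Finset.sum_mul, hA.col_sum, Complex.real_smul]
      push_cast
      ring
    · rw [← Finset.sum_smul, hA.col_sum, Complex.real_smul, Complex.ofReal_natCast]
  have e2 : wsum A i (fun _ _ k => (qval N d : ℂ)⁻¹ * (G k k * G i x)) =
      wsum A i (fun _ _ k => G k k) * ((qval N d : ℂ)⁻¹ * G i x) := by
    rw [← wsum_mul_right_complex]
    exact wsum_congr fun l j _ k _ => by ring
  have e3 : (N : ℂ) * (qval N d : ℂ) ^ 2 = d * (N - d) := by exact_mod_cast h.N_mul_q_sq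
  rw [e2, e1]
  field_simp
  linear_combination (-(diagAvg d A G i * G i x)) * e3

theorem norm_wsum_cross_le (h : Params N d z K ψ) (hA : IsAdjMat N d A)
    (hG : IsGreen (qval N d) A z G) (hGK : ∀ x y, ‖G x y‖ ≤ K) (x : Fin N) :
    ‖wsum A i (fun l j k => G k l * G j x)‖ ≤ K * (N * (qval N d * K ^ 2) + 2 * d * (N * K * ψ)) := by
  have hK := h.one_le_K
  have hrow := fun x => (hG.sum_norm_le h hA.1 hGK x).2
  have h1 : ∀ l, ‖∑ k ∈ nb A l i, G k l‖ ≤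
      qval N d * K ^ 2 + ∑ k, A i k * (A l k * ‖G k l‖) + ‖G i l‖ := by
    intro l
    have e : ∑ k ∈ nb A l i, G k l = ∑ k, (A l k : ℂ) * G k l -
        ∑ k, ((A i k * A l k : ℝ) : ℂ) * G k l - (A l i : ℂ) * G i l := by
      rw [sum_nb hA, ← Finset.sum_sub_distrib, Complex.real_smul]
      congr 1
      refine Finset.sum_congr rfl fun k _ => ?_
      rw [Complex.real_smul]
      push_cast
      ring
    rw [e]
    refine (norm_sub_le _ _).trans (add_le_add ((norm_sub_le _ _).trans (add_le_add ?_ ?_)) ?_)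
    · exact norm_rowSum_le h hG hGK l l
    · refine norm_sum_le_of_le _ fun k _ => ?_
      rw [norm_mul, Complex.norm_real, Real.norm_of_nonneg
        (mul_nonneg (hA.nonneg _ _) (hA.nonneg _ _)), mul_assoc]
    · rw [norm_mul, norm_ofReal_entry hA]
      exact mul_le_of_le_one_left (norm_nonneg _) (hA.le_one _ _)
  have h2 : ∀ l, ‖((nb A i l).card : ℝ)⁻¹ • ∑ j ∈ nb A i l, ∑ k ∈ nb A l i, G k l * G j x‖ ≤
      K * (qval N d * K ^ 2 + ∑ k, A i k * (A l k * ‖G k l‖) + ‖G i l‖) := by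
    intro l
    have e : ∑ j ∈ nb A i l, ∑ k ∈ nb A l i, G k l * G j x =
        (∑ k ∈ nb A l i, G k l) * ∑ j ∈ nb A i l, G j x := by
      rw [Finset.sum_comm, Finset.sum_mul_sum]
    have h3 : ‖∑ j ∈ nb A i l, G j x‖ ≤ (nb A i l).card * K := by
      have := norm_sum_le_of_le (nb A i l) (f := fun j => G j x) (n := fun _ => K)
        fun j _ => hGK j x
      simpa using this
    rw [e, norm_smul, norm_mul, Real.norm_of_nonneg (by positivity)]
    have h4 : ((nb A i l).card : ℝ)⁻¹ * ‖∑ j ∈ nb A i l, G j x‖ ≤ K := by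
      by_cases h0 : (nb A i l).card = 0
      · rw [h0, Nat.cast_zero, _root_.inv_zero, zero_mul]
        linarith
      · have h0' : (0 : ℝ) < (nb A i l).card := by exact_mod_cast Nat.pos_of_ne_zero h0
        rwa [inv_mul_le_iff₀ h0']
    calc _ = (((nb A i l).card : ℝ)⁻¹ * ‖∑ j ∈ nb A i l, G j x‖) * ‖∑ k ∈ nb A l i, G k l‖ := by
          ring
      _ ≤ _ := mul_le_mul h4 (h1 l) (norm_nonneg _) (by linarith)
  rw [wsum]
  refine (norm_sum_le_of_le _ fun l _ => h2 l).trans ?_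
  rw [← Finset.mul_sum]
  refine mul_le_mul_of_nonneg_left ?_ (by linarith)
  rw [Finset.sum_add_distrib, Finset.sum_add_distrib, Finset.sum_const, Finset.card_univ,
    Fintype.card_fin, nsmul_eq_mul, Finset.sum_comm]
  have h5 : ∑ k, ∑ l, A i k * (A l k * ‖G k l‖) ≤ d * (N * K * ψ) := by
    rw [← hA.2.2.2 i, Finset.sum_mul]
    refine Finset.sum_le_sum fun k _ => ?_
    rw [← Finset.mul_sum]
    refine mul_le_mul_of_nonneg_left (le_trans (Finset.sum_le_sum fun l _ => ?_) (hrow k))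
      (hA.nonneg _ _)
    exact mul_le_of_le_one_left (norm_nonneg _) (hA.le_one _ _)
  have h6 : N * K * ψ ≤ d * (N * K * ψ) :=
    le_mul_of_one_le_left (by have := h.N_pos; have := h.psi_pos; positivity) h.d_ge
  linarith [hrow i]

theorem norm_selfErr_sub_wsum_le (h : Params N d z K ψ)
    (hΓ : ∀ B, IsAdjMat N d B → IsGreen (qval N d) B z (Γ B)) (hA : IsAdjMat N d A)
    (hGK : ∀ x y, ‖Γ A x y‖ ≤ K) (i x : Fin N) :
    ‖N * qval N d * selfErr d z A (Γ A) i x -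
      wsum A i (fun l j k => Γ A j x - Γ (switch A i l j k) k x)‖ ≤
        600 * K ^ 3 * (N * qval N d * ψ) := by
  set q := qval N d with hq
  set G := Γ A with hGdef
  have hG : IsGreen q A z G := hΓ A hA
  have hq0 : 0 < q := h.q_pos
  have hqi : 0 < q⁻¹ := inv_pos.mpr hq0
  have hqc : (q : ℂ) ≠ 0 := by exact_mod_cast hq0.ne'
  have hN := h.N_pos
  have hψ := h.psi_pos
  have hK := h.one_le_K
  have hd := h.d_ge
  have hrow := fun x => (hG.sum_norm_le h hA.1 hGK x).2
  have hrow2 := fun x => (hG.sum_norm_le h hA.1 hGK x).1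
  have hcol : ∀ x, ∑ y, ‖G y x‖ ≤ N * K * ψ := fun x => by
    simp_rw [fun y => hG.comm y x]; exact hrow x
  have hcol2 : ∀ x, ∑ y, ‖G y x‖ ^ 2 ≤ K * (N * ψ ^ 2) := fun x => by
    simp_rw [fun y => hG.comm y x]; exact hrow2 x
  set W := N * q * ψ with hW
  have hW1 : q ≤ W := by
    have : q * 1 ≤ q * (N * ψ) := mul_le_mul_of_nonneg_left h.one_le_N_psi hq0.le
    linarith
  have hW2 : (d : ℝ) ≤ 2 * W := by
    have : q * q ≤ q * (N * ψ) := mul_le_mul_of_nonneg_left h.q_le hq0.le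
    nlinarith [h.d_le_q_sq]
  have hW3 : q⁻¹ * d ≤ 2 * W := by
    rw [inv_mul_le_iff₀ hq0]
    nlinarith [h.d_le_q_sq]
  have hW4 : (N : ℝ) ≤ 2 * W := by
    have : N * 1 ≤ N * (2 * q * ψ) := mul_le_mul_of_nonneg_left h.one_le_q_psi hN.le
    linarith
  have hW5 : q⁻¹ * (d * N * ψ) ≤ 2 * W := by
    rw [inv_mul_le_iff₀ hq0]
    have := mul_le_mul_of_nonneg_right h.d_le_q_sq (mul_pos hN hψ).le
    rw [hW]; linarith
  have hW6 : q⁻¹ * (N * d * q⁻¹) ≤ 4 * W := by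
    have : q⁻¹ * (N * d * q⁻¹) ≤ 2 * N := by
      rw [← mul_assoc, mul_inv_le_iff₀ hq0, inv_mul_le_iff₀ hq0]
      nlinarith [h.d_le_q_sq]
    linarith
  -- the three pieces of `G k x - H k x`
  let f₁ : Fin N → Fin N → Fin N → ℂ := fun l j k =>
    G k x - Γ (switch A i l j k) k x - (q : ℂ)⁻¹ * (G k k * G i x) - G k l * G j x * (q : ℂ)⁻¹
  have hf₁ : ∀ l, ∀ j ∈ nb A i l, ∀ k ∈ nb A l i, ‖f₁ l j k‖ ≤
      q⁻¹ * (q⁻¹ * (128 * K ^ 3) + 2 * K * ‖G k i‖ + K * ‖G k x‖ + 2 * K * ‖G k j‖ +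
        K * ‖G l x‖) := by
    intro l j hj k hk
    have hA' := isAdjMat_switch hA hj hk
    have hH := hΓ _ hA'
    set H := Γ (switch A i l j k) with hHdef
    have hdiff := norm_sub_switch_le hA.1 hq0 h.K_le hG hH hGK
    have e : f₁ l j k = -((q : ℂ)⁻¹ *
        (((G k i - G k l) * ((G k x - H k x) - (G j x - H j x)) +
          (G k j - G k k) * ((G l x - H l x) - (G i x - H i x))) +
        G k i * (G j x - G k x) + G k l * G k x + G k j * (G i x - G l x) + G k k * G l x)) := by
      simp only [f₁]
      linear_combination switch_sub_apply hA.1 hq0.ne' hG hH k x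
    rw [e, norm_neg_inv_mul hq0]
    refine mul_le_mul_of_nonneg_left ?_ hqi.le
    refine norm_add_le_of_le (norm_add_le_of_le (norm_add_le_of_le (norm_add_le_of_le ?_ ?_) ?_)
      ?_) ?_
    · have h1 := norm_mul_sub_le (hGK k i) (hGK k l) (hdiff k x) (hdiff j x)
      have h2 := norm_mul_sub_le (hGK k j) (hGK k k) (hdiff l x) (hdiff i x)
      refine (norm_add_le_of_le h1 h2).trans (le_of_eq ?_)
      ring
    · rw [norm_mul, mul_comm]
      exact mul_le_mul_of_nonneg_right ((norm_sub_le _ _).trans (by linarith [hGK j x, hGK k x]))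
        (norm_nonneg _)
    · rw [norm_mul]
      exact mul_le_mul_of_nonneg_right (hGK _ _) (norm_nonneg _)
    · rw [norm_mul, mul_comm]
      exact mul_le_mul_of_nonneg_right ((norm_sub_le _ _).trans (by linarith [hGK i x, hGK l x]))
        (norm_nonneg _)
    · rw [norm_mul]
      exact mul_le_mul_of_nonneg_right (hGK _ _) (norm_nonneg _)
  have b₁ : ‖wsum A i f₁‖ ≤ 548 * K ^ 3 * W := by
    refine (norm_wsum_le_of hf₁).trans ?_
    rw [wsum_mul_left, wsum_add, wsum_add, wsum_add, wsum_add,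
      wsum_mul_left (2 * K) (fun _ _ k => ‖G k i‖), wsum_mul_left K (fun _ _ k => ‖G k x‖),
      wsum_mul_left (2 * K) (fun _ j k => ‖G k j‖), wsum_mul_left K (fun l _ _ => ‖G l x‖)]
    have c0 := wsum_const_le (i := i) hA (c := q⁻¹ * (128 * K ^ 3)) (by positivity)
    have c1 := (wsum_right_le (i := i) hA (fun k => norm_nonneg (G k i))).trans
      (mul_le_mul_of_nonneg_left (hcol i) (by linarith))
    have c2 := (wsum_right_le (i := i) hA (fun k => norm_nonneg (G k x))).trans
      (mul_le_mul_of_nonneg_left (hcol x) (by linarith))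
    have c4 := (wsum_mid_le (i := i) hA (fun k => norm_nonneg (G k x))).trans
      (mul_le_mul_of_nonneg_left (hcol x) (by linarith))
    have c3 := wsum_pair_le (i := i) hA h.one_le_d (w := fun k j => ‖G k j‖)
      (fun _ _ => norm_nonneg _) hcol hcol2
    have s : √(d * (K * (N * ψ ^ 2))) ≤ N * K * ψ := by
      refine Real.sqrt_le_iff.mpr ⟨by positivity, ?_⟩
      have e : (N * K * ψ) ^ 2 = N * K * (K * (N * ψ ^ 2)) := by ring
      rw [e]
      refine mul_le_mul_of_nonneg_right ?_ (by positivity)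
      nlinarith [h.N_ge]
    have c3' : wsum A i (fun _ j k => ‖G k j‖) ≤ 7 * d * (N * K * ψ) := by
      have := mul_le_mul_of_nonneg_left s (by positivity : 0 ≤ 3 * (d : ℝ))
      linarith
    calc _ ≤ q⁻¹ * (N * d * (q⁻¹ * (128 * K ^ 3)) + 2 * K * (d * (N * K * ψ)) +
          K * (d * (N * K * ψ)) + 2 * K * (7 * d * (N * K * ψ)) + K * (d * (N * K * ψ))) := by
          gcongr
      _ = 128 * K ^ 3 * (q⁻¹ * (N * d * q⁻¹)) + 18 * K ^ 2 * (q⁻¹ * (d * N * ψ)) := by ring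
      _ ≤ 128 * K ^ 3 * (4 * W) + 18 * K ^ 3 * (2 * W) := by
          gcongr
          norm_num
      _ = _ := by ring
  have b₂ : ‖wsum A i (fun l j k => G k l * G j x * (q : ℂ)⁻¹)‖ ≤ 6 * K ^ 3 * W := by
    rw [wsum_mul_right_complex, norm_mul, norm_inv, Complex.norm_real,
      Real.norm_of_nonneg hq0.le, mul_comm]
    calc _ ≤ q⁻¹ * (K * (N * (q * K ^ 2) + 2 * d * (N * K * ψ))) :=
          mul_le_mul_of_nonneg_left (norm_wsum_cross_le h hA hG hGK x) hqi.le
      _ = (q⁻¹ * q) * (K ^ 3 * N) + 2 * K ^ 2 * (q⁻¹ * (d * N * ψ)) := by ring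
      _ ≤ 1 * (K ^ 3 * (2 * W)) + 2 * K ^ 3 * (2 * W) := by
          rw [inv_mul_cancel₀ hq0.ne']
          gcongr
          norm_num
      _ = _ := by ring
  have hS := norm_rowSum_le h hG hGK i x
  have e1 : wsum A i (fun l j k => G j x - Γ (switch A i l j k) k x) =
      wsum A i (fun _ j k => G j x - G k x) + (wsum A i f₁ +
        wsum A i (fun _ _ k => (q : ℂ)⁻¹ * (G k k * G i x)) +
        wsum A i (fun l j k => G k l * G j x * (q : ℂ)⁻¹)) := by
    rw [← wsum_add, ← wsum_add, ← wsum_add]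
    refine wsum_congr fun l j _ k _ => ?_
    simp only [f₁]
    ring
  have e2 : N * q * selfErr d z A G i x - wsum A i (fun l j k => G j x - Γ (switch A i l j k) k x) =
      ∑ j, (A i j : ℂ) * G j x - d * G i x + (q : ℂ)⁻¹ * d * (G i i * G i x) -
      (wsum A i f₁ + wsum A i (fun l j k => G k l * G j x * (q : ℂ)⁻¹)) := by
    rw [e1, wsum_sub_eq hA, wsum_diag_mul h hA, ← hq, hG.sum_col]
    simp only [Complex.real_smul, smul_zero, hG.mul_apply, selfErr]
    push_cast
    ring
  rw [e2]
  have b3 : ‖(d : ℂ) * G i x‖ ≤ 2 * W * K := by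
    rw [norm_mul, Complex.norm_natCast]
    exact mul_le_mul hW2 (hGK _ _) (norm_nonneg _) (by positivity)
  have b4 : ‖(q : ℂ)⁻¹ * d * (G i i * G i x)‖ ≤ 2 * W * (K * K) := by
    rw [norm_mul, norm_mul, norm_mul, Complex.norm_natCast, norm_inv, Complex.norm_real,
      Real.norm_of_nonneg hq0.le]
    exact mul_le_mul hW3 (mul_le_mul (hGK _ _) (hGK _ _) (norm_nonneg _) (by linarith))
      (by positivity) (by positivity)
  refine (norm_sub_le_of_le (norm_add_le_of_le (norm_sub_le_of_le hS b3) b4)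
    (norm_add_le_of_le b₁ b₂)).trans ?_
  have hW0 : 0 ≤ W := by positivity
  have k2 : K ^ 2 ≤ K ^ 3 := pow_le_pow_right₀ hK (by norm_num)
  have k1 : K ≤ K ^ 3 := le_self_pow₀ hK (by norm_num)
  have t1 : q * K ^ 2 ≤ K ^ 3 * W := by
    rw [mul_comm]; exact mul_le_mul k2 hW1 hq0.le (by positivity)
  have t2 : 2 * W * K ≤ 2 * (K ^ 3 * W) := by nlinarith
  have t3 : 2 * W * (K * K) ≤ 2 * (K ^ 3 * W) := by nlinarith
  have t4 : 0 ≤ K ^ 3 * W := by positivity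
  linarith

end Expansion

section Variation

variable {N d : ℕ} {A : Matrix (Fin N) (Fin N) ℝ} {z : ℂ} {K ψ lam : ℝ} {i l j k : Fin N}
  {G H : Matrix (Fin N) (Fin N) ℂ}
  {Γ : Matrix (Fin N) (Fin N) ℝ → Matrix (Fin N) (Fin N) ℂ}

theorem sum_switch_row (hA : IsAdjMat N d A) (hj : j ∈ nb A i l) (hk : k ∈ nb A l i)
    (f : Fin N → ℂ) :
    ∑ m, (switch A i l j k i m : ℂ) * f m = ∑ m, (A i m : ℂ) * f m + f k - f j := by
  obtain ⟨h1, h2, h3, h4, h5, h6⟩ := ne_of_mem_nb hA hj hk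
  have e : ∀ m, (switch A i l j k i m : ℂ) * f m =
      (A i m : ℂ) * f m + (if k = m then f k else 0) - (if j = m then f j else 0) := by
    intro m
    simp only [switch, xiMat, Dmat, Matrix.sub_apply, Matrix.add_apply, Matrix.of_apply, h1.symm,
      h3.symm, h6.symm, and_false, false_and, if_false, true_and]
    by_cases hjm : j = m <;> by_cases hkm : k = m
    · exact absurd (hjm.trans hkm.symm) h5
    · subst hjm; simp [hkm]; ring
    · subst hkm; simp [hjm]; ring
    · simp [hjm, hkm]
  simp only [e, Finset.sum_sub_distrib, Finset.sum_add_distrib]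
  simp

theorem Params.inv_N_sub_le (h : Params N d z K ψ) : (N - d : ℝ)⁻¹ ≤ 2 * (N : ℝ)⁻¹ := by
  have := h.N_pos
  have h1 := h.N_sub_pos
  rw [inv_le_iff_one_le_mul₀ h1, mul_assoc, mul_comm, mul_assoc, ← div_eq_inv_mul, one_le_div this]
  linarith [h.N_ge]

theorem Params.inv_N_le (h : Params N d z K ψ) : (N : ℝ)⁻¹ ≤ (qval N d)⁻¹ * ψ := by
  have := h.N_pos
  rw [inv_le_iff_one_le_mul₀ this, mul_assoc, ← div_eq_inv_mul, one_le_div h.q_pos]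
  linarith [h.q_le]

theorem Params.inv_q_le (h : Params N d z K ψ) : (qval N d)⁻¹ ≤ 2 * ψ := by
  rw [inv_le_iff_one_le_mul₀ h.q_pos]
  linarith [h.one_le_q_psi]

theorem Params.psi_sq_le (h : Params N d z K ψ) : ψ ^ 2 ≤ ψ := by
  nlinarith [h.psi_nonneg, h.psi_le]

theorem norm_diagAvg_sub_le (h : Params N d z K ψ) (hA : IsAdjMat N d A) (hj : j ∈ nb A i l)
    (hk : k ∈ nb A l i) (hG : IsGreen (qval N d) A z G)
    (hH : IsGreen (qval N d) (switch A i l j k) z H) (hGK : ∀ x y, ‖G x y‖ ≤ K) :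
    ‖diagAvg d A G i - diagAvg d (switch A i l j k) H i‖ ≤ (qval N d)⁻¹ * (40 * K * ψ) := by
  have hHK := norm_switch_le hA.1 h.q_pos h.K_le hG hH hGK
  have hs := sum_norm_diag_sub_le h hA.1 (isAdjMat_switch hA hj hk).1 hG hH hGK
  have hK := h.one_le_K
  have hN := h.N_pos
  have hqi := inv_pos.mpr h.q_pos
  have e : diagAvg d A G i - diagAvg d (switch A i l j k) H i =
      ((N : ℂ) - d)⁻¹ * (∑ m, (1 - (A i m : ℂ)) * (G m m - H m m) + (H k k - H j j)) := by
    have e1 := sum_switch_row hA hj hk (fun m => H m m)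
    simp only [diagAvg, mul_sub, sub_mul, one_mul, Finset.sum_sub_distrib]
    rw [e1]
    ring
  have h1 : ‖∑ m, (1 - (A i m : ℂ)) * (G m m - H m m)‖ ≤
      (qval N d)⁻¹ * (16 * K * N * ψ ^ 2) := by
    refine (norm_sum_le_of_le _ fun m _ => ?_).trans hs
    rw [norm_mul, norm_one_sub hA]
    exact mul_le_of_le_one_left (norm_nonneg _) (by linarith [hA.nonneg i m])
  have h2 := norm_add_le_of_le h1 (norm_sub_le_of_le (hHK k k) (hHK j j))
  rw [e, norm_mul, norm_N_sub_inv h]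
  calc _ ≤ (2 * (N : ℝ)⁻¹) * ((qval N d)⁻¹ * (16 * K * N * ψ ^ 2) + (2 * K + 2 * K)) :=
        mul_le_mul h.inv_N_sub_le h2 (norm_nonneg _) (by positivity)
    _ = (N : ℝ)⁻¹ * N * ((qval N d)⁻¹ * (32 * K * ψ ^ 2)) + 8 * K * (N : ℝ)⁻¹ := by ring
    _ ≤ 1 * ((qval N d)⁻¹ * (32 * K * ψ)) + 8 * K * ((qval N d)⁻¹ * ψ) := by
        rw [inv_mul_cancel₀ hN.ne']
        have := h.psi_sq_le
        have := h.inv_N_le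
        gcongr
    _ = _ := by ring

theorem norm_selfErr_sub_le (h : Params N d z K ψ) (hA : IsAdjMat N d A) (hj : j ∈ nb A i l)
    (hk : k ∈ nb A l i) (hG : IsGreen (qval N d) A z G)
    (hH : IsGreen (qval N d) (switch A i l j k) z H) (hGK : ∀ x y, ‖G x y‖ ≤ K) (x : Fin N) :
    ‖selfErr d z A G i x - selfErr d z (switch A i l j k) H i x‖ ≤
      2 * K * ‖G i x - H i x‖ + (qval N d)⁻¹ * (80 * K ^ 2 * ψ) := by
  have hHK := norm_switch_le hA.1 h.q_pos h.K_le hG hH hGK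
  have hY := norm_diagAvg_sub_le h hA hj hk hG hH hGK
  have hK := h.one_le_K
  have hqi := inv_pos.mpr h.q_pos
  have e : selfErr d z A G i x - selfErr d z (switch A i l j k) H i x =
      (z + diagAvg d A G i) * (G i x - H i x) +
      (diagAvg d A G i - diagAvg d (switch A i l j k) H i) * H i x := by
    simp only [selfErr]; ring
  rw [e]
  refine norm_add_le_of_le ?_ ?_
  · rw [norm_mul]
    refine mul_le_mul_of_nonneg_right ((norm_add_le _ _).trans ?_) (norm_nonneg _)
    linarith [norm_diagAvg_le h hA hGK i, h.le_K]
  · rw [norm_mul]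
    have := h.psi_pos
    calc _ ≤ (qval N d)⁻¹ * (40 * K * ψ) * (2 * K) :=
          mul_le_mul hY (hHK i x) (norm_nonneg _) (by positivity)
      _ = _ := by ring

theorem norm_selfErr_sub_le_psi (h : Params N d z K ψ) (hA : IsAdjMat N d A) (hj : j ∈ nb A i l)
    (hk : k ∈ nb A l i) (hG : IsGreen (qval N d) A z G)
    (hH : IsGreen (qval N d) (switch A i l j k) z H) (hGK : ∀ x y, ‖G x y‖ ≤ K) (x : Fin N) :
    ‖selfErr d z A G i x - selfErr d z (switch A i l j k) H i x‖ ≤ 224 * K ^ 3 * ψ := by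
  refine (norm_selfErr_sub_le h hA hj hk hG hH hGK x).trans ?_
  have h1 := norm_sub_switch_le hA.1 h.q_pos h.K_le hG hH hGK i x
  have hK := h.one_le_K
  have hqi := inv_pos.mpr h.q_pos
  have hψ := h.psi_le
  calc _ ≤ 2 * K * ((qval N d)⁻¹ * (16 * K ^ 2)) + (qval N d)⁻¹ * (80 * K ^ 3 * 1) := by
        have hψ0 := h.psi_nonneg
        gcongr ?_ + _ * (?_ * K ^ ?_ * ?_)
        · gcongr
        all_goals norm_num
    _ = 112 * K ^ 3 * (qval N d)⁻¹ := by ring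
    _ ≤ 112 * K ^ 3 * (2 * ψ) := by
        have := h.inv_q_le
        gcongr
    _ = _ := by ring

theorem norm_offDiag_le (h : Params N d z K ψ) (hGK : ∀ x y, ‖G x y‖ ≤ K)
    (hlam : ∀ i x, ‖selfErr d z A G i x‖ ≤ lam) {i x : Fin N} (hix : i ≠ x) :
    ‖G i x‖ ≤ 4 * K * (lam + ψ) := by
  have hK := h.one_le_K
  have hψ := h.psi_pos
  have hN := h.N_pos
  have hlam0 : 0 ≤ lam := (norm_nonneg _).trans (hlam i x)
  by_cases hc : 1 / 4 ≤ lam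
  · have := hGK i x
    nlinarith
  push Not at hc
  have hN2 : (2 : ℝ) ≤ N := by linarith [h.N_ge, h.d_ge]
  have hNi : (N : ℝ)⁻¹ ≤ 1 / 2 := by
    rw [inv_eq_one_div]
    exact one_div_le_one_div_of_le (by norm_num) hN2
  have hnN : ‖(N : ℂ)⁻¹‖ = (N : ℝ)⁻¹ := by rw [norm_inv, Complex.norm_natCast]
  have h1 : 1 / 4 ≤ ‖z + diagAvg d A G i‖ * ‖G i i‖ := by
    have e : (z + diagAvg d A G i) * G i i = selfErr d z A G i i + (N : ℂ)⁻¹ - 1 := by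
      simp only [selfErr, if_true]; ring
    rw [← norm_mul, e]
    have h2 := norm_sub_norm_le (1 : ℂ) (selfErr d z A G i i + (N : ℂ)⁻¹)
    rw [norm_one, norm_sub_rev] at h2
    have h3 := norm_add_le (selfErr d z A G i i) (N : ℂ)⁻¹
    linarith [hlam i i]
  have h2 : ‖z + diagAvg d A G i‖ * ‖G i x‖ ≤ lam + (N : ℝ)⁻¹ := by
    have e : (z + diagAvg d A G i) * G i x = selfErr d z A G i x + (N : ℂ)⁻¹ := by
      simp only [selfErr, hix, if_false]; ring
    rw [← norm_mul, e]
    exact norm_add_le_of_le (hlam i x) hnN.le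
  have h3 : (N : ℝ)⁻¹ ≤ ψ := by
    rw [inv_le_iff_one_le_mul₀ hN]
    linarith [h.one_le_N_psi]
  have h4 : 1 / 4 ≤ ‖z + diagAvg d A G i‖ * K :=
    h1.trans (mul_le_mul_of_nonneg_left (hGK i i) (norm_nonneg _))
  have h5 : 1 / 4 * ‖G i x‖ ≤ K * (lam + ψ) := by
    calc 1 / 4 * ‖G i x‖ ≤ ‖z + diagAvg d A G i‖ * K * ‖G i x‖ :=
          mul_le_mul_of_nonneg_right h4 (norm_nonneg _)
      _ = K * (‖z + diagAvg d A G i‖ * ‖G i x‖) := by ring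
      _ ≤ K * (lam + ψ) := mul_le_mul_of_nonneg_left (by linarith) (by linarith)
  linarith

theorem norm_sub_switch_row_le (h : Params N d z K ψ) (hA : IsAdjMat N d A) (hj : j ∈ nb A i l)
    (hk : k ∈ nb A l i) (hG : IsGreen (qval N d) A z G)
    (hH : IsGreen (qval N d) (switch A i l j k) z H) (hGK : ∀ x y, ‖G x y‖ ≤ K)
    {Λ : ℝ} (hΛ0 : 0 ≤ Λ) (hΛ : ∀ x y, x ≠ y → ‖G x y‖ ≤ Λ) (x : Fin N) :
    ‖G i x - H i x‖ ≤ (qval N d)⁻¹ * (12 * K * Λ + 128 * K ^ 3 * ψ +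
      2 * K ^ 2 * ((if j = x then 1 else 0) + (if k = x then 1 else 0))) := by
  have hHK := norm_switch_le hA.1 h.q_pos h.K_le hG hH hGK
  have hK := h.one_le_K
  have hqi := inv_pos.mpr h.q_pos
  have hψ := h.psi_pos
  obtain ⟨h1, h2, h3, h4, h5, h6⟩ := ne_of_mem_nb hA hj hk
  have hHb : ∀ a, ‖H a x‖ ≤ Λ + K * (if a = x then 1 else 0) + 32 * K ^ 2 * ψ := by
    intro a
    have g1 := norm_sub_switch_le hA.1 h.q_pos h.K_le hG hH hGK a x
    have g2 : (qval N d)⁻¹ * (16 * K ^ 2) ≤ 2 * ψ * (16 * K ^ 2) :=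
      mul_le_mul_of_nonneg_right h.inv_q_le (by positivity)
    have g3 := norm_sub_le (G a x) (G a x - H a x)
    rw [sub_sub_cancel] at g3
    have g4 : ‖G a x‖ ≤ Λ + K * (if a = x then 1 else 0) := by
      split_ifs with hax
      · linarith [hGK a x]
      · linarith [hΛ a x hax]
    linarith
  rw [switch_sub_apply hA.1 h.q_pos.ne' hG hH, norm_neg_inv_mul h.q_pos]
  refine mul_le_mul_of_nonneg_left ?_ hqi.le
  have t1 := norm_mul_sub_le (hGK i i) (hGK i l) (hHb j) (hHb k)
  have t2 := norm_mul_sub_le (hΛ i j h1) (hΛ i k h3) (hHK i x) (hHK l x)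
  refine (norm_add_le_of_le t1 t2).trans (le_of_eq ?_)
  ring

theorem wsum_mul_selfErr_sub_le (h : Params N d z K ψ)
    (hΓ : ∀ B, IsAdjMat N d B → IsGreen (qval N d) B z (Γ B)) (hA : IsAdjMat N d A)
    (hGK : ∀ x y, ‖Γ A x y‖ ≤ K) (hlam : ∀ i x, ‖selfErr d z A (Γ A) i x‖ ≤ lam) (i x : Fin N) :
    wsum A i (fun l j k => ‖Γ (switch A i l j k) k x‖ *
      ‖selfErr d z A (Γ A) i x - selfErr d z (switch A i l j k) (Γ (switch A i l j k)) i x‖) ≤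
    N * qval N d * (30000 * K ^ 6 * ψ * (lam + ψ)) := by
  set q := qval N d with hq
  set G := Γ A with hGdef
  have hG : IsGreen q A z G := hΓ A hA
  have hq0 : 0 < q := h.q_pos
  have hqi : 0 < q⁻¹ := inv_pos.mpr hq0
  have hN := h.N_pos
  have hψ := h.psi_pos
  have hK := h.one_le_K
  have hd := h.d_ge
  have hlam0 : 0 ≤ lam := (norm_nonneg _).trans (hlam i x)
  set Λ := 4 * K * (lam + ψ) with hΛdef
  have hΛ0 : 0 ≤ Λ := by positivity
  have hΛ : ∀ x y, x ≠ y → ‖G x y‖ ≤ Λ := fun x y hxy => norm_offDiag_le h hGK hlam hxy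
  have hcol : ∀ x, ∑ y, ‖G y x‖ ≤ N * K * ψ := fun x => by
    simp_rw [fun y => hG.comm y x]; exact (hG.sum_norm_le h hA.1 hGK x).2
  set B := 24 * K ^ 2 * Λ + 336 * K ^ 4 * ψ with hB
  have hB0 : 0 ≤ B := by positivity
  have hpt : ∀ l, ∀ j ∈ nb A i l, ∀ k ∈ nb A l i, ‖Γ (switch A i l j k) k x‖ *
      ‖selfErr d z A G i x - selfErr d z (switch A i l j k) (Γ (switch A i l j k)) i x‖ ≤
      q⁻¹ * (B * ‖G k x‖ + B * (32 * K ^ 2 * ψ) + 8 * K ^ 4 * (if j = x then 1 else 0) +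
        8 * K ^ 4 * (if k = x then 1 else 0)) := by
    intro l j hj k hk
    have hH := hΓ _ (isAdjMat_switch hA hj hk)
    have hHK := norm_switch_le hA.1 hq0 h.K_le hG hH hGK
    have g0 := norm_sub_switch_row_le h hA hj hk hG hH hGK hΛ0 hΛ x
    have g1 := norm_selfErr_sub_le h hA hj hk hG hH hGK x
    set I : ℝ := (if j = x then 1 else 0) + (if k = x then 1 else 0) with hI
    have hI0 : 0 ≤ I := by positivity
    have g2 : ‖selfErr d z A G i x -
        selfErr d z (switch A i l j k) (Γ (switch A i l j k)) i x‖ ≤ q⁻¹ * (B + 4 * K ^ 3 * I) := by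
      refine g1.trans ?_
      have : 2 * K * ‖G i x - Γ (switch A i l j k) i x‖ ≤ _ :=
        mul_le_mul_of_nonneg_left g0 (by positivity)
      have k2 : K ^ 2 ≤ K ^ 4 := pow_le_pow_right₀ hK (by norm_num)
      have : q⁻¹ * (80 * K ^ 2 * ψ) ≤ q⁻¹ * (80 * K ^ 4 * ψ) := by gcongr
      rw [← hq] at *
      have e : q⁻¹ * (B + 4 * K ^ 3 * I) = 2 * K * (q⁻¹ * (12 * K * Λ + 128 * K ^ 3 * ψ +
          2 * K ^ 2 * I)) + q⁻¹ * (80 * K ^ 4 * ψ) := by rw [hB]; ring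
      linarith
    have g3 : ‖Γ (switch A i l j k) k x‖ ≤ ‖G k x‖ + 32 * K ^ 2 * ψ := by
      have r1 := norm_sub_switch_le hA.1 hq0 h.K_le hG hH hGK k x
      have r2 : q⁻¹ * (16 * K ^ 2) ≤ 2 * ψ * (16 * K ^ 2) :=
        mul_le_mul_of_nonneg_right h.inv_q_le (by positivity)
      have r3 := norm_sub_le (G k x) (G k x - Γ (switch A i l j k) k x)
      rw [sub_sub_cancel] at r3
      linarith
    calc _ ≤ ‖Γ (switch A i l j k) k x‖ * (q⁻¹ * (B + 4 * K ^ 3 * I)) :=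
          mul_le_mul_of_nonneg_left g2 (norm_nonneg _)
      _ = q⁻¹ * (‖Γ (switch A i l j k) k x‖ * B + ‖Γ (switch A i l j k) k x‖ * (4 * K ^ 3 * I)) := by
          ring
      _ ≤ q⁻¹ * ((‖G k x‖ + 32 * K ^ 2 * ψ) * B + 2 * K * (4 * K ^ 3 * I)) := by
          have := hHK k x
          gcongr
      _ = _ := by rw [hI]; ring
  refine (wsum_le hpt).trans ?_
  rw [wsum_mul_left, wsum_add, wsum_add, wsum_add, wsum_mul_left B (fun _ _ k => ‖G k x‖),
    wsum_mul_left (8 * K ^ 4) (fun _ j _ => if j = x then 1 else 0),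
    wsum_mul_left (8 * K ^ 4) (fun _ _ k => if k = x then 1 else 0)]
  have c0 := wsum_const_le (i := i) hA (c := B * (32 * K ^ 2 * ψ)) (by positivity)
  have c1 := (wsum_right_le (i := i) hA (fun k => norm_nonneg (G k x))).trans
    (mul_le_mul_of_nonneg_left (hcol x) (by linarith))
  have c2 := wsum_ite_left_le (i := i) hA x
  have c3 := wsum_ite_right_le (i := i) hA x
  have w1 : q⁻¹ * d ≤ 2 * q := by
    rw [inv_mul_le_iff₀ hq0]; nlinarith [h.d_le_q_sq]
  have w2 : q⁻¹ ≤ q * (4 * ψ ^ 2) := by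
    rw [inv_le_iff_one_le_mul₀ hq0]
    have := h.one_le_q_psi
    nlinarith
  calc _ ≤ q⁻¹ * (B * (d * (N * K * ψ)) + N * d * (B * (32 * K ^ 2 * ψ)) + 8 * K ^ 4 * N +
        8 * K ^ 4 * N) := by gcongr
    _ = (q⁻¹ * d) * (N * (B * (K + 32 * K ^ 2) * ψ)) + q⁻¹ * (16 * K ^ 4 * N) := by ring
    _ ≤ (2 * q) * (N * (B * (K + 32 * K ^ 2) * ψ)) + (q * (4 * ψ ^ 2)) * (16 * K ^ 4 * N) := by
        gcongr
    _ = N * q * (2 * B * (K + 32 * K ^ 2) * ψ + 64 * K ^ 4 * ψ ^ 2) := by ring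
    _ ≤ N * q * (30000 * K ^ 6 * ψ * (lam + ψ)) := by
        refine mul_le_mul_of_nonneg_left ?_ (by positivity)
        have k1 : K + 32 * K ^ 2 ≤ 33 * K ^ 2 := by nlinarith
        have k4 : K ^ 4 ≤ K ^ 6 := pow_le_pow_right₀ hK (by norm_num)
        have k5 : K ^ 5 ≤ K ^ 6 := pow_le_pow_right₀ hK (by norm_num)
        calc _ ≤ 2 * B * (33 * K ^ 2) * ψ + 64 * K ^ 6 * ψ ^ 2 := by gcongr
          _ = 6336 * K ^ 5 * ψ * (lam + ψ) + 22176 * K ^ 6 * ψ ^ 2 + 64 * K ^ 6 * ψ ^ 2 := by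
              rw [hB, hΛdef]; ring
          _ ≤ 6336 * K ^ 6 * ψ * (lam + ψ) + 22176 * K ^ 6 * ψ ^ 2 + 64 * K ^ 6 * ψ ^ 2 := by
              gcongr
          _ ≤ _ := by
              have : 0 ≤ K ^ 6 * ψ * lam := by positivity
              have : 0 ≤ K ^ 6 * ψ ^ 2 := by positivity
              nlinarith

end Variation

section DiagonalDeviation

variable {N d : ℕ} {A : Matrix (Fin N) (Fin N) ℝ} {z : ℂ} {K ψ : ℝ} {i l j k : Fin N}
  {G H : Matrix (Fin N) (Fin N) ℂ}
  {Γ : Matrix (Fin N) (Fin N) ℝ → Matrix (Fin N) (Fin N) ℂ}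

theorem Params.d_mul_inv_q_le (h : Params N d z K ψ) :
    (N : ℝ) * d * (qval N d)⁻¹ ≤ 4 * (N * (N - d) * ψ) := by
  have hq := h.q_pos
  have hN := h.N_pos
  have hd := h.N_sub_pos
  have h1 : (d : ℝ) * (qval N d)⁻¹ ≤ 2 * qval N d := by
    rw [← div_eq_mul_inv, div_le_iff₀ hq]
    nlinarith [h.d_le_q_sq]
  have h2 : (d : ℝ) * (qval N d)⁻¹ ≤ 4 * ((N - d) * ψ) := by
    have : (N : ℝ) * ψ ≤ 2 * (N - d) * ψ :=
      mul_le_mul_of_nonneg_right (by linarith [h.N_ge]) h.psi_nonneg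
    linarith [h.q_le]
  nlinarith

theorem norm_diagDev_sub_wsum_le (h : Params N d z K ψ)
    (hΓ : ∀ B, IsAdjMat N d B → IsGreen (qval N d) B z (Γ B)) (hA : IsAdjMat N d A)
    (hGK : ∀ x y, ‖Γ A x y‖ ≤ K) (i : Fin N) :
    ‖N * (N - d) * diagDev d A (Γ A) i -
      wsum A i (fun l j k => Γ A j j - Γ (switch A i l j k) k k)‖ ≤
        66 * K ^ 2 * (N * (N - d) * ψ) := by
  have hK := h.one_le_K
  have hN := h.N_pos
  have hd := h.N_sub_pos
  have hqi := inv_pos.mpr h.q_pos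
  have hNC : (N : ℂ) ≠ 0 := by exact_mod_cast hN.ne'
  have hdC : (N : ℂ) - d ≠ 0 := by exact_mod_cast hd.ne'
  have e1 : (N : ℂ) * (N - d) * diagDev d A (Γ A) i =
      N * ∑ k, (A i k : ℂ) * Γ A k k - d * ∑ k, Γ A k k := by
    simp only [diagDev]
    field_simp
  have e2 : wsum A i (fun l j k => Γ A j j - Γ (switch A i l j k) k k) =
      wsum A i (fun _ j k => Γ A j j - Γ A k k) +
      wsum A i (fun l j k => Γ A k k - Γ (switch A i l j k) k k) := by
    rw [← wsum_add]
    exact wsum_congr fun _ _ _ _ _ => by ring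
  have e3 := wsum_sub_eq hA (i := i) (fun k => Γ A k k)
  simp only [Complex.real_smul, Complex.ofReal_natCast] at e3
  have e : (N : ℂ) * (N - d) * diagDev d A (Γ A) i -
      wsum A i (fun l j k => Γ A j j - Γ (switch A i l j k) k k) =
      (∑ k, (A i k : ℂ) * Γ A k k - d * Γ A i i) -
      wsum A i (fun l j k => Γ A k k - Γ (switch A i l j k) k k) := by
    rw [e1, e2, e3]; ring
  have b1 : ‖∑ k, (A i k : ℂ) * Γ A k k‖ ≤ d * K := by
    refine (norm_sum_le_of_le _ (n := fun k => A i k * K) fun k _ => ?_).trans_eq ?_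
    · rw [norm_mul, norm_ofReal_entry hA]
      exact mul_le_mul_of_nonneg_left (hGK k k) (hA.nonneg i k)
    · rw [← Finset.sum_mul, hA.2.2.2]
  have b2 : ‖(d : ℂ) * Γ A i i‖ ≤ d * K := by
    rw [norm_mul, Complex.norm_natCast]
    exact mul_le_mul_of_nonneg_left (hGK i i) (Nat.cast_nonneg _)
  have b3 : ‖wsum A i (fun l j k => Γ A k k - Γ (switch A i l j k) k k)‖ ≤
      N * d * ((qval N d)⁻¹ * (16 * K ^ 2)) := by
    refine (norm_wsum_le_of fun l j hj k hk => ?_).trans (wsum_const_le hA (by positivity))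
    exact norm_sub_switch_le hA.1 h.q_pos h.K_le (hΓ _ hA) (hΓ _ (isAdjMat_switch hA hj hk)) hGK k k
  rw [e]
  refine (norm_sub_le_of_le (norm_sub_le_of_le b1 b2) b3).trans ?_
  have h1 := mul_le_mul_of_nonneg_left h.d_mul_inv_q_le (by positivity : 0 ≤ 16 * K ^ 2)
  have h2 : (d : ℝ) * K ≤ N * (N - d) * ψ * K ^ 2 := by
    have : (d : ℝ) ≤ (N - d) * (N * ψ) := by nlinarith [h.one_le_N_psi, h.N_ge]
    calc (d : ℝ) * K ≤ ((N - d) * (N * ψ)) * K ^ 2 := by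
          have hKK : K ≤ K ^ 2 := by nlinarith
          exact mul_le_mul this hKK (by positivity) ((Nat.cast_nonneg _).trans this)
      _ = _ := by ring
  linarith

theorem norm_diagDev_sub_le (h : Params N d z K ψ) (hA : IsAdjMat N d A) (hj : j ∈ nb A i l)
    (hk : k ∈ nb A l i) (hG : IsGreen (qval N d) A z G)
    (hH : IsGreen (qval N d) (switch A i l j k) z H) (hGK : ∀ x y, ‖G x y‖ ≤ K) :
    ‖diagDev d A G i - diagDev d (switch A i l j k) H i‖ ≤ (qval N d)⁻¹ * (72 * K * ψ) := by
  have hHK := norm_switch_le hA.1 h.q_pos h.K_le hG hH hGK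
  have hs := sum_norm_diag_sub_le h hA.1 (isAdjMat_switch hA hj hk).1 hG hH hGK
  have hK := h.one_le_K
  have hN := h.N_pos
  have hqi := inv_pos.mpr h.q_pos
  have hψ := h.psi_pos
  have e : diagDev d A G i - diagDev d (switch A i l j k) H i = ((N : ℂ) - d)⁻¹ *
      (∑ m, (A i m : ℂ) * (G m m - H m m) - (d : ℂ) / N * ∑ m, (G m m - H m m) -
        (H k k - H j j)) := by
    simp only [diagDev]
    rw [sum_switch_row hA hj hk]
    simp only [mul_sub, Finset.sum_sub_distrib]
    ring
  have h1 : ‖∑ m, (A i m : ℂ) * (G m m - H m m)‖ ≤ (qval N d)⁻¹ * (16 * K * N * ψ ^ 2) := by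
    refine (norm_sum_le_of_le _ fun m _ => ?_).trans hs
    rw [norm_mul, norm_ofReal_entry hA]
    exact mul_le_of_le_one_left (norm_nonneg _) (hA.le_one i m)
  have h2 : ‖(d : ℂ) / N * ∑ m, (G m m - H m m)‖ ≤ (qval N d)⁻¹ * (16 * K * N * ψ ^ 2) := by
    refine le_trans ?_ ((norm_sum_le _ _).trans hs)
    rw [norm_mul, norm_div, Complex.norm_natCast, Complex.norm_natCast]
    refine mul_le_of_le_one_left (norm_nonneg _) ?_
    rw [div_le_one hN]
    linarith [h.N_ge, h.d_ge]
  have h3 := norm_sub_le_of_le (norm_sub_le_of_le h1 h2) (norm_sub_le_of_le (hHK k k) (hHK j j))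
  rw [e, norm_mul, norm_N_sub_inv h]
  calc _ ≤ (2 * (N : ℝ)⁻¹) * ((qval N d)⁻¹ * (16 * K * N * ψ ^ 2) +
        (qval N d)⁻¹ * (16 * K * N * ψ ^ 2) + (2 * K + 2 * K)) :=
        mul_le_mul h.inv_N_sub_le h3 (norm_nonneg _) (by positivity)
    _ = (N : ℝ)⁻¹ * N * ((qval N d)⁻¹ * (64 * K * ψ ^ 2)) + 8 * K * (N : ℝ)⁻¹ := by ring
    _ ≤ 1 * ((qval N d)⁻¹ * (64 * K * ψ)) + 8 * K * ((qval N d)⁻¹ * ψ) := by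
        rw [inv_mul_cancel₀ hN.ne']
        have := h.psi_sq_le
        have := h.inv_N_le
        gcongr
    _ = _ := by ring

theorem wsum_mul_diagDev_sub_le (h : Params N d z K ψ)
    (hΓ : ∀ B, IsAdjMat N d B → IsGreen (qval N d) B z (Γ B)) (hA : IsAdjMat N d A)
    (hGK : ∀ x y, ‖Γ A x y‖ ≤ K) (i : Fin N) :
    wsum A i (fun l j k => ‖Γ (switch A i l j k) k k‖ *
      ‖diagDev d A (Γ A) i - diagDev d (switch A i l j k) (Γ (switch A i l j k)) i‖) ≤
    N * (N - d) * (576 * K ^ 2 * ψ ^ 2) := by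
  have hK := h.one_le_K
  have hqi := inv_pos.mpr h.q_pos
  have hψ := h.psi_pos
  have h1 : wsum A i (fun l j k => ‖Γ (switch A i l j k) k k‖ *
      ‖diagDev d A (Γ A) i - diagDev d (switch A i l j k) (Γ (switch A i l j k)) i‖) ≤
      N * d * (2 * K * ((qval N d)⁻¹ * (72 * K * ψ))) := by
    refine (wsum_le fun l j hj k hk => ?_).trans (wsum_const_le hA (by positivity))
    have hH := hΓ _ (isAdjMat_switch hA hj hk)
    exact mul_le_mul (norm_switch_le hA.1 h.q_pos h.K_le (hΓ _ hA) hH hGK k k)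
      (norm_diagDev_sub_le h hA hj hk (hΓ _ hA) hH hGK) (norm_nonneg _) (by positivity)
  have h2 := mul_le_mul_of_nonneg_left h.d_mul_inv_q_le (by positivity : 0 ≤ 144 * K ^ 2 * ψ)
  linarith

end DiagonalDeviation

section Moments

/-- The function `w ↦ ‖w‖ ^ m * conj w`. -/
def powConj (m : ℕ) (w : ℂ) : ℂ := (‖w‖ : ℂ) ^ m * (starRingEnd ℂ) w

theorem norm_powConj (m : ℕ) (w : ℂ) : ‖powConj m w‖ = ‖w‖ ^ (m + 1) := by
  simp [powConj, pow_succ]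

theorem mul_powConj (m : ℕ) (w : ℂ) : w * powConj m w = ((‖w‖ ^ (m + 2) : ℝ) : ℂ) := by
  simp only [powConj]
  rw [mul_left_comm, Complex.mul_conj, Complex.normSq_eq_norm_sq]
  push_cast
  ring

theorem norm_powConj_sub_le (m : ℕ) (w w' : ℂ) :
    ‖powConj m w - powConj m w'‖ ≤
      ((m + 1) * 2 ^ m) * ‖w - w'‖ * (‖w‖ ^ m + ‖w - w'‖ ^ m) := by
  set r := ‖w‖
  set s := ‖w - w'‖
  have hr : 0 ≤ r := norm_nonneg _
  have hs : 0 ≤ s := norm_nonneg _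
  have hw' : ‖w'‖ ≤ r + s := by
    have : w' = w - (w - w') := by ring
    rw [this]
    exact norm_sub_le _ _
  have e : powConj m w - powConj m w' = (r : ℂ) ^ m * (starRingEnd ℂ) (w - w') +
      ((r : ℂ) ^ m - (‖w'‖ : ℂ) ^ m) * (starRingEnd ℂ) w' := by
    simp only [powConj, map_sub]
    ring
  have h1 : |r ^ m - ‖w'‖ ^ m| * ‖w'‖ ≤ m * s * (r + s) ^ m := by
    rcases m with _ | p
    · simp
    have hab := abs_pow_sub_pow_le (a := r) (b := ‖w'‖) (n := p + 1)
    rw [abs_of_nonneg hr, abs_of_nonneg (norm_nonneg w')] at hab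
    have hm : max r ‖w'‖ ≤ r + s := max_le (by linarith) hw'
    have hd : |r - ‖w'‖| ≤ s := abs_norm_sub_norm_le w w'
    calc _ ≤ (s * (p + 1 : ℕ) * (r + s) ^ p) * (r + s) := by
          refine mul_le_mul (hab.trans ?_) hw' (norm_nonneg _) (by positivity)
          have hp := pow_le_pow_left₀ (le_max_of_le_left hr) hm p
          rw [Nat.add_sub_cancel]
          gcongr
      _ = _ := by push_cast; ring
  have h2 : (r + s) ^ m ≤ 2 ^ m * (r ^ m + s ^ m) := by
    calc (r + s) ^ m ≤ (2 * max r s) ^ m := by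
          gcongr
          linarith [le_max_left r s, le_max_right r s]
      _ = 2 ^ m * (max r s) ^ m := mul_pow _ _ _
      _ ≤ _ := by
          gcongr
          rcases max_choice r s with h | h <;> rw [h] <;> nlinarith [pow_nonneg hr m, pow_nonneg hs m]
  have h3 : r ^ m ≤ (r + s) ^ m := by gcongr; linarith
  rw [e]
  refine (norm_add_le _ _).trans ?_
  rw [norm_mul, norm_mul, norm_pow, RCLike.norm_conj, RCLike.norm_conj, Complex.norm_real,
    Real.norm_of_nonneg hr]
  have e4 : ‖(r : ℂ) ^ m - (‖w'‖ : ℂ) ^ m‖ = |r ^ m - ‖w'‖ ^ m| := by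
    rw [← Complex.ofReal_pow, ← Complex.ofReal_pow, ← Complex.ofReal_sub, Complex.norm_real,
      Real.norm_eq_abs]
  rw [e4]
  calc _ ≤ (r + s) ^ m * s + m * s * (r + s) ^ m :=
        add_le_add (mul_le_mul_of_nonneg_right h3 hs) h1
    _ = (m + 1) * s * (r + s) ^ m := by ring
    _ ≤ (m + 1) * s * (2 ^ m * (r ^ m + s ^ m)) := by gcongr
    _ = _ := by ring

/-- Absorbing the terms of the moment estimate. -/
theorem moment_term_le {m : ℕ} {a u lam L C : ℝ} (ha : 0 ≤ a) (hu : 0 ≤ u) (hlam : 0 ≤ lam)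
    (hL : 1 ≤ L) (hC : 1 ≤ C) :
    u * a ^ (m + 1) + C * (a ^ m + u ^ m) * (u * (lam + u)) ≤
      5 / 8 * (a ^ (m + 2) + (8 * C * u * L) ^ (m + 2) + (lam / L) ^ (m + 2)) := by
  set ρ := max (8 * C * u * L) (lam / L)
  set μ := max a ρ
  have hW : 0 ≤ 8 * C * u * L := by positivity
  have hWμ : 8 * C * u * L ≤ μ := (le_max_left _ _).trans (le_max_right _ _)
  have haμ : a ≤ μ := le_max_left _ _
  have hμ : 0 ≤ μ := ha.trans haμ
  have hlamμ : lam ≤ L * μ := by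
    have : lam / L ≤ μ := (le_max_right _ _).trans (le_max_right _ _)
    rwa [div_le_iff₀' (by linarith)] at this
  have huμ : 8 * (C * u * L) ≤ μ := by linarith
  have hCuL : 0 ≤ C * u * L := by positivity
  have hu8 : 8 * u ≤ μ := by
    have : u ≤ C * u * L := by
      calc u = 1 * u * 1 := by ring
        _ ≤ C * u * L := by gcongr
    linarith
  have hlu : lam + u ≤ 2 * (L * μ) := by nlinarith
  have t1 : u * a ^ (m + 1) ≤ 1 / 8 * μ ^ (m + 2) := by
    calc _ ≤ (μ / 8) * μ ^ (m + 1) := by gcongr; linarith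
      _ = _ := by ring
  have t2 : C * (a ^ m + u ^ m) * (u * (lam + u)) ≤ 1 / 2 * μ ^ (m + 2) := by
    calc _ ≤ C * (μ ^ m + μ ^ m) * (u * (2 * (L * μ))) := by
          gcongr
          linarith
      _ = (8 * (C * u * L)) * (1 / 2 * μ ^ (m + 1)) := by ring
      _ ≤ μ * (1 / 2 * μ ^ (m + 1)) := by gcongr
      _ = _ := by ring
  have t3 : μ ^ (m + 2) ≤ a ^ (m + 2) + (8 * C * u * L) ^ (m + 2) + (lam / L) ^ (m + 2) := by
    have p1 := pow_nonneg ha (m + 2)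
    have p2 := pow_nonneg hW (m + 2)
    have p3 : 0 ≤ (lam / L) ^ (m + 2) := by positivity
    rcases max_choice a ρ with h | h
    · simp only [μ, h]; linarith
    · rcases max_choice (8 * C * u * L) (lam / L) with h' | h'
      · simp only [μ, h]; simp only [ρ, h']; linarith
      · simp only [μ, h]; simp only [ρ, h']; linarith
  linarith

variable {N d : ℕ} {ι : Type*}

/-- A family of functions of a random regular graph which, up to small errors, are discrete
divergences with respect to the switchings. -/
structure SwitchFamily (N d : ℕ) {ι : Type*} (good : Matrix (Fin N) (Fin N) ℝ → Prop)
    (X : ι → Matrix (Fin N) (Fin N) ℝ → ℂ) (v : ι → Matrix (Fin N) (Fin N) ℝ → Fin N → ℂ)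
    (row : ι → Fin N) (c u B : ℝ) : Prop where
  c_pos : 0 < c
  u_nonneg : 0 ≤ u
  B_nonneg : 0 ≤ B
  le_c : (d : ℝ) ≤ c
  norm_X_le : ∀ A, IsAdjMat N d A → ∀ b, ‖X b A‖ ≤ B
  norm_v_le : ∀ A, IsAdjMat N d A → ∀ b k, ‖v b A k‖ ≤ B
  err_le : ∀ A, IsAdjMat N d A → good A → ∀ b,
    ‖c * X b A - wsum A (row b) (fun l j k => v b A j - v b (switch A (row b) l j k) k)‖ ≤ c * u
  sub_le : ∀ A, IsAdjMat N d A → good A → ∀ b l, ∀ j ∈ nb A (row b) l, ∀ k ∈ nb A l (row b),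
    ‖X b A - X b (switch A (row b) l j k)‖ ≤ u
  wsum_le : ∀ A, IsAdjMat N d A → good A → ∀ lam, (∀ b, ‖X b A‖ ≤ lam) → ∀ b,
    wsum A (row b) (fun l j k => ‖v b (switch A (row b) l j k) k‖ *
      ‖X b A - X b (switch A (row b) l j k)‖) ≤ c * (u * (lam + u))

namespace SwitchFamily

variable {good : Matrix (Fin N) (Fin N) ℝ → Prop}
    {X : ι → Matrix (Fin N) (Fin N) ℝ → ℂ} {v : ι → Matrix (Fin N) (Fin N) ℝ → Fin N → ℂ}
    {row : ι → Fin N} {c u B : ℝ} {A : Matrix (Fin N) (Fin N) ℝ}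

/-- The right-hand side of the moment recursion. -/
def remainder (X : ι → Matrix (Fin N) (Fin N) ℝ → ℂ)
    (v : ι → Matrix (Fin N) (Fin N) ℝ → Fin N → ℂ) (row : ι → Fin N) (c : ℝ) (m : ℕ) (b : ι)
    (A : Matrix (Fin N) (Fin N) ℝ) : ℝ :=
  ‖c * X b A - wsum A (row b) (fun l j k => v b A j - v b (switch A (row b) l j k) k)‖ *
    ‖X b A‖ ^ (m + 1) +
  wsum A (row b) (fun l j k => ‖v b (switch A (row b) l j k) k‖ *
    ‖powConj m (X b A) - powConj m (X b (switch A (row b) l j k))‖)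

theorem sum_moment_le (X : ι → Matrix (Fin N) (Fin N) ℝ → ℂ)
    (v : ι → Matrix (Fin N) (Fin N) ℝ → Fin N → ℂ) (row : ι → Fin N) (c : ℝ) (m : ℕ) (b : ι) :
    c * ∑ A ∈ graphs N d, ‖X b A‖ ^ (m + 2) ≤
      ∑ A ∈ graphs N d, remainder X v row c m b A := by
  have key : ((c * ∑ A ∈ graphs N d, ‖X b A‖ ^ (m + 2) : ℝ) : ℂ) =
      ∑ A ∈ graphs N d, ((c * X b A - wsum A (row b)
        (fun l j k => v b A j - v b (switch A (row b) l j k) k)) * powConj m (X b A) -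
        wsum A (row b) (fun l j k => v b (switch A (row b) l j k) k *
          (powConj m (X b A) - powConj m (X b (switch A (row b) l j k))))) := by
    have hsw := sum_wsum_switch (N := N) (d := d) (row b)
      (fun A _ j _ => v b A j * powConj m (X b A))
    have e : ∀ A, (c * X b A - wsum A (row b)
        (fun l j k => v b A j - v b (switch A (row b) l j k) k)) * powConj m (X b A) -
        wsum A (row b) (fun l j k => v b (switch A (row b) l j k) k *
          (powConj m (X b A) - powConj m (X b (switch A (row b) l j k)))) =
        c * ((‖X b A‖ ^ (m + 2) : ℝ) : ℂ) -
        wsum A (row b) (fun _ j _ => v b A j * powConj m (X b A)) +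
        wsum A (row b) (fun l j k => v b (switch A (row b) l j k) k *
          powConj m (X b (switch A (row b) l j k))) := by
      intro A
      simp only [mul_sub, wsum_sub]
      rw [sub_mul, sub_mul, mul_assoc, mul_powConj, wsum_mul_right_complex, wsum_mul_right_complex]
      ring
    simp only [e, Finset.sum_add_distrib, Finset.sum_sub_distrib, hsw]
    push_cast
    rw [Finset.mul_sum]
    ring
  refine (le_abs_self _).trans ?_
  rw [← Real.norm_eq_abs, ← Complex.norm_real, key]
  refine norm_sum_le_of_le _ fun A _ => (norm_sub_le _ _).trans (add_le_add ?_ ?_)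
  · rw [norm_mul, norm_powConj]
  · exact norm_wsum_le_of fun l j _ k _ => (norm_mul _ _).le

theorem remainder_le_of_good (h : SwitchFamily N d good X v row c u B)
    (hA : IsAdjMat N d A)
    (hgood : good A) (m : ℕ) {L lam : ℝ} (hL : 1 ≤ L) (hlam : ∀ b, ‖X b A‖ ≤ lam) (b : ι) :
    remainder X v row c m b A ≤ c * (5 / 8 * (‖X b A‖ ^ (m + 2) +
      (8 * ((m + 1) * 2 ^ m) * u * L) ^ (m + 2) + (lam / L) ^ (m + 2))) := by
  have hc := h.c_pos
  have hu := h.u_nonneg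
  set C : ℝ := (m + 1) * 2 ^ m
  have hC : 1 ≤ C := by
    have : (1 : ℝ) ≤ 2 ^ m := one_le_pow₀ (by norm_num)
    have hm : (0 : ℝ) ≤ m := m.cast_nonneg
    nlinarith
  refine le_trans ?_ (mul_le_mul_of_nonneg_left (moment_term_le (m := m) (norm_nonneg (X b A)) hu
    ((norm_nonneg _).trans (hlam b)) hL hC) hc.le)
  rw [mul_add]
  refine add_le_add ?_ ?_
  · rw [← mul_assoc]
    exact mul_le_mul_of_nonneg_right (h.err_le A hA hgood b) (by positivity)
  · have h1 : wsum A (row b) (fun l j k => ‖v b (switch A (row b) l j k) k‖ *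
        ‖powConj m (X b A) - powConj m (X b (switch A (row b) l j k))‖) ≤
        wsum A (row b) (fun l j k => (C * (‖X b A‖ ^ m + u ^ m)) *
          (‖v b (switch A (row b) l j k) k‖ * ‖X b A - X b (switch A (row b) l j k)‖)) := by
      refine RandomRegular.wsum_le fun l j hj k hk => ?_
      have hs := h.sub_le A hA hgood b l j hj k hk
      calc _ ≤ ‖v b (switch A (row b) l j k) k‖ * (C * ‖X b A - X b (switch A (row b) l j k)‖ *
            (‖X b A‖ ^ m + u ^ m)) := by
            refine mul_le_mul_of_nonneg_left ((norm_powConj_sub_le m _ _).trans ?_) (norm_nonneg _)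
            gcongr
        _ = _ := by ring
    rw [wsum_mul_left] at h1
    refine h1.trans ?_
    calc _ ≤ (C * (‖X b A‖ ^ m + u ^ m)) * (c * (u * (lam + u))) :=
          mul_le_mul_of_nonneg_left (h.wsum_le A hA hgood lam hlam b) (by positivity)
      _ = _ := by ring

theorem remainder_le (h : SwitchFamily N d good X v row c u B) (hA : IsAdjMat N d A) (m : ℕ)
    (b : ι) : remainder X v row c m b A ≤ c * ((1 + 4 * N) * B ^ (m + 2)) := by
  have hc := h.c_pos
  have hB := h.B_nonneg
  have hX := h.norm_X_le A hA b
  have h1 : ‖wsum A (row b) (fun l j k => v b A j - v b (switch A (row b) l j k) k)‖ ≤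
      N * d * (B + B) := by
    refine (norm_wsum_le_of fun l j hj k hk => ?_).trans (wsum_const_le hA (by positivity))
    exact norm_sub_le_of_le (h.norm_v_le A hA b j)
      (h.norm_v_le _ (isAdjMat_switch hA hj hk) b k)
  have h2 : wsum A (row b) (fun l j k => ‖v b (switch A (row b) l j k) k‖ *
      ‖powConj m (X b A) - powConj m (X b (switch A (row b) l j k))‖) ≤
      N * d * (B * (B ^ (m + 1) + B ^ (m + 1))) := by
    refine (RandomRegular.wsum_le fun l j hj k hk => ?_).trans (wsum_const_le hA (by positivity))
    have hA' := isAdjMat_switch hA hj hk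
    refine mul_le_mul (h.norm_v_le _ hA' b k) (norm_sub_le_of_le ?_ ?_) (norm_nonneg _) hB
    · rw [norm_powConj]
      exact pow_le_pow_left₀ (norm_nonneg _) hX _
    · rw [norm_powConj]
      exact pow_le_pow_left₀ (norm_nonneg _) (h.norm_X_le _ hA' b) _
  have h3 : ‖(c : ℂ) * X b A‖ ≤ c * B := by
    rw [norm_mul, Complex.norm_real, Real.norm_of_nonneg hc.le]
    gcongr
  have h4 : ‖c * X b A - wsum A (row b)
      (fun l j k => v b A j - v b (switch A (row b) l j k) k)‖ * ‖X b A‖ ^ (m + 1) ≤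
      (c * B + N * d * (B + B)) * B ^ (m + 1) :=
    mul_le_mul (norm_sub_le_of_le h3 h1) (pow_le_pow_left₀ (norm_nonneg _) hX _) (by positivity)
      (by positivity)
  refine (add_le_add h4 h2).trans ?_
  have h5 := mul_le_mul_of_nonneg_right h.le_c (by positivity : 0 ≤ 4 * N * B ^ (m + 2))
  calc _ = c * B ^ (m + 2) + d * (4 * N * B ^ (m + 2)) := by ring
    _ ≤ c * B ^ (m + 2) + c * (4 * N * B ^ (m + 2)) := by gcongr
    _ = _ := by ring

open Classical in
theorem sum_remainder_le [Fintype ι] [Nonempty ι] (h : SwitchFamily N d good X v row c u B)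
    (hA : IsAdjMat N d A) (m : ℕ) {L : ℝ} (hL : 1 ≤ L)
    (hLι : 5 * (Fintype.card ι : ℝ) ≤ L ^ (m + 2)) :
    ∑ b, remainder X v row c m b A ≤ c * (3 / 4 * ∑ b, ‖X b A‖ ^ (m + 2) +
      Fintype.card ι * (8 * ((m + 1) * 2 ^ m) * u * L) ^ (m + 2) +
      (if good A then 0 else Fintype.card ι * ((1 + 4 * N) * B ^ (m + 2)))) := by
  have hu := h.u_nonneg
  have hB := h.B_nonneg
  set W : ℝ := (8 * ((m + 1) * 2 ^ m) * u * L) ^ (m + 2)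
  have hW : 0 ≤ W := by positivity
  have hs : 0 ≤ ∑ b, ‖X b A‖ ^ (m + 2) := Finset.sum_nonneg fun b _ => by positivity
  have hι : (0 : ℝ) < Fintype.card ι := by exact_mod_cast Fintype.card_pos
  by_cases hg : good A
  · obtain ⟨b₀, hb₀⟩ := Finite.exists_max fun b => ‖X b A‖
    refine (Finset.sum_le_sum fun b _ => h.remainder_le_of_good hA hg m hL hb₀ b).trans ?_
    rw [← Finset.mul_sum, ← Finset.mul_sum, Finset.sum_add_distrib, Finset.sum_add_distrib]
    simp only [Finset.sum_const, Finset.card_univ, nsmul_eq_mul, hg, if_true]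
    have h0 : ‖X b₀ A‖ ^ (m + 2) ≤ ∑ b, ‖X b A‖ ^ (m + 2) :=
      Finset.single_le_sum (f := fun b => ‖X b A‖ ^ (m + 2)) (fun b _ => by positivity)
        (Finset.mem_univ b₀)
    have h1 : (Fintype.card ι : ℝ) * (‖X b₀ A‖ / L) ^ (m + 2) ≤
        1 / 5 * ∑ b, ‖X b A‖ ^ (m + 2) := by
      rw [div_pow, mul_div_assoc', div_le_iff₀ (by positivity)]
      nlinarith
    refine mul_le_mul_of_nonneg_left ?_ h.c_pos.le
    have : 0 ≤ (Fintype.card ι : ℝ) * W := by positivity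
    linarith
  · refine (Finset.sum_le_sum fun b _ => h.remainder_le hA m b).trans ?_
    simp only [Finset.sum_const, Finset.card_univ, nsmul_eq_mul, hg, if_false]
    have : 0 ≤ c * (3 / 4 * ∑ b, ‖X b A‖ ^ (m + 2) + Fintype.card ι * W) :=
      mul_nonneg h.c_pos.le (by positivity)
    linarith

open Classical in
theorem card_le [Fintype ι] [Nonempty ι] (h : SwitchFamily N d good X v row c u B) (m : ℕ)
    {L t : ℝ} (hL : 1 ≤ L) (hLι : 5 * (Fintype.card ι : ℝ) ≤ L ^ (m + 2)) (ht : 0 ≤ t) :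
    (((graphs N d).filter fun A => ∃ b, t ≤ ‖X b A‖).card : ℝ) * t ^ (m + 2) ≤
      4 * Fintype.card ι * ((graphs N d).card * (8 * ((m + 1) * 2 ^ m) * u * L) ^ (m + 2) +
        ((graphs N d).filter fun A => ¬ good A).card * ((1 + 4 * N) * B ^ (m + 2))) := by
  set W : ℝ := (8 * ((m + 1) * 2 ^ m) * u * L) ^ (m + 2)
  set S : ℝ := ∑ A ∈ graphs N d, ∑ b, ‖X b A‖ ^ (m + 2)
  have h1 : c * S ≤ c * (3 / 4 * S + (graphs N d).card * (Fintype.card ι * W) +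
      ((graphs N d).filter fun A => ¬ good A).card *
        (Fintype.card ι * ((1 + 4 * N) * B ^ (m + 2)))) := by
    calc c * S = ∑ b, c * ∑ A ∈ graphs N d, ‖X b A‖ ^ (m + 2) := by
          rw [← Finset.mul_sum, Finset.sum_comm]
      _ ≤ ∑ b, ∑ A ∈ graphs N d, remainder X v row c m b A :=
          Finset.sum_le_sum fun b _ => sum_moment_le X v row c m b
      _ = ∑ A ∈ graphs N d, ∑ b, remainder X v row c m b A := Finset.sum_comm
      _ ≤ _ := Finset.sum_le_sum fun A hA =>
          h.sum_remainder_le (mem_graphs.mp hA) m hL hLι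
      _ = _ := by
          rw [← Finset.mul_sum, Finset.sum_add_distrib, Finset.sum_add_distrib, ← Finset.mul_sum,
            Finset.sum_const, nsmul_eq_mul]
          congr 2
          have e : ∀ A, (if good A then (0 : ℝ) else Fintype.card ι * ((1 + 4 * N) * B ^ (m + 2))) =
              if ¬ good A then Fintype.card ι * ((1 + 4 * N) * B ^ (m + 2)) else 0 := by
            intro A
            by_cases hA : good A <;> simp [hA]
          simp only [e]
          rw [← Finset.sum_filter, Finset.sum_const, nsmul_eq_mul]
  have h2 := le_of_mul_le_mul_left h1 h.c_pos
  have h3 : (((graphs N d).filter fun A => ∃ b, t ≤ ‖X b A‖).card : ℝ) * t ^ (m + 2) ≤ S := by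
    rw [← nsmul_eq_mul, ← Finset.sum_const]
    refine (Finset.sum_le_sum fun A hA => ?_).trans
      (Finset.sum_le_sum_of_subset_of_nonneg (Finset.filter_subset _ _) fun A _ _ =>
        Finset.sum_nonneg fun b _ => by positivity)
    obtain ⟨b, hb⟩ := (Finset.mem_filter.mp hA).2
    exact (pow_le_pow_left₀ ht hb _).trans
      (Finset.single_le_sum (f := fun b => ‖X b A‖ ^ (m + 2)) (fun b _ => by positivity)
        (Finset.mem_univ b))
  linarith

open Classical in
/-- Markov's inequality for a switch family. -/
theorem PrReg_le [Fintype ι] [Nonempty ι] (h : SwitchFamily N d good X v row c u B) (m : ℕ)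
    {L : ℝ} (hL : 1 ≤ L) (hLι : 5 * (Fintype.card ι : ℝ) ≤ L ^ (m + 2)) (hu : 0 < u) :
    PrReg N d (fun A => ∃ b, 8 * ((m + 1) * 2 ^ m) * u * L ^ 2 ≤ ‖X b A‖) ≤
      4 * Fintype.card ι * ((L ^ (m + 2))⁻¹ + PrReg N d (fun A => ¬ good A) *
        ((1 + 4 * N) * (B / u) ^ (m + 2))) := by
  have hB := h.B_nonneg
  set C : ℝ := 8 * ((m + 1) * 2 ^ m)
  have hC : 1 ≤ C := by
    have : (1 : ℝ) ≤ 2 ^ m := one_le_pow₀ (by norm_num)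
    have hm : (0 : ℝ) ≤ m := m.cast_nonneg
    simp only [C]
    nlinarith
  have h1 := h.card_le m hL hLι (t := C * u * L ^ 2) (by positivity)
  set bad : ℝ := (((graphs N d).filter fun A => ¬ good A).card : ℝ) with hbad_def
  set cnt : ℝ := (((graphs N d).filter fun A => ∃ b, C * u * L ^ 2 ≤ ‖X b A‖).card : ℝ)
    with hcnt_def
  have e1 : PrReg N d (fun A => ¬ good A) = bad / (graphs N d).card := by
    rw [PrReg_eq, hbad_def]
    congr!
  have e2 : PrReg N d (fun A => ∃ b, C * u * L ^ 2 ≤ ‖X b A‖) = cnt / (graphs N d).card := by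
    rw [PrReg_eq, hcnt_def]
    congr!
  rw [e1, e2]
  rcases (Nat.cast_nonneg (α := ℝ) (graphs N d).card).eq_or_lt with h0 | h0
  · rw [← h0]
    simp only [div_zero, zero_mul, add_zero]
    positivity
  set g : ℝ := ((graphs N d).card : ℝ)
  have hbad : 0 ≤ bad := Nat.cast_nonneg _
  have hCu : u ≤ C * u * L ^ 2 := by
    calc u = 1 * u * 1 ^ 2 := by ring
      _ ≤ _ := by gcongr
  have h2 : (C * u * L) ^ (m + 2) = (C * u * L ^ 2) ^ (m + 2) * (L ^ (m + 2))⁻¹ := by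
    have : C * u * L ^ 2 = C * u * L * L := by ring
    rw [this, mul_pow (C * u * L) L, mul_inv_cancel_right₀ (by positivity)]
  have h3 : B ^ (m + 2) ≤ (C * u * L ^ 2) ^ (m + 2) * (B / u) ^ (m + 2) := by
    rw [← mul_pow]
    refine pow_le_pow_left₀ hB ?_ _
    calc B = u * (B / u) := by field_simp
      _ ≤ _ := by gcongr
  have htp : 0 < (C * u * L ^ 2) ^ (m + 2) := by positivity
  rw [div_le_iff₀ h0]
  refine le_of_mul_le_mul_right (h1.trans ?_) htp
  calc _ ≤ 4 * (Fintype.card ι : ℝ) * (g * ((C * u * L ^ 2) ^ (m + 2) * (L ^ (m + 2))⁻¹) +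
        bad * ((1 + 4 * N) * ((C * u * L ^ 2) ^ (m + 2) * (B / u) ^ (m + 2)))) := by
        rw [h2]
        gcongr
    _ = _ := by field_simp

end SwitchFamily

end Moments

section Probability

variable {N d : ℕ}

theorem PrReg_nonneg (N d : ℕ) (E : Matrix (Fin N) (Fin N) ℝ → Prop) : 0 ≤ PrReg N d E := by
  unfold PrReg
  positivity

open Classical in
theorem PrReg_mono {E F : Matrix (Fin N) (Fin N) ℝ → Prop}
    (h : ∀ A, IsAdjMat N d A → E A → F A) : PrReg N d E ≤ PrReg N d F := by
  rw [PrReg_eq, PrReg_eq]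
  gcongr (Nat.cast ?_) / _
  refine Finset.card_le_card fun A hA => ?_
  rw [Finset.mem_filter] at hA ⊢
  exact ⟨hA.1, h A (mem_graphs.mp hA.1) hA.2⟩

open Classical in
theorem PrReg_or_le (E F : Matrix (Fin N) (Fin N) ℝ → Prop) :
    PrReg N d (fun A => E A ∨ F A) ≤ PrReg N d E + PrReg N d F := by
  rw [PrReg_eq, PrReg_eq, PrReg_eq, ← add_div]
  gcongr
  refine le_trans ?_ (Nat.cast_le.mpr (Finset.card_union_le _ _) |>.trans_eq (Nat.cast_add _ _))
  gcongr
  intro A hA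
  simp only [Finset.mem_filter, Finset.mem_union] at hA ⊢
  tauto

theorem PrReg_exists_le {ι : Type*} (s : Finset ι) (E : ι → Matrix (Fin N) (Fin N) ℝ → Prop)
    {p : ℝ} (hE : ∀ a ∈ s, PrReg N d (E a) ≤ p) :
    PrReg N d (fun A => ∃ a ∈ s, E a A) ≤ s.card * p := by
  classical
  induction s using Finset.induction_on with
  | empty => simp [PrReg]
  | insert a s ha ih =>
    have h1 : PrReg N d (fun A => ∃ b ∈ insert a s, E b A) ≤
        PrReg N d (fun A => E a A ∨ ∃ b ∈ s, E b A) := by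
      refine PrReg_mono fun A _ h => ?_
      simpa using h
    have h2 := PrReg_or_le (N := N) (d := d) (E a) (fun A => ∃ b ∈ s, E b A)
    have h3 := hE a (Finset.mem_insert_self _ _)
    have h4 := ih fun b hb => hE b (Finset.mem_insert_of_mem hb)
    rw [Finset.card_insert_of_notMem ha]
    push_cast
    linarith

end Probability

section SelfConsistent

variable {N d : ℕ} {z : ℂ} {K ψ : ℝ}
  {Γ : Matrix (Fin N) (Fin N) ℝ → Matrix (Fin N) (Fin N) ℂ} {A : Matrix (Fin N) (Fin N) ℝ}

theorem Params.norm_green_le (h : Params N d z K ψ) {G : Matrix (Fin N) (Fin N) ℂ}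
    (hA : IsAdjMat N d A) (hG : IsGreen (qval N d) A z G) (x y : Fin N) : ‖G x y‖ ≤ N := by
  refine (hG.norm_le_inv hA.1 h.q_pos.ne' h.im_pos x y).trans (h.inv_im_le.trans ?_)
  have := h.psi_le
  have := h.psi_nonneg
  exact mul_le_of_le_one_right h.N_pos.le (by nlinarith)

theorem Params.K_le_N (h : Params N d z K ψ) : K ≤ N := by
  have := h.K_le
  have := h.q_le
  have := mul_le_of_le_one_right h.N_pos.le h.psi_le
  linarith [h.one_le_K]

theorem Params.one_le_N (h : Params N d z K ψ) : (1 : ℝ) ≤ N := h.one_le_K.trans h.K_le_N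

theorem Params.norm_diagAvg_le (h : Params N d z K ψ) {G : Matrix (Fin N) (Fin N) ℂ} {M : ℝ}
    (hA : IsAdjMat N d A) (hGM : ∀ x y, ‖G x y‖ ≤ M) (i : Fin N) :
    ‖diagAvg d A G i‖ ≤ M := by
  have hd := h.N_sub_pos
  rw [diagAvg, norm_mul, norm_N_sub_inv h, inv_mul_le_iff₀ hd, ← sum_one_sub hA i, Finset.sum_mul]
  refine norm_sum_le_of_le _ fun k _ => ?_
  rw [norm_mul, norm_one_sub hA]
  exact mul_le_mul_of_nonneg_left (hGM k k) (sub_nonneg.mpr (hA.le_one i k))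

theorem Params.norm_selfErr_le (h : Params N d z K ψ) {G : Matrix (Fin N) (Fin N) ℂ}
    (hA : IsAdjMat N d A) (hG : IsGreen (qval N d) A z G) (i x : Fin N) :
    ‖selfErr d z A G i x‖ ≤ 4 * N ^ 2 := by
  have hGN := h.norm_green_le hA hG
  have hN := h.one_le_N
  have hz : ‖z‖ ≤ N := by linarith [h.le_K, h.K_le_N]
  have h1 : ‖(if i = x then 1 else 0 : ℂ)‖ ≤ 1 := by split_ifs <;> simp
  have h2 : ‖(N : ℂ)⁻¹‖ ≤ 1 := by
    rw [norm_inv, Complex.norm_natCast]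
    exact inv_le_one_of_one_le₀ hN
  have h3 : ‖z * G i x‖ ≤ N * N := by
    rw [norm_mul]
    exact mul_le_mul hz (hGN i x) (norm_nonneg _) (by positivity)
  have h4 : ‖diagAvg d A G i * G i x‖ ≤ N * N := by
    rw [norm_mul]
    exact mul_le_mul (h.norm_diagAvg_le hA hGN i) (hGN i x) (norm_nonneg _) (by positivity)
  refine (norm_add_le_of_le (norm_add_le_of_le (norm_sub_le_of_le h1 h2) h3) h4).trans ?_
  nlinarith

theorem Params.norm_diagDev_le (h : Params N d z K ψ) {G : Matrix (Fin N) (Fin N) ℂ}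
    (hA : IsAdjMat N d A) (hG : IsGreen (qval N d) A z G) (i : Fin N) :
    ‖diagDev d A G i‖ ≤ 4 * N ^ 2 := by
  have hGN := h.norm_green_le hA hG
  have hN := h.one_le_N
  have hd := h.N_sub_pos
  have h1 : ‖∑ k, (A i k : ℂ) * G k k‖ ≤ d * N := by
    refine (norm_sum_le_of_le _ (n := fun k => A i k * N) fun k _ => ?_).trans_eq ?_
    · rw [norm_mul, norm_ofReal_entry hA]
      exact mul_le_mul_of_nonneg_left (hGN k k) (hA.nonneg i k)
    · rw [← Finset.sum_mul, hA.2.2.2]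
  have h2 : ‖(d : ℂ) / N * ∑ k, G k k‖ ≤ d * N := by
    have : ‖∑ k, G k k‖ ≤ N * N := by
      refine (norm_sum_le_of_le _ (n := fun _ => (N : ℝ)) fun k _ => hGN k k).trans_eq ?_
      simp
    rw [norm_mul, norm_div, Complex.norm_natCast, Complex.norm_natCast]
    calc _ ≤ (d : ℝ) / N * (N * N) := by gcongr
      _ = _ := by field_simp
  rw [diagDev, norm_mul, norm_N_sub_inv h, inv_mul_le_iff₀ hd]
  refine (norm_sub_le_of_le h1 h2).trans ?_
  have : (d : ℝ) * N ≤ (N - d) * N ^ 2 := by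
    have := h.N_ge
    calc (d : ℝ) * N ≤ (N - d) * N := by gcongr; linarith
      _ ≤ (N - d) * N ^ 2 := by gcongr; nlinarith
  nlinarith

theorem switchFamily_selfErr (h : Params N d z K ψ)
    (hΓ : ∀ B, IsAdjMat N d B → IsGreen (qval N d) B z (Γ B)) :
    SwitchFamily N d (fun A => ∀ x y, ‖Γ A x y‖ ≤ K)
      (fun (b : Fin N × Fin N) A => selfErr d z A (Γ A) b.1 b.2) (fun b A k => Γ A k b.2)
      (fun b => b.1) (N * qval N d) (30000 * K ^ 6 * ψ) (4 * N ^ 2) where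
  c_pos := mul_pos h.N_pos h.q_pos
  u_nonneg := by have := h.one_le_K; have := h.psi_nonneg; positivity
  B_nonneg := by positivity
  le_c := by nlinarith [h.q_ge, h.N_ge, h.N_pos, h.d_ge]
  norm_X_le A hA b := h.norm_selfErr_le hA (hΓ A hA) b.1 b.2
  norm_v_le A hA b k := by
    refine (h.norm_green_le hA (hΓ A hA) k b.2).trans ?_
    nlinarith [h.one_le_N]
  err_le A hA hgood b := by
    have hK := h.one_le_K
    have hq := h.q_pos
    have hψ := h.psi_pos
    have := norm_selfErr_sub_wsum_le h hΓ hA hgood b.1 b.2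
    push_cast
    refine this.trans ?_
    calc 600 * K ^ 3 * (N * qval N d * ψ) ≤ 30000 * K ^ 6 * (N * qval N d * ψ) := by
          gcongr
          all_goals norm_num [hK]
      _ = _ := by ring
  sub_le A hA hgood b l j hj k hk := by
    have hK := h.one_le_K
    have hψ := h.psi_pos
    refine (norm_selfErr_sub_le_psi h hA hj hk (hΓ _ hA) (hΓ _ (isAdjMat_switch hA hj hk)) hgood
      b.2).trans ?_
    gcongr
    all_goals norm_num [hK]
  wsum_le A hA hgood lam hlam b := by
    have hK := h.one_le_K
    have hψ := h.psi_pos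
    have hq := h.q_pos
    have hlam0 := (norm_nonneg _).trans (hlam b)
    refine (wsum_mul_selfErr_sub_le h hΓ hA hgood (fun i x => hlam (i, x)) b.1 b.2).trans ?_
    have : ψ ≤ 30000 * K ^ 6 * ψ := by
      have : 1 ≤ K ^ 6 := one_le_pow₀ hK
      nlinarith
    gcongr

theorem switchFamily_diagDev (h : Params N d z K ψ)
    (hΓ : ∀ B, IsAdjMat N d B → IsGreen (qval N d) B z (Γ B)) :
    SwitchFamily N d (fun A => ∀ x y, ‖Γ A x y‖ ≤ K)
      (fun (i : Fin N) A => diagDev d A (Γ A) i) (fun _ A k => Γ A k k)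
      (fun i => i) (N * (N - d)) (30000 * K ^ 6 * ψ) (4 * N ^ 2) where
  c_pos := mul_pos h.N_pos h.N_sub_pos
  u_nonneg := by have := h.one_le_K; have := h.psi_nonneg; positivity
  B_nonneg := by positivity
  le_c := by nlinarith [h.N_ge, h.one_le_N, h.d_ge]
  norm_X_le A hA b := h.norm_diagDev_le hA (hΓ A hA) b
  norm_v_le A hA b k := by
    refine (h.norm_green_le hA (hΓ A hA) k k).trans ?_
    nlinarith [h.one_le_N]
  err_le A hA hgood b := by
    have hK := h.one_le_K
    have hd := h.N_sub_pos
    have hψ := h.psi_pos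
    have := norm_diagDev_sub_wsum_le h hΓ hA hgood b
    push_cast
    refine this.trans ?_
    calc 66 * K ^ 2 * (N * (N - d) * ψ) ≤ 30000 * K ^ 6 * (N * (N - d) * ψ) := by
          gcongr
          all_goals norm_num [hK]
      _ = _ := by ring
  sub_le A hA hgood b l j hj k hk := by
    have hK := h.one_le_K
    have hψ := h.psi_pos
    refine (norm_diagDev_sub_le h hA hj hk (hΓ _ hA) (hΓ _ (isAdjMat_switch hA hj hk)) hgood).trans
      ?_
    have hq : (qval N d)⁻¹ ≤ 1 := inv_le_one_of_one_le₀ (by linarith [h.q_ge])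
    calc _ ≤ 1 * (72 * K * ψ) := by gcongr
      _ ≤ 30000 * K ^ 6 * ψ := by
        rw [one_mul]
        have : K ≤ K ^ 6 := le_self_pow₀ hK (by norm_num)
        gcongr
        norm_num
  wsum_le A hA hgood lam hlam b := by
    have hK := h.one_le_K
    have hψ := h.psi_pos
    have hd := h.N_sub_pos
    have hlam0 := (norm_nonneg _).trans (hlam b)
    refine (wsum_mul_diagDev_sub_le h hΓ hA hgood b).trans ?_
    have h6 : 1 ≤ K ^ 6 := one_le_pow₀ hK
    have h2 : K ^ 2 ≤ K ^ 6 := pow_le_pow_right₀ hK (by norm_num)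
    have h1 : ψ ≤ lam + 30000 * K ^ 6 * ψ := by nlinarith
    refine mul_le_mul_of_nonneg_left ?_ (by positivity)
    calc 576 * K ^ 2 * ψ ^ 2 = 576 * K ^ 2 * ψ * ψ := by ring
      _ ≤ _ := by gcongr; norm_num

/-- Concentration of the self-consistent equation. -/
theorem PrReg_selfErr_or_diagDev_le (h : Params N d z K ψ) (m : ℕ) {L : ℝ} (hL : 1 ≤ L)
    (hLN : 5 * (N : ℝ) ^ 2 ≤ L ^ (m + 2)) :
    PrReg N d (fun A => ∃ i x,
      8 * ((m + 1) * 2 ^ m) * (30000 * K ^ 6 * ψ) * L ^ 2 ≤ ‖selfErr d z A (greenM N d A z) i x‖ ∨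
      8 * ((m + 1) * 2 ^ m) * (30000 * K ^ 6 * ψ) * L ^ 2 ≤ ‖diagDev d A (greenM N d A z) i‖) ≤
    8 * N ^ 2 * ((L ^ (m + 2))⁻¹ + PrReg N d (fun A => ¬ ∀ x y, ‖greenM N d A z x y‖ ≤ K) *
      ((1 + 4 * N) * (4 * N ^ 3) ^ (m + 2))) := by
  have hΓ : ∀ B, IsAdjMat N d B → IsGreen (qval N d) B z (greenM N d B z) :=
    fun B hB => isGreen_greenM hB h.q_pos h.im_pos.ne'
  have hN := h.one_le_N
  have hK := h.one_le_K
  have hψ := h.psi_pos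
  have hNn : 0 < N := by exact_mod_cast h.N_pos
  have : Nonempty (Fin N) := ⟨⟨0, hNn⟩⟩
  have hu : 0 < 30000 * K ^ 6 * ψ := by positivity
  have h1 := (switchFamily_selfErr h hΓ).PrReg_le m hL
    (by rw [Fintype.card_prod, Fintype.card_fin]; push_cast; linarith) hu
  have h2 := (switchFamily_diagDev h hΓ).PrReg_le m hL
    (by rw [Fintype.card_fin]; nlinarith) hu
  set p := PrReg N d (fun A => ¬ ∀ x y, ‖greenM N d A z x y‖ ≤ K)
  have hp : 0 ≤ p := PrReg_nonneg _ _ _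
  have hBu : 4 * (N : ℝ) ^ 2 / (30000 * K ^ 6 * ψ) ≤ 4 * N ^ 3 := by
    rw [div_le_iff₀ hu]
    have h6 : 1 ≤ K ^ 6 := one_le_pow₀ hK
    have h7 := h.one_le_N_psi
    calc 4 * (N : ℝ) ^ 2 = 4 * N ^ 2 * (1 * 1 * 1) := by ring
      _ ≤ 4 * N ^ 2 * (30000 * K ^ 6 * (N * ψ)) := by gcongr; norm_num
      _ = _ := by ring
  have hR : (L ^ (m + 2))⁻¹ + p * ((1 + 4 * N) * (4 * (N : ℝ) ^ 2 / (30000 * K ^ 6 * ψ)) ^ (m + 2)) ≤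
      (L ^ (m + 2))⁻¹ + p * ((1 + 4 * N) * (4 * N ^ 3) ^ (m + 2)) := by
    gcongr
  have hR0 : 0 ≤ (L ^ (m + 2))⁻¹ + p * ((1 + 4 * N) * (4 * N ^ 3) ^ (m + 2)) := by positivity
  have h3 : (Fintype.card (Fin N × Fin N) : ℝ) = N ^ 2 := by
    rw [Fintype.card_prod, Fintype.card_fin]; push_cast; ring
  have h4 : (Fintype.card (Fin N) : ℝ) ≤ N ^ 2 := by rw [Fintype.card_fin]; nlinarith
  refine (PrReg_mono (F := fun A => (∃ b : Fin N × Fin N, 8 * ((m + 1) * 2 ^ m) *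
    (30000 * K ^ 6 * ψ) * L ^ 2 ≤ ‖selfErr d z A (greenM N d A z) b.1 b.2‖) ∨
    (∃ i : Fin N, 8 * ((m + 1) * 2 ^ m) * (30000 * K ^ 6 * ψ) * L ^ 2 ≤
      ‖diagDev d A (greenM N d A z) i‖)) ?_).trans ?_
  · rintro A - ⟨i, x, hix | hi⟩
    · exact Or.inl ⟨(i, x), hix⟩
    · exact Or.inr ⟨i, hi⟩
  refine (PrReg_or_le _ _).trans ((add_le_add h1 h2).trans ?_)
  rw [h3]
  calc _ ≤ 4 * (N : ℝ) ^ 2 * ((L ^ (m + 2))⁻¹ + p * ((1 + 4 * N) * (4 * N ^ 3) ^ (m + 2))) +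
        4 * (N : ℝ) ^ 2 * ((L ^ (m + 2))⁻¹ + p * ((1 + 4 * N) * (4 * N ^ 3) ^ (m + 2))) := by
        gcongr
    _ = _ := by ring

end SelfConsistent

section Semicircle

open Complex in
/-- An explicit root of the semicircle equation in the unit disc. -/
theorem exists_root_norm_lt_one {z : ℂ} (hz : 0 < z.im) :
    ∃ m : ℂ, m ^ 2 + z * m + 1 = 0 ∧ ‖m‖ < 1 := by
  obtain ⟨s, hs⟩ := IsAlgClosed.exists_pow_nat_eq (z ^ 2 - 4) (n := 2) (by norm_num)
  have hroot : ∀ t : ℂ, t ^ 2 = z ^ 2 - 4 → ((-z + t) / 2) ^ 2 + z * ((-z + t) / 2) + 1 = 0 := by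
    intro t ht
    linear_combination (1 / 4) * ht
  have hne : ∀ m : ℂ, m ^ 2 + z * m + 1 = 0 → ‖m‖ ≠ 1 := by
    intro m hm h1
    have hconj : m * (starRingEnd ℂ) m = 1 := by
      rw [Complex.mul_conj, Complex.normSq_eq_norm_sq, h1]; norm_num
    have hm0 : m ≠ 0 := by
      rintro rfl
      simp at h1
    have h2 : z = -(m + (starRingEnd ℂ) m) := by
      apply mul_right_cancel₀ hm0
      linear_combination hm + hconj
    rw [h2] at hz
    simp at hz
  have hprod : ((-z + s) / 2) * ((-z + -s) / 2) = 1 := by linear_combination (-1 / 4) * hs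
  have hs' : (-s) ^ 2 = z ^ 2 - 4 := by rw [neg_sq, hs]
  have h1 := congrArg norm hprod
  rw [norm_mul, norm_one] at h1
  rcases lt_trichotomy ‖(-z + s) / 2‖ 1 with h | h | h
  · exact ⟨_, hroot s hs, h⟩
  · exact absurd h (hne _ (hroot s hs))
  · refine ⟨_, hroot (-s) hs', ?_⟩
    by_contra! hc
    nlinarith [norm_nonneg ((-z + s) / 2)]

open Complex in
theorem hasDerivAt_log_one_add_mul_exp {m a : ℂ} (hm : ‖m‖ < 1) (ha : a.re = 0) (θ : ℝ) :
    HasDerivAt (fun θ : ℝ => Complex.log (1 + m * Complex.exp (a * θ)))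
      (a * (m * Complex.exp (a * θ)) / (1 + m * Complex.exp (a * θ))) θ := by
  have h1 : HasDerivAt (fun w : ℂ => 1 + m * Complex.exp (a * w)) (a * (m * Complex.exp (a * θ)))
      (θ : ℂ) := by
    have := (((hasDerivAt_id (θ : ℂ)).const_mul a).cexp.const_mul m).const_add 1
    refine this.congr_deriv ?_
    simp only [id, mul_one]
    ring
  have h2 : (1 + m * Complex.exp (a * θ)) ∈ Complex.slitPlane := by
    refine Complex.mem_slitPlane_of_norm_lt_one ?_
    rw [norm_mul, Complex.norm_exp]
    simpa [ha] using hm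
  exact (h1.clog h2).comp_ofReal

open Complex in
theorem integral_sin_sq_div {z m : ℂ} (hm : m ^ 2 + z * m + 1 = 0) (hm1 : ‖m‖ < 1)
    (hz : 0 < z.im) :
    ∫ θ in (0 : ℝ)..Real.pi, (4 * (Real.sin θ : ℂ) ^ 2) / (2 * (Real.cos θ : ℂ) - z) =
      2 * Real.pi * m := by
  have hm0 : m ≠ 0 := by
    rintro rfl
    simp at hm
  have hzm : z = -(m + m⁻¹) := by
    field_simp
    linear_combination hm
  have hden : ∀ θ : ℝ, 2 * (Real.cos θ : ℂ) - z ≠ 0 := by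
    intro θ h
    have := congrArg Complex.im h
    simp [-Complex.ofReal_cos] at this
    linarith
  have hderiv : ∀ θ : ℝ, HasDerivAt (fun θ : ℝ => -((1 - m ^ 2) / m) * ((θ : ℂ) +
      I * (Complex.log (1 + m * Complex.exp (I * θ)) -
        Complex.log (1 + m * Complex.exp (-I * θ)))) - (2 * (Real.sin θ : ℂ) + z * θ))
      ((4 * (Real.sin θ : ℂ) ^ 2) / (2 * (Real.cos θ : ℂ) - z)) θ := by
    intro θ
    have h1 := hasDerivAt_log_one_add_mul_exp hm1 (a := I) (by simp) θ
    have h2 := hasDerivAt_log_one_add_mul_exp hm1 (a := -I) (by simp) θ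
    have hid : HasDerivAt (fun θ : ℝ => (θ : ℂ)) 1 θ := (hasDerivAt_id (θ : ℂ)).comp_ofReal
    have hsin : HasDerivAt (fun θ : ℝ => (Real.sin θ : ℂ)) (Real.cos θ : ℂ) θ :=
      (Real.hasDerivAt_sin θ).ofReal_comp
    have h := ((hid.add ((h1.sub h2).const_mul I)).const_mul (-((1 - m ^ 2) / m))).sub
      ((hsin.const_mul 2).add (hid.const_mul z))
    refine h.congr_deriv ?_
    set w := Complex.exp (I * θ)
    have hw0 : w ≠ 0 := Complex.exp_ne_zero _
    have hwi : Complex.exp (-I * θ) = w⁻¹ := by rw [neg_mul, Complex.exp_neg]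
    have hcos : (Real.cos θ : ℂ) = (w + w⁻¹) / 2 := by
      rw [Complex.ofReal_cos, Complex.cos, ← hwi]
      simp only [w]
      ring_nf
    have hsinw : (Real.sin θ : ℂ) = (w⁻¹ - w) * I / 2 := by
      rw [Complex.ofReal_sin, Complex.sin, ← hwi]
      simp only [w]
      ring_nf
    have hd := hden θ
    rw [hcos] at hd ⊢
    rw [hsinw, hwi]
    have hf : 2 * ((w + w⁻¹) / 2) - z = (1 + m * w) * (1 + m * w⁻¹) / m := by
      rw [hzm]; field_simp; ring
    have hne := hd
    rw [hf] at hne ⊢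
    have hn1 : 1 + m * w ≠ 0 := fun h => hne (by rw [h]; simp)
    have hn2 : 1 + m * w⁻¹ ≠ 0 := fun h => hne (by rw [h]; simp)
    have hn3 : w + m ≠ 0 := by
      intro h
      apply hn2
      field_simp
      rw [h, mul_zero]
    have hI : I ^ 2 = -1 := Complex.I_sq
    have e1 : I * (I * (m * w) / (1 + m * w) - -I * (m * w⁻¹) / (1 + m * w⁻¹)) =
        -(m * w / (1 + m * w) + m * w⁻¹ / (1 + m * w⁻¹)) := by
      linear_combination (m * w / (1 + m * w) + m * w⁻¹ / (1 + m * w⁻¹)) * hI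
    have e2 : 4 * ((w⁻¹ - w) * I / 2) ^ 2 = -(w⁻¹ - w) ^ 2 := by
      linear_combination (w⁻¹ - w) ^ 2 * hI
    rw [e1, e2, hzm]
    field_simp
    ring
  have h_integrable : IntervalIntegrable
      (fun θ : ℝ => (4 * (Real.sin θ : ℂ) ^ 2) / (2 * (Real.cos θ : ℂ) - z)) volume 0 Real.pi := by
    refine Continuous.intervalIntegrable ?_ _ _
    refine Continuous.div (by fun_prop) (by fun_prop) hden
  rw [intervalIntegral.integral_eq_sub_of_hasDerivAt (fun θ _ => hderiv θ) h_integrable]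
  have e1 : Complex.exp (I * (Real.pi : ℂ)) = -1 := by rw [mul_comm, Complex.exp_pi_mul_I]
  have e2 : Complex.exp (-I * (Real.pi : ℂ)) = -1 := by
    rw [neg_mul, Complex.exp_neg, e1]; norm_num
  rw [e1, e2]
  simp only [Complex.ofReal_zero, mul_zero, Complex.exp_zero, sub_self, Real.sin_pi, Real.sin_zero,
    add_zero]
  rw [hzm]
  field_simp
  ring

theorem mSC_spec {z : ℂ} (hz : 0 < z.im) : mSC z ^ 2 + z * mSC z + 1 = 0 ∧ ‖mSC z‖ < 1 := by
  obtain ⟨m, hm, hm1⟩ := exists_root_norm_lt_one hz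
  suffices h : mSC z = m by rw [h]; exact ⟨hm, hm1⟩
  have hden : ∀ x : ℝ, (x : ℂ) - z ≠ 0 := by
    intro x h
    have := congrArg Complex.im h
    simp at this
    linarith
  set g : ℝ → ℂ := fun x => ((Real.sqrt (4 - x ^ 2) / (2 * Real.pi) : ℝ) : ℂ) / ((x : ℂ) - z)
    with hg
  have hgc : Continuous g := by
    refine Continuous.div (Complex.continuous_ofReal.comp ?_) (by fun_prop) hden
    exact ((Real.continuous_sqrt.comp (by fun_prop)).div_const _)
  have hsub := intervalIntegral.integral_deriv_smul_comp (a := 0) (b := Real.pi)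
    (f := fun θ => 2 * Real.cos θ) (f' := fun θ => 2 * -Real.sin θ) (g := g)
    (fun θ _ => (Real.hasDerivAt_cos θ).const_mul 2) (by fun_prop) hgc
  have e1 : ∫ x in (2 * Real.cos 0)..(2 * Real.cos Real.pi), g x = -mSC z := by
    rw [Real.cos_zero, Real.cos_pi, intervalIntegral.integral_symm]
    norm_num
    rfl
  rw [e1] at hsub
  have e2 : ∫ θ in (0 : ℝ)..Real.pi, (2 * -Real.sin θ) • (g ∘ fun θ => 2 * Real.cos θ) θ =
      ∫ θ in (0 : ℝ)..Real.pi, -((2 * Real.pi : ℂ)⁻¹ *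
        ((4 * (Real.sin θ : ℂ) ^ 2) / (2 * (Real.cos θ : ℂ) - z))) := by
    refine intervalIntegral.integral_congr fun θ hθ => ?_
    rw [Set.uIcc_of_le Real.pi_pos.le] at hθ
    have hs : 0 ≤ Real.sin θ := Real.sin_nonneg_of_mem_Icc hθ
    have hsq : Real.sqrt (4 - (2 * Real.cos θ) ^ 2) = 2 * Real.sin θ := by
      rw [show 4 - (2 * Real.cos θ) ^ 2 = (2 * Real.sin θ) ^ 2 by
        nlinarith [Real.sin_sq_add_cos_sq θ]]
      exact Real.sqrt_sq (by linarith)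
    have hπ : (Real.pi : ℂ) ≠ 0 := by exact_mod_cast Real.pi_ne_zero
    simp only [hg, Function.comp, hsq, Complex.real_smul]
    push_cast
    ring
  rw [e2, intervalIntegral.integral_neg, intervalIntegral.integral_const_mul,
    integral_sin_sq_div hm hm1 hz, neg_inj] at hsub
  rw [← hsub, inv_mul_cancel_left₀]
  simp

end Semicircle

section Stability

theorem mSC_ne_zero {z : ℂ} (hz : 0 < z.im) : mSC z ≠ 0 := by
  intro h
  have := (mSC_spec hz).1
  rw [h] at this
  simp at this

theorem mSC_add_inv {z : ℂ} (hz : 0 < z.im) : z = -(mSC z + (mSC z)⁻¹) := by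
  have h0 := mSC_ne_zero hz
  have h := (mSC_spec hz).1
  field_simp
  linear_combination h

theorem im_mul_norm_mSC_le {z : ℂ} (hz : 0 < z.im) : z.im * ‖mSC z‖ ≤ 1 - ‖mSC z‖ ^ 2 := by
  have h0 := mSC_ne_zero hz
  obtain ⟨-, h1⟩ := mSC_spec hz
  have hpos : 0 < ‖mSC z‖ := norm_pos_iff.mpr h0
  have him : z.im = -(mSC z).im + (mSC z).im / ‖mSC z‖ ^ 2 := by
    have := congrArg Complex.im (mSC_add_inv hz)
    rw [Complex.neg_im, Complex.add_im, Complex.inv_im, Complex.normSq_eq_norm_sq] at this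
    linear_combination this
  have h2 : z.im * ‖mSC z‖ ^ 2 = (mSC z).im * (1 - ‖mSC z‖ ^ 2) := by
    rw [him]
    field_simp
    ring
  have h3 : (mSC z).im ≤ ‖mSC z‖ := (le_abs_self _).trans (Complex.abs_im_le_norm _)
  have h4 : 0 ≤ 1 - ‖mSC z‖ ^ 2 := by nlinarith
  have h5 : ‖mSC z‖ * (z.im * ‖mSC z‖) ≤ ‖mSC z‖ * (1 - ‖mSC z‖ ^ 2) := by
    nlinarith [mul_le_mul_of_nonneg_right h3 h4]
  exact le_of_mul_le_mul_left h5 hpos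

theorem norm_mSC_sub_le {z w : ℂ} (hz : 0 < z.im) (hw : 0 < w.im) :
    ‖mSC w - mSC z‖ ≤ 2 * ‖w - z‖ / z.im := by
  have h0 := mSC_ne_zero hz
  have h0' := mSC_ne_zero hw
  obtain ⟨-, h1⟩ := mSC_spec hz
  obtain ⟨-, h1'⟩ := mSC_spec hw
  have hpos : 0 < ‖mSC z‖ := norm_pos_iff.mpr h0
  have hb := im_mul_norm_mSC_le hz
  have key : (mSC w - mSC z) * (1 - mSC z * mSC w) = (w - z) * (mSC z * mSC w) := by
    have e1 := (mSC_spec hz).1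
    have e2 := (mSC_spec hw).1
    linear_combination (mSC w) * e1 - (mSC z) * e2
  have hn := congrArg norm key
  rw [norm_mul, norm_mul, norm_mul] at hn
  have h2 : 1 - ‖mSC z‖ ≤ ‖1 - mSC z * mSC w‖ := by
    have := norm_sub_norm_le (1 : ℂ) (mSC z * mSC w)
    rw [norm_one, norm_mul] at this
    nlinarith [norm_nonneg (mSC z)]
  have h3 : z.im * ‖mSC z‖ / 2 ≤ ‖1 - mSC z * mSC w‖ := by nlinarith
  rw [le_div_iff₀ hz]
  have h4 : ‖mSC w - mSC z‖ * (z.im * ‖mSC z‖ / 2) ≤ ‖w - z‖ * ‖mSC z‖ := by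
    calc _ ≤ ‖mSC w - mSC z‖ * ‖1 - mSC z * mSC w‖ := by gcongr
      _ = ‖w - z‖ * (‖mSC z‖ * ‖mSC w‖) := hn
      _ ≤ ‖w - z‖ * (‖mSC z‖ * 1) := by gcongr
      _ = _ := by ring
  have h5 : ‖mSC z‖ * (‖mSC w - mSC z‖ * z.im) ≤ ‖mSC z‖ * (2 * ‖w - z‖) := by linarith
  exact le_of_mul_le_mul_left h5 hpos

theorem norm_root_gap_sq {z : ℂ} (hz : 0 < z.im) :
    ‖mSC z - (-z - mSC z)‖ ^ 2 = ‖z - 2‖ * ‖z + 2‖ := by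
  rw [← norm_pow, ← norm_mul]
  congr 1
  linear_combination 4 * (mSC_spec hz).1

theorem norm_sub_ofReal_mono {E a η η' : ℝ} (h0 : 0 ≤ η) (h : η ≤ η') :
    ‖(E + η * Complex.I - a : ℂ)‖ ≤ ‖(E + η' * Complex.I - a : ℂ)‖ := by
  have e : ∀ t : ℝ, ‖(E + t * Complex.I - a : ℂ)‖ = √((E - a) ^ 2 + t ^ 2) := by
    intro t
    rw [← Complex.norm_add_mul_I]
    congr 1
    push_cast
    ring
  rw [e, e]
  apply Real.sqrt_le_sqrt
  nlinarith

theorem norm_root_gap_mono {E η η' : ℝ} (h0 : 0 < η) (h : η ≤ η') :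
    ‖mSC (E + η * Complex.I) - (-(E + η * Complex.I) - mSC (E + η * Complex.I))‖ ≤
    ‖mSC (E + η' * Complex.I) - (-(E + η' * Complex.I) - mSC (E + η' * Complex.I))‖ := by
  have e := norm_root_gap_sq (z := E + η * Complex.I) (by simpa using h0)
  have e' := norm_root_gap_sq (z := E + η' * Complex.I) (by simpa using h0.trans_le h)
  have h1 := norm_sub_ofReal_mono (E := E) (a := 2) h0.le h
  have h2 := norm_sub_ofReal_mono (E := E) (a := -2) h0.le h
  push_cast at h1 h2
  rw [sub_neg_eq_add, sub_neg_eq_add] at h2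
  refine le_of_sq_le_sq ?_ (norm_nonneg _)
  rw [e, e']
  gcongr

/-- A sequence of approximate roots starting near the root `m 0` and moving in small steps stays
near `m`. -/
theorem norm_sub_root_le {s m n : ℕ → ℂ} {r : ℝ} (M : ℕ) (hr : 0 ≤ r)
    (hroot : ∀ k ≤ M, ‖s k - m k‖ * ‖s k - n k‖ ≤ r ^ 2)
    (hs : ∀ k < M, ‖s (k + 1) - s k‖ ≤ r / 2) (hm : ∀ k < M, ‖m (k + 1) - m k‖ ≤ r / 2)
    (hgap : ∀ k ≤ M, ‖m M - n M‖ ≤ ‖m k - n k‖) (h0 : ‖s 0 - m 0‖ ≤ r) :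
    ‖s M - m M‖ ≤ 5 * r := by
  by_cases hb : ‖m M - n M‖ ≤ 4 * r
  · by_contra! hlt
    have h1 : ‖s M - m M‖ ≤ ‖s M - n M‖ + ‖m M - n M‖ := by
      have := norm_sub_le (s M - n M) (m M - n M)
      rwa [sub_sub_sub_cancel_right] at this
    have h2 : r < ‖s M - n M‖ := by linarith
    have h3 := hroot M le_rfl
    nlinarith
  · push Not at hb
    have hind : ∀ k ≤ M, ‖s k - m k‖ ≤ r := by
      intro k
      induction k with
      | zero => exact fun _ => h0
      | succ k ih =>
        intro hk
        have h1 := ih (by omega)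
        have h2 : ‖s (k + 1) - m (k + 1)‖ ≤ 2 * r := by
          have e : s (k + 1) - m (k + 1) =
            (s (k + 1) - s k) + (s k - m k) - (m (k + 1) - m k) := by ring
          rw [e]
          refine (norm_sub_le _ _).trans ?_
          linarith [norm_add_le (s (k + 1) - s k) (s k - m k), hs k (by omega), hm k (by omega)]
        have h3 := hgap (k + 1) hk
        have h4 : ‖m (k + 1) - n (k + 1)‖ ≤ ‖s (k + 1) - n (k + 1)‖ + ‖s (k + 1) - m (k + 1)‖ := by
          have := norm_sub_le (s (k + 1) - n (k + 1)) (s (k + 1) - m (k + 1))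
          rwa [sub_sub_sub_cancel_left] at this
        have h5 := hroot (k + 1) hk
        by_contra! hlt
        nlinarith
    linarith [hind M le_rfl]

end Stability

section Deterministic

variable {N d : ℕ} {A : Matrix (Fin N) (Fin N) ℝ} {G H : Matrix (Fin N) (Fin N) ℂ}
  {z w : ℂ} {K ψ lam : ℝ}

/-- The normalized trace of `G`. -/
def avg (G : Matrix (Fin N) (Fin N) ℂ) : ℂ := (N : ℂ)⁻¹ * ∑ k, G k k

theorem diagAvg_eq (h : Params N d z K ψ) (i : Fin N) :
    diagAvg d A G i = avg G - diagDev d A G i := by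
  have h1 : (N : ℂ) ≠ 0 := by exact_mod_cast h.N_pos.ne'
  have h2 : (N : ℂ) - d ≠ 0 := by exact_mod_cast h.N_sub_pos.ne'
  simp only [diagAvg, avg, diagDev, sub_mul, one_mul, Finset.sum_sub_distrib]
  field_simp
  ring

theorem norm_avg_le {M : ℝ} (hN : 0 < N) (hG : ∀ k, ‖G k k‖ ≤ M) : ‖avg G‖ ≤ M := by
  rw [avg, norm_mul, norm_inv, Complex.norm_natCast, inv_mul_le_iff₀ (by exact_mod_cast hN)]
  exact (norm_sum_le_of_le _ fun k _ => hG k).trans (by simp)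

theorem norm_diag_self_consistent_le (h : Params N d z K ψ)
    (hGK : ∀ x y, ‖G x y‖ ≤ K) (hψ : ψ ≤ lam) (hP : ∀ i x, ‖selfErr d z A G i x‖ ≤ lam)
    (hT : ∀ i, ‖diagDev d A G i‖ ≤ lam) (i : Fin N) :
    ‖1 + z * G i i + avg G * G i i‖ ≤ 3 * K * lam := by
  have hK := h.one_le_K
  have e : 1 + z * G i i + avg G * G i i =
      selfErr d z A G i i + (N : ℂ)⁻¹ + diagDev d A G i * G i i := by
    rw [selfErr, diagAvg_eq h, if_pos rfl]
    ring
  have hlam : 0 ≤ lam := h.psi_nonneg.trans hψ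
  have hN : ‖(N : ℂ)⁻¹‖ ≤ lam := by
    rw [norm_inv, Complex.norm_natCast, inv_le_iff_one_le_mul₀' h.N_pos]
    exact h.one_le_N_psi.trans (by gcongr)
  rw [e]
  refine (norm_add₃_le).trans ?_
  rw [norm_mul]
  calc _ ≤ lam + lam + lam * K := by
        gcongr
        exacts [hP i i, hT i, hGK i i]
    _ ≤ _ := by nlinarith

theorem norm_avg_self_consistent_le (h : Params N d z K ψ)
    (hGK : ∀ x y, ‖G x y‖ ≤ K) (hψ : ψ ≤ lam) (hP : ∀ i x, ‖selfErr d z A G i x‖ ≤ lam)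
    (hT : ∀ i, ‖diagDev d A G i‖ ≤ lam) :
    ‖1 + z * avg G + avg G * avg G‖ ≤ 3 * K * lam := by
  have h1 : (N : ℂ) ≠ 0 := by exact_mod_cast h.N_pos.ne'
  have e : 1 + z * avg G + avg G * avg G =
      (N : ℂ)⁻¹ * ∑ i, (1 + z * G i i + avg G * G i i) := by
    simp only [Finset.sum_add_distrib, ← Finset.mul_sum, Finset.sum_const, Finset.card_univ,
      Fintype.card_fin, nsmul_eq_mul, mul_one]
    have : ∑ i, G i i = N * avg G := by rw [avg]; field_simp
    rw [this]
    field_simp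
  rw [e, norm_mul, norm_inv, Complex.norm_natCast, inv_mul_le_iff₀ h.N_pos]
  refine (norm_sum_le_of_le _ fun k _ => norm_diag_self_consistent_le h hGK hψ hP hT k).trans ?_
  simp

theorem norm_avg_sub_le (hz : Params N d z K ψ) (hw : Params N d w K ψ) (hA : IsAdjMat N d A)
    (hG : IsGreen (qval N d) A z G) (hH : IsGreen (qval N d) A w H) :
    ‖avg G - avg H‖ ≤ ‖z - w‖ * N ^ 2 := by
  have hb : ∀ {v : ℂ}, Params N d v K ψ → v.im⁻¹ ≤ N := fun {v} hv =>
    hv.inv_im_le.trans (mul_le_of_le_one_right hv.N_pos.le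
      (pow_le_one₀ hv.psi_nonneg hv.psi_le))
  have hs : ∀ {v : ℂ} {F : Matrix (Fin N) (Fin N) ℂ}, Params N d v K ψ →
      IsGreen (qval N d) A v F → ∀ k, √(‖F k k‖ / v.im) ≤ N := fun {v F} hv hF k => by
    apply Real.sqrt_le_iff.mpr ⟨hv.N_pos.le, ?_⟩
    rw [div_eq_mul_inv, sq]
    have := hF.norm_le_inv hA.1 hv.q_pos.ne' hv.im_pos k k
    have hi := inv_pos.mpr hv.im_pos
    gcongr
    exacts [this.trans (hb hv), hb hv]
  have e : avg G - avg H = avg (G - H) := by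
    simp [avg, Finset.sum_sub_distrib, mul_sub]
  rw [e]
  refine norm_avg_le (by exact_mod_cast hz.N_pos) fun k => ?_
  rw [hG.sub_eq_mul hA.1 hz.q_pos.ne' hH, Matrix.smul_apply, smul_eq_mul, norm_mul, sq]
  gcongr
  refine (hG.sum_mul_norm_le hA.1 hA.1 hz.q_pos.ne' hz.im_pos hw.im_pos hH k k).trans ?_
  gcongr
  exacts [hs hz hG k, hs hw hH k]

/-- If the self-consistent equation holds on a fine vertical grid reaching up to large imaginary
part, then the average of the diagonal follows the correct root. -/
theorem norm_avg_sub_mSC_le {E : ℝ} {y : ℕ → ℝ} {M : ℕ} (hA : IsAdjMat N d A)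
    (hpar : ∀ k ≤ M, Params N d (E + y k * Complex.I) K ψ)
    (hanti : ∀ k < M, y (k + 1) ≤ y k) (hy0 : 10 ≤ y 0) (hψ : ψ ≤ lam)
    (hr : 3 * K * lam ≤ 1)
    (hstep : ∀ k < M, (y k - y (k + 1)) * (2 * N ^ 2) ≤ √(3 * K * lam) / 2)
    (hGK : ∀ k ≤ M, ∀ u v, ‖greenM N d A (E + y k * Complex.I) u v‖ ≤ K)
    (hP : ∀ k ≤ M, ∀ i x, ‖selfErr d (E + y k * Complex.I) A
      (greenM N d A (E + y k * Complex.I)) i x‖ ≤ lam)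
    (hT : ∀ k ≤ M, ∀ i, ‖diagDev d A (greenM N d A (E + y k * Complex.I)) i‖ ≤ lam) :
    ‖avg (greenM N d A (E + y M * Complex.I)) - mSC (E + y M * Complex.I)‖ ≤
      5 * √(3 * K * lam) := by
  have hp0 := hpar 0 (Nat.zero_le _)
  have hK := hp0.one_le_K
  have hlam : 0 ≤ lam := hp0.psi_nonneg.trans hψ
  have h3 : 0 ≤ 3 * K * lam := by positivity
  have him : ∀ k, (E + y k * Complex.I : ℂ).im = y k := fun k => by simp
  have hpos : ∀ k ≤ M, 0 < y k := fun k hk => him k ▸ (hpar k hk).im_pos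
  have hgr : ∀ k ≤ M, IsGreen (qval N d) A (E + y k * Complex.I)
      (greenM N d A (E + y k * Complex.I)) := fun k hk =>
    isGreen_greenM hA (hpar k hk).q_pos (hpar k hk).im_pos.ne'
  have hanti' : ∀ k ≤ M, y M ≤ y k := fun k hk => by
    induction hk using Nat.decreasingInduction with
    | self => exact le_rfl
    | of_succ k hk ih => exact ih.trans (hanti k hk)
  have hdist : ∀ k < M, ‖(E + y (k + 1) * Complex.I - (E + y k * Complex.I) : ℂ)‖ =
      y k - y (k + 1) := fun k hk => by
    have : (E + y (k + 1) * Complex.I - (E + y k * Complex.I) : ℂ) =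
      ((y (k + 1) - y k : ℝ) : ℂ) * Complex.I := by push_cast; ring
    rw [this, norm_mul, Complex.norm_I, mul_one, Complex.norm_real, Real.norm_eq_abs,
      abs_of_nonpos (by linarith [hanti k hk])]
    ring
  refine norm_sub_root_le (s := fun k => avg (greenM N d A (E + y k * Complex.I)))
    (m := fun k => mSC (E + y k * Complex.I))
    (n := fun k => -(E + y k * Complex.I) - mSC (E + y k * Complex.I)) M (Real.sqrt_nonneg _)
    ?_ ?_ ?_ ?_ ?_
  · intro k hk
    rw [Real.sq_sqrt h3, ← norm_mul]
    refine le_of_eq_of_le ?_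
      (norm_avg_self_consistent_le (hpar k hk) (hGK k hk) hψ (hP k hk) (hT k hk))
    congr 1
    linear_combination -(mSC_spec (hpar k hk).im_pos).1
  · intro k hk
    refine (norm_avg_sub_le (hpar _ hk) (hpar k hk.le) hA (hgr _ hk) (hgr k hk.le)).trans
      (le_trans ?_ (hstep k hk))
    rw [hdist k hk]
    have := hanti k hk
    have : 0 ≤ y k - y (k + 1) := by linarith
    gcongr
    nlinarith [sq_nonneg (N : ℝ)]
  · intro k hk
    refine (norm_mSC_sub_le (hpar k hk.le).im_pos (hpar _ hk).im_pos).trans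
      (le_trans ?_ (hstep k hk))
    rw [hdist k hk, him]
    have h1 : (y k)⁻¹ ≤ N := by
      have hv := hpar k hk.le
      have := hv.inv_im_le.trans (mul_le_of_le_one_right hv.N_pos.le
        (pow_le_one₀ hv.psi_nonneg hv.psi_le))
      rwa [him] at this
    have h2 : 0 ≤ y k - y (k + 1) := by linarith [hanti k hk]
    have h4 := hp0.one_le_N
    rw [div_eq_mul_inv]
    calc _ ≤ 2 * (y k - y (k + 1)) * N := by gcongr
      _ ≤ _ := by nlinarith [mul_nonneg h2 (sub_nonneg.mpr h4), mul_nonneg (mul_nonneg h2 (sub_nonneg.mpr h4)) (by linarith : (0:ℝ) ≤ N)]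
  · intro k hk
    exact norm_root_gap_mono (hpos M le_rfl) (hanti' k hk)
  · have hz := hp0.im_pos
    have hm := im_mul_norm_mSC_le hz
    have hm1 := (mSC_spec hz).2
    have hinv := mSC_add_inv hz
    have hne := mSC_ne_zero hz
    have hG0 : ‖avg (greenM N d A (E + y 0 * Complex.I))‖ ≤ 1 / 10 := by
      refine norm_avg_le (by exact_mod_cast hp0.N_pos) fun k => ?_
      refine ((hgr 0 (Nat.zero_le _)).norm_le_inv hA.1 hp0.q_pos.ne' hz k k).trans ?_
      rw [him, one_div]
      gcongr
    rw [him] at hm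
    have heq := norm_avg_self_consistent_le hp0 (hGK 0 (Nat.zero_le _)) hψ (hP 0 (Nat.zero_le _))
      (hT 0 (Nat.zero_le _))
    have hspec := (mSC_spec hz).1
    generalize mSC (E + y 0 * Complex.I) = m at *
    generalize avg (greenM N d A (E + y 0 * Complex.I)) = s at *
    generalize (E + y 0 * Complex.I : ℂ) = z at *
    have hmle : ‖m‖ ≤ 1 / 10 := by nlinarith [norm_nonneg m, sq_nonneg ‖m‖]
    have hfac : ‖s - m‖ * ‖s - m⁻¹‖ ≤ 3 * K * lam := by
      rw [← norm_mul]
      refine le_of_eq_of_le ?_ heq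
      congr 1
      rw [hinv]
      field_simp
      ring
    have hbig : 1 ≤ ‖s - m⁻¹‖ := by
      have h1 : ‖m‖⁻¹ - ‖s‖ ≤ ‖s - m⁻¹‖ := by
        rw [norm_sub_rev, ← norm_inv]
        exact norm_sub_norm_le _ _
      have h2 : (10 : ℝ) ≤ ‖m‖⁻¹ := by
        rw [le_inv_comm₀ (by norm_num) (norm_pos_iff.mpr hne)]
        linarith
      linarith
    have h5 : ‖s - m‖ ≤ 3 * K * lam := by nlinarith [norm_nonneg (s - m)]
    refine h5.trans (Real.le_sqrt_of_sq_le ?_)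
    nlinarith

theorem norm_green_sub_mSC_le (h : Params N d z K ψ)
    (hGK : ∀ x y, ‖G x y‖ ≤ K) (hψ : ψ ≤ lam) (hr : 3 * K * lam ≤ 1)
    (hP : ∀ i x, ‖selfErr d z A G i x‖ ≤ lam) (hT : ∀ i, ‖diagDev d A G i‖ ≤ lam)
    (havg : ‖avg G - mSC z‖ ≤ 5 * √(3 * K * lam)) (i j : Fin N) :
    ‖G i j - if i = j then mSC z else 0‖ ≤ 8 * K * √(3 * K * lam) := by
  have hK := h.one_le_K
  have hlam : 0 ≤ lam := h.psi_nonneg.trans hψ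
  have h3 : 0 ≤ 3 * K * lam := by positivity
  have hle : 3 * K * lam ≤ √(3 * K * lam) := Real.le_sqrt_of_sq_le (by nlinarith)
  by_cases hij : i = j
  · subst hij
    rw [if_pos rfl]
    have e : G i i - mSC z = mSC z * ((avg G - mSC z) * G i i -
        (1 + z * G i i + avg G * G i i)) := by
      linear_combination G i i * (mSC_spec h.im_pos).1
    rw [e, norm_mul]
    have h1 := norm_diag_self_consistent_le h hGK hψ hP hT i
    calc _ ≤ 1 * (5 * √(3 * K * lam) * K + 3 * K * lam) := by
          gcongr
          · exact (mSC_spec h.im_pos).2.le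
          · refine (norm_sub_le _ _).trans ?_
            rw [norm_mul]
            gcongr
            exact hGK i i
      _ ≤ _ := by nlinarith [Real.sqrt_nonneg (3 * K * lam)]
  · rw [if_neg hij, sub_zero]
    refine (norm_offDiag_le h hGK hP hij).trans ?_
    nlinarith

end Deterministic

section LocalLaw

variable {N d : ℕ} {K ψ lam L p : ℝ}

theorem PrReg_green_sub_mSC_le {E : ℝ} {y : ℕ → ℝ} {M : ℕ}
    (hpar : ∀ k ≤ M, Params N d (E + y k * Complex.I) K ψ)
    (hanti : ∀ k < M, y (k + 1) ≤ y k) (hy0 : 10 ≤ y 0) (m : ℕ) (hL : 1 ≤ L)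
    (hLN : 5 * (N : ℝ) ^ 2 ≤ L ^ (m + 2))
    (hlam : lam = 8 * ((m + 1) * 2 ^ m) * (30000 * K ^ 6 * ψ) * L ^ 2) (hψ : ψ ≤ lam)
    (hr : 3 * K * lam ≤ 1)
    (hstep : ∀ k < M, (y k - y (k + 1)) * (2 * N ^ 2) ≤ √(3 * K * lam) / 2)
    (hp : ∀ k ≤ M, PrReg N d
      (fun A => ¬ ∀ u v, ‖greenM N d A (E + y k * Complex.I) u v‖ ≤ K) ≤ p)
    {t : ℝ} (ht : 8 * K * √(3 * K * lam) < t) :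
    PrReg N d (fun A => ∃ i j, t ≤ ‖(greenM N d A (E + y M * Complex.I) i j -
      if i = j then mSC (E + y M * Complex.I) else 0 : ℂ)‖) ≤
    (M + 1) * (p + 8 * N ^ 2 * ((L ^ (m + 2))⁻¹ + p * ((1 + 4 * N) * (4 * N ^ 3) ^ (m + 2)))) := by
  have hbad : ∀ k ∈ Finset.range (M + 1), PrReg N d (fun A =>
      (¬ ∀ u v, ‖greenM N d A (E + y k * Complex.I) u v‖ ≤ K) ∨
      ∃ i x, lam ≤ ‖selfErr d (E + y k * Complex.I) A (greenM N d A (E + y k * Complex.I)) i x‖ ∨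
        lam ≤ ‖diagDev d A (greenM N d A (E + y k * Complex.I)) i‖) ≤
      p + 8 * N ^ 2 * ((L ^ (m + 2))⁻¹ + p * ((1 + 4 * N) * (4 * N ^ 3) ^ (m + 2))) := by
    intro k hk
    have hk' : k ≤ M := by simpa [Nat.lt_succ_iff] using hk
    refine (PrReg_or_le _ _).trans (add_le_add (hp k hk') ?_)
    have := PrReg_selfErr_or_diagDev_le (hpar k hk') m hL hLN
    rw [← hlam] at this
    refine this.trans ?_
    gcongr
    exact hp k hk'
  refine le_trans (PrReg_mono ?_) (le_of_le_of_eq (PrReg_exists_le _ _ hbad) (by simp))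
  rintro A hA ⟨i, j, hij⟩
  by_contra! hcon
  have hgood : ∀ k ≤ M, (∀ u v, ‖greenM N d A (E + y k * Complex.I) u v‖ ≤ K) ∧
      ∀ i x, ‖selfErr d (E + y k * Complex.I) A (greenM N d A (E + y k * Complex.I)) i x‖ < lam ∧
        ‖diagDev d A (greenM N d A (E + y k * Complex.I)) i‖ < lam := fun k hk =>
    hcon k (by simpa [Nat.lt_succ_iff] using hk)
  have havg := norm_avg_sub_mSC_le hA hpar hanti hy0 hψ hr hstep (fun k hk => (hgood k hk).1)
    (fun k hk i x => ((hgood k hk).2 i x).1.le) (fun k hk i => ((hgood k hk).2 i i).2.le)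
  have := norm_green_sub_mSC_le (hpar M le_rfl) (hgood M le_rfl).1 hψ hr
    (fun i x => ((hgood M le_rfl).2 i x).1.le) (fun i => ((hgood M le_rfl).2 i i).2.le) havg i j
  linarith

/-- The control parameter `(N η)^{-1/2} + d^{-1/2}`. -/
def ctrl (N d : ℕ) (η : ℝ) : ℝ := (√(N * η))⁻¹ + (√d)⁻¹

theorem ctrl_nonneg (N d : ℕ) (η : ℝ) : 0 ≤ ctrl N d η := by
  unfold ctrl; positivity

theorem ctrl_le {x η : ℝ} (hx : 0 < x) (hη : x ^ 2 ≤ N * η) (hd : x ^ 2 ≤ d) :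
    ctrl N d η ≤ 2 * x⁻¹ := by
  have h1 : (√(N * η))⁻¹ ≤ x⁻¹ := by
    gcongr
    exact Real.le_sqrt_of_sq_le hη
  have h2 : (√(d : ℝ))⁻¹ ≤ x⁻¹ := by
    gcongr
    exact Real.le_sqrt_of_sq_le hd
  rw [ctrl]
  linarith

theorem sqrt_ctrl_le {η : ℝ} (hη : 0 ≤ η) :
    √(ctrl N d η) ≤ (N * η) ^ (-(1 / 4) : ℝ) + (d : ℝ) ^ (-(1 / 4) : ℝ) := by
  have h : ∀ u : ℝ, 0 ≤ u → (√u)⁻¹ = (u ^ (-(1 / 4) : ℝ)) ^ 2 := by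
    intro u hu
    rw [Real.sqrt_eq_rpow, ← Real.rpow_neg hu, ← Real.rpow_natCast, ← Real.rpow_mul hu]
    norm_num
  have h0 : 0 ≤ N * η := by positivity
  have h1 : (0 : ℝ) ≤ d := by positivity
  have h2 := Real.rpow_nonneg h0 (-(1 / 4))
  have h3 := Real.rpow_nonneg h1 (-(1 / 4))
  rw [ctrl, h _ h0, h _ h1]
  apply Real.sqrt_le_iff.mpr ⟨by positivity, ?_⟩
  nlinarith

theorem params_ctrl {x δ E η y : ℝ} (hx : 512 ≤ x) (hδ : 1 + 2 * δ⁻¹ ≤ x)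
    (hd : x ^ 3 ≤ d) (hdN : 2 * d ≤ N) (hE : |E| ≤ δ⁻¹) (hη : 0 < η) (hηy : η ≤ y)
    (hy : y ≤ δ⁻¹) (hψ : ctrl N d η ≤ 1) : Params N d (E + y * Complex.I) x (ctrl N d η) := by
  have hd1 : (1 : ℝ) ≤ d := le_trans (by nlinarith [sq_nonneg x]) hd
  have hd0 : (0 : ℝ) < d := by linarith
  have hdN' : 2 * (d : ℝ) ≤ N := by exact_mod_cast hdN
  have hN : (0 : ℝ) < N := by linarith
  have hNη : 0 < N * η := by positivity
  have hsq : ∀ {u v : ℝ}, 0 < u → (√u)⁻¹ ≤ v → 1 ≤ u * v ^ 2 := by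
    intro u v hu huv
    calc 1 = u * (√u)⁻¹ ^ 2 := by rw [inv_pow, Real.sq_sqrt hu.le, mul_inv_cancel₀ hu.ne']
      _ ≤ _ := by gcongr
  refine ⟨by exact_mod_cast hd1, hdN, by simpa using hη.trans_le hηy, ?_, ?_, ctrl_nonneg _ _ _,
    hψ, ?_, ?_⟩
  · refine le_trans ?_ hδ
    have h1 := norm_add_le (E : ℂ) (y * Complex.I)
    rw [norm_mul, Complex.norm_I, Complex.norm_real, Complex.norm_real, Real.norm_eq_abs,
      Real.norm_eq_abs, abs_of_pos (hη.trans_le hηy)] at h1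
    linarith
  · apply Real.le_sqrt_of_sq_le
    rw [le_div_iff₀ hN]
    have h1 : (16 * x) ^ 2 ≤ d / 2 := by nlinarith [sq_nonneg x]
    nlinarith
  · have h1 := hsq hNη (v := ctrl N d η) (le_add_of_nonneg_right (by positivity))
    have h2 : (E + y * Complex.I : ℂ).im = y := by simp
    rw [h2]
    refine h1.trans ?_
    gcongr
  · exact hsq hd0 (le_add_of_nonneg_left (by positivity))

end LocalLaw

section Bootstrap

variable {N d : ℕ}

theorem PrReg_green_sub_mSC_le_ctrl {x δ E η p C : ℝ} (m : ℕ) (hx : 512 ≤ x)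
    (hδ : 1 + 2 * δ⁻¹ ≤ x) (hC : C = 8 * ((m + 1) * 2 ^ m) * 30000) (hCx : 192 * C < x)
    (hxN : x ≤ N) (hd : x ^ 100 ≤ d)
    (hηx : x ^ 100 ≤ N * η) (hdN : 2 * d ≤ N) (hE : |E| ≤ δ⁻¹) (hη : 0 < η) (hηδ : η ≤ δ⁻¹)
    (h10 : 10 ≤ δ⁻¹) (hLN : 5 * (N : ℝ) ^ 2 ≤ x ^ (m + 2))
    (hp : ∀ y, η ≤ y → y ≤ δ⁻¹ → PrReg N d
      (fun A => ¬ ∀ u v, ‖greenM N d A (E + y * Complex.I) u v‖ ≤ x) ≤ p) :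
    PrReg N d (fun A => ∃ i j, x ^ 6 * √(ctrl N d η) ≤ ‖(greenM N d A (E + η * Complex.I) i j -
      if i = j then mSC (E + η * Complex.I) else 0 : ℂ)‖) ≤
    ((N ^ 5 : ℕ) + 1) * (p + 8 * N ^ 2 * ((x ^ (m + 2))⁻¹ +
      p * ((1 + 4 * N) * (4 * N ^ 3) ^ (m + 2)))) := by
  have hx0 : 0 < x := by linarith
  have hx1 : 1 ≤ x := by linarith
  have hN : (0 : ℝ) < N := by linarith
  have hC1 : 1 ≤ C := by
    have h1 : (1 : ℝ) ≤ 2 ^ m := one_le_pow₀ (by norm_num)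
    have h2 : (1 : ℝ) ≤ (m + 1) * 2 ^ m := by nlinarith [(Nat.cast_nonneg m : (0 : ℝ) ≤ m)]
    rw [hC]
    linarith
  have hψ : ctrl N d η ≤ 2 * (x ^ 50)⁻¹ := by
    refine ctrl_le (by positivity) ?_ ?_
    · rwa [← pow_mul]
    · rwa [← pow_mul]
  have hψ' : x ^ 10 * ctrl N d η ≤ 1 := by
    calc x ^ 10 * ctrl N d η ≤ x ^ 10 * (2 * (x ^ 50)⁻¹) := by gcongr
      _ = 2 * (x ^ 40)⁻¹ := by field_simp
      _ ≤ x * (x ^ 40)⁻¹ := by gcongr; linarith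
      _ = (x ^ 39)⁻¹ := by field_simp
      _ ≤ 1 := inv_le_one_of_one_le₀ (one_le_pow₀ hx1)
  have hψ1 : ctrl N d η ≤ 1 := by
    refine le_trans ?_ hψ'
    exact le_mul_of_one_le_left (ctrl_nonneg _ _ _) (one_le_pow₀ hx1)
  have hpar : ∀ y, η ≤ y → y ≤ δ⁻¹ → Params N d (E + y * Complex.I) x (ctrl N d η) :=
    fun y h1 h2 => params_ctrl hx hδ ((pow_le_pow_right₀ hx1 (by norm_num)).trans hd) hdN hE hη h1
      h2 hψ1
  have hpar0 := hpar η le_rfl hηδ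
  have hpsi0 := hpar0.psi_pos
  set ψ := ctrl N d η with hψdef
  have hM : (0 : ℝ) < ((N ^ 5 : ℕ) : ℝ) := by push_cast; positivity
  set y : ℕ → ℝ := fun k => δ⁻¹ - k * ((δ⁻¹ - η) / (N ^ 5 : ℕ)) with hy
  have hyM : y (N ^ 5) = η := by
    rw [hy]
    field_simp
    ring
  have hs0 : 0 ≤ (δ⁻¹ - η) / (N ^ 5 : ℕ) := div_nonneg (by linarith) hM.le
  have hyle : ∀ k, y k ≤ δ⁻¹ := fun k => by
    have : 0 ≤ k * ((δ⁻¹ - η) / (N ^ 5 : ℕ)) := by positivity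
    simp only [hy]
    linarith
  have hyge : ∀ k ≤ N ^ 5, η ≤ y k := fun k hk => by
    have hk' : (k : ℝ) ≤ (N ^ 5 : ℕ) := by exact_mod_cast hk
    have := mul_le_mul_of_nonneg_right hk' hs0
    rw [← hyM]
    simp only [hy]
    linarith
  have hdiff : ∀ k, y k - y (k + 1) = (δ⁻¹ - η) / (N ^ 5 : ℕ) := fun k => by
    simp only [hy]
    push_cast
    ring
  have hlamψ : 3 * x * (8 * ((m + 1) * 2 ^ m) * (30000 * x ^ 6 * ψ) * x ^ 2) =
      3 * C * x ^ 9 * ψ := by rw [hC]; ring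
  have hlamge : ψ ≤ 3 * C * x ^ 9 * ψ := by
    refine le_mul_of_one_le_left hpsi0.le ?_
    have := one_le_pow₀ hx1 (n := 9)
    nlinarith
  have key := PrReg_green_sub_mSC_le (N := N) (d := d) (E := E) (y := y) (M := N ^ 5) (K := x)
    (ψ := ψ) (L := x) (p := p) (fun k hk => hpar _ (hyge k hk) (hyle k))
    (fun k hk => by linarith [hdiff k]) (by simpa [hy] using h10) m hx1 hLN rfl ?_ ?_ ?_
    (fun k hk => hp _ (hyge k hk) (hyle k)) (t := x ^ 6 * √ψ) ?_
  · rwa [hyM] at key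
  · have h1 : 1 ≤ C * x ^ 8 := by
      have := one_le_pow₀ hx1 (n := 8)
      nlinarith
    calc ψ ≤ C * x ^ 8 * ψ := le_mul_of_one_le_left hpsi0.le h1
      _ = _ := by rw [hC]; ring
  · rw [hlamψ]
    calc 3 * C * x ^ 9 * ψ ≤ x * x ^ 9 * ψ := by gcongr; linarith
      _ = x ^ 10 * ψ := by ring
      _ ≤ 1 := hψ'
  · intro k hk
    rw [hdiff, hlamψ]
    have h1 : (N : ℝ)⁻¹ ≤ √(3 * C * x ^ 9 * ψ) := by
      apply Real.le_sqrt_of_sq_le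
      refine le_trans ?_ hlamge
      have h2 : (N : ℝ)⁻¹ ≤ ψ := by
        rw [inv_le_iff_one_le_mul₀' hN]
        exact hpar0.one_le_N_psi
      have h3 : (N : ℝ)⁻¹ ≤ 1 := inv_le_one_of_one_le₀ hpar0.one_le_N
      have h4 : 0 ≤ (N : ℝ)⁻¹ := by positivity
      nlinarith
    calc (δ⁻¹ - η) / (N ^ 5 : ℕ) * (2 * N ^ 2) ≤ N / (N ^ 5 : ℕ) * (2 * N ^ 2) := by
          gcongr
          linarith
      _ = 2 * (N : ℝ)⁻¹ * (N : ℝ)⁻¹ := by push_cast; field_simp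
      _ ≤ 2 * (N : ℝ)⁻¹ * (1 / 4) := by
          gcongr
          rw [one_div]
          gcongr
          linarith
      _ ≤ _ := by linarith
  · rw [hlamψ]
    have hsqrt : ∀ {a : ℝ} (b : ℝ), 0 ≤ a → a * √b = √(a ^ 2 * b) := fun b ha => by
      rw [Real.sqrt_mul (by positivity), Real.sqrt_sq ha]
    rw [hsqrt _ (by positivity), hsqrt _ (by positivity)]
    apply Real.sqrt_lt_sqrt (by positivity)
    have h3 : 0 < x ^ 11 * ψ := by positivity
    nlinarith [mul_lt_mul_of_pos_right hCx h3]

/-- The part of the spectral domain with imaginary part at least `N ^ (-κ)`. -/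
structure Dom (τ δ κ : ℝ) (N d : ℕ) (E η : ℝ) : Prop where
  le_d : (N : ℝ) ^ τ ≤ d
  two_d_le : 2 * d ≤ N
  abs_le : |E| ≤ δ⁻¹
  le_im : (N : ℝ) ^ (-1 + δ) ≤ η
  im_le : η ≤ δ⁻¹
  scale_le : (N : ℝ) ^ (-κ) ≤ η

theorem Dom.mono {τ δ κ E η y : ℝ} (h : Dom τ δ κ N d E η) (h1 : η ≤ y) (h2 : y ≤ δ⁻¹) :
    Dom τ δ κ N d E y :=
  ⟨h.le_d, h.two_d_le, h.abs_le, h.le_im.trans h1, h2, h.scale_le.trans h1⟩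

/-- With overwhelming probability the Green function is bounded by `N ^ θ`, down to imaginary part
`N ^ (-κ)`. -/
def APriori (τ δ θ κ : ℝ) : Prop :=
  ∀ D : ℝ, 0 < D → ∀ᶠ N : ℕ in atTop, ∀ (d : ℕ) (E η : ℝ), Dom τ δ κ N d E η →
    PrReg N d (fun A => ¬ ∀ u v, ‖greenM N d A (E + η * Complex.I) u v‖ ≤ (N : ℝ) ^ θ) ≤
      (N : ℝ) ^ (-D)

theorem tendsto_natCast_rpow {θ : ℝ} (hθ : 0 < θ) :
    Tendsto (fun N : ℕ => (N : ℝ) ^ θ) atTop atTop :=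
  (tendsto_rpow_atTop hθ).comp tendsto_natCast_atTop_atTop

theorem union_bound_le {n D : ℝ} (m : ℕ) (hn : 100 ≤ n) {X : ℝ}
    (hX : n ^ (D + 20) ≤ X) :
    (n ^ 5 + 1) * (n ^ (-(D + 23 + 4 * (m + 2))) + 8 * n ^ 2 * (X⁻¹ +
      n ^ (-(D + 23 + 4 * (m + 2))) * ((1 + 4 * n) * (4 * n ^ 3) ^ (m + 2)))) ≤ n ^ (-D) := by
  have hn0 : 0 < n := by linarith
  have hn1 : 1 ≤ n := by linarith
  set P := n ^ (-(D + 20)) with hP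
  have hP0 : 0 < P := by positivity
  have h1 : X⁻¹ ≤ P := by
    rw [hP, Real.rpow_neg hn0.le]
    gcongr
  have h2 : n ^ (-(D + 23 + 4 * (m + 2))) = P * (n ^ (3 + 4 * (m + 2)))⁻¹ := by
    rw [hP, ← Real.rpow_natCast, ← Real.rpow_neg hn0.le, ← Real.rpow_add hn0]
    congr 1
    push_cast
    ring
  have h3 : (1 + 4 * n) * (4 * n ^ 3) ^ (m + 2) ≤ n ^ (3 + 4 * (m + 2)) := by
    rw [pow_add n, pow_mul n]
    gcongr
    · nlinarith [sq_nonneg n]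
    · nlinarith [pow_pos hn0 3]
  have h4 : n ^ (-(D + 23 + 4 * (m + 2))) * ((1 + 4 * n) * (4 * n ^ 3) ^ (m + 2)) ≤ P := by
    rw [h2, mul_assoc]
    refine mul_le_of_le_one_right hP0.le ?_
    rw [inv_mul_le_iff₀ (by positivity), mul_one]
    exact h3
  have h5 : n ^ (-(D + 23 + 4 * (m + 2))) ≤ P := by
    apply Real.rpow_le_rpow_of_exponent_le hn1
    have : (0 : ℝ) ≤ m := by positivity
    linarith
  have h6 : n ^ (-D) = P * n ^ 20 := by
    rw [hP, ← Real.rpow_natCast, ← Real.rpow_add hn0]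
    congr 1
    push_cast
    ring
  rw [h6]
  calc _ ≤ (n ^ 5 + 1) * (P + 8 * n ^ 2 * (P + P)) := by gcongr
    _ = P * ((n ^ 5 + 1) * (1 + 16 * n ^ 2)) := by ring
    _ ≤ P * (n ^ 6 * n ^ 14) := by
        gcongr
        · have := one_le_pow₀ hn1 (n := 5)
          rw [pow_succ n 5]
          nlinarith
        · have h7 : n ^ 3 ≤ n ^ 14 := pow_le_pow_right₀ hn1 (by norm_num)
          nlinarith [sq_nonneg n]
    _ = P * n ^ 20 := by ring

theorem Dom.lt_one {τ δ κ E η : ℝ} (h : Dom τ δ κ N d E η) (hN : 2 ≤ N) : τ < 1 := by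
  by_contra! hτ
  have hN' : (2 : ℝ) ≤ N := by exact_mod_cast hN
  have h1 : (N : ℝ) ^ (1 : ℝ) ≤ (N : ℝ) ^ τ :=
    Real.rpow_le_rpow_of_exponent_le (by linarith) hτ
  rw [Real.rpow_one] at h1
  have h2 : 2 * (d : ℝ) ≤ N := by exact_mod_cast h.two_d_le
  linarith [h.le_d]

theorem Dom.pow_le {τ δ κ θ E η : ℝ} (h : Dom τ δ κ N d E η) (hN : 1 ≤ N) (hθ : 100 * θ ≤ δ)
    (hδτ : δ ≤ τ) : ((N : ℝ) ^ θ) ^ 100 ≤ d ∧ ((N : ℝ) ^ θ) ^ 100 ≤ N * η := by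
  have hN' : (1 : ℝ) ≤ N := by exact_mod_cast hN
  have h1 : ((N : ℝ) ^ θ) ^ 100 ≤ (N : ℝ) ^ δ := by
    rw [← Real.rpow_natCast, ← Real.rpow_mul (by linarith)]
    apply Real.rpow_le_rpow_of_exponent_le hN'
    push_cast
    linarith
  refine ⟨h1.trans ((Real.rpow_le_rpow_of_exponent_le hN' hδτ).trans h.le_d), h1.trans ?_⟩
  calc (N : ℝ) ^ δ = N * (N : ℝ) ^ (-1 + δ) := by
        rw [Real.rpow_add (by linarith), Real.rpow_neg_one, ← mul_assoc,
          mul_inv_cancel₀ (by linarith), one_mul]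
    _ ≤ _ := by gcongr; exact h.le_im

theorem APriori.local_law {τ δ θ κ : ℝ} (hδ : 0 < δ) (hδτ : δ < τ / 10) (hθ : 0 < θ)
    (hθδ : 100 * θ ≤ δ) (h : APriori τ δ θ κ) {D : ℝ} (hD : 0 < D) :
    ∀ᶠ N : ℕ in atTop, ∀ (d : ℕ) (E η : ℝ), Dom τ δ κ N d E η →
      PrReg N d (fun A => ∃ i j, ((N : ℝ) ^ θ) ^ 6 * √(ctrl N d η) ≤
        ‖(greenM N d A (E + η * Complex.I) i j -
          if i = j then mSC (E + η * Complex.I) else 0 : ℂ)‖) ≤ (N : ℝ) ^ (-D) := by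
  obtain ⟨m, hm⟩ := exists_nat_ge ((D + 20) / θ)
  have hmθ : D + 20 ≤ θ * (m + 2) := by
    rw [div_le_iff₀ hθ] at hm
    nlinarith
  set C : ℝ := 8 * ((m + 1) * 2 ^ m) * 30000 with hC
  filter_upwards [h (D + 23 + 4 * (m + 2)) (by positivity), eventually_ge_atTop 100,
    (tendsto_natCast_rpow hθ).eventually_ge_atTop 512,
    (tendsto_natCast_rpow hθ).eventually_ge_atTop (1 + 2 * δ⁻¹),
    (tendsto_natCast_rpow hθ).eventually_gt_atTop (192 * C)] with N hap hN hx1 hx2 hx3 d E η hdom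
  have hN' : (100 : ℝ) ≤ N := by exact_mod_cast hN
  have hτ1 := hdom.lt_one (by omega)
  obtain ⟨hd, hη⟩ := hdom.pow_le (by omega) hθδ (by linarith)
  have hηpos : 0 < η := (Real.rpow_pos_of_pos (by linarith) _).trans_le hdom.le_im
  have hX : (N : ℝ) ^ (D + 20) ≤ ((N : ℝ) ^ θ) ^ (m + 2) := by
    rw [← Real.rpow_natCast, ← Real.rpow_mul (by linarith)]
    apply Real.rpow_le_rpow_of_exponent_le (by linarith)
    push_cast
    exact hmθ
  have hLN : 5 * (N : ℝ) ^ 2 ≤ ((N : ℝ) ^ θ) ^ (m + 2) := by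
    refine le_trans ?_ hX
    calc 5 * (N : ℝ) ^ 2 ≤ N ^ 3 := by nlinarith [sq_nonneg (N : ℝ)]
      _ = (N : ℝ) ^ (3 : ℝ) := by norm_cast
      _ ≤ _ := Real.rpow_le_rpow_of_exponent_le (by linarith) (by linarith)
  have hxN : (N : ℝ) ^ θ ≤ N := by
    conv_rhs => rw [← Real.rpow_one (N : ℝ)]
    exact Real.rpow_le_rpow_of_exponent_le (by linarith) (by linarith)
  have h10 : 10 ≤ δ⁻¹ := by
    rw [le_inv_comm₀ (by norm_num) hδ]
    linarith
  refine (PrReg_green_sub_mSC_le_ctrl m hx1 hx2 hC hx3 hxN hd hη hdom.two_d_le hdom.abs_le hηpos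
    hdom.im_le h10 hLN fun y h1 h2 => hap d E y (hdom.mono h1 h2)).trans ?_
  push_cast
  exact union_bound_le m hN' hX

theorem APriori.step {τ δ θ κ : ℝ} (hδ : 0 < δ) (hδτ : δ < τ / 10) (hθ : 0 < θ)
    (hθδ : 100 * θ ≤ δ) (hκ : 0 ≤ κ) (h : APriori τ δ θ κ) : APriori τ δ θ (κ + θ / 2) := by
  intro D hD
  filter_upwards [h.local_law hδ hδτ hθ hθδ hD, eventually_ge_atTop 100,
    (tendsto_natCast_rpow hθ).eventually_ge_atTop 512,
    (tendsto_natCast_rpow hθ).eventually_ge_atTop (1 + 2 * δ⁻¹)] with N hloc hN hx1 hx2 d E η hdom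
  have hN' : (100 : ℝ) ≤ N := by exact_mod_cast hN
  have hN0 : (0 : ℝ) < N := by linarith
  have hτ1 := hdom.lt_one (by omega)
  have h10 : 10 ≤ δ⁻¹ := by
    rw [le_inv_comm₀ (by norm_num) hδ]
    linarith
  have hηpos : 0 < η := (Real.rpow_pos_of_pos hN0 _).trans_le hdom.le_im
  set s := (N : ℝ) ^ (θ / 2) with hs
  have hs0 : 0 < s := Real.rpow_pos_of_pos hN0 _
  have hss : s * s = (N : ℝ) ^ θ := by rw [hs, ← Real.rpow_add hN0]; ring_nf
  have hs1 : 20 ≤ s := by nlinarith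
  set y := min (η * s) δ⁻¹ with hy
  have hyη : η ≤ y := le_min (by nlinarith) hdom.im_le
  have hyδ : y ≤ δ⁻¹ := min_le_right _ _
  have hscale : (N : ℝ) ^ (-κ) ≤ y := by
    refine le_min ?_ ?_
    · calc (N : ℝ) ^ (-κ) = (N : ℝ) ^ (-(κ + θ / 2)) * s := by
            rw [hs, ← Real.rpow_add hN0]
            ring_nf
        _ ≤ _ := by gcongr; exact hdom.scale_le
    · calc (N : ℝ) ^ (-κ) ≤ 1 := Real.rpow_le_one_of_one_le_of_nonpos (by linarith) (by linarith)
        _ ≤ _ := by linarith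
  have hdom' : Dom τ δ κ N d E y :=
    ⟨hdom.le_d, hdom.two_d_le, hdom.abs_le, hdom.le_im.trans hyη, hyδ, hscale⟩
  refine (PrReg_mono fun A hA hbad => ?_).trans (hloc d E y hdom')
  obtain ⟨hd, hηx⟩ := hdom'.pow_le (by omega) hθδ (by linarith)
  set x := (N : ℝ) ^ θ with hx
  have hx0 : 0 < x := by linarith
  have hthr : x ^ 6 * √(ctrl N d y) ≤ 1 := by
    have h1 : √(ctrl N d y) ≤ (x ^ 24)⁻¹ := by
      apply Real.sqrt_le_iff.mpr ⟨by positivity, ?_⟩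
      calc ctrl N d y ≤ 2 * (x ^ 50)⁻¹ :=
            ctrl_le (by positivity) (by rwa [← pow_mul]) (by rwa [← pow_mul])
        _ ≤ x ^ 2 * (x ^ 50)⁻¹ := by gcongr; nlinarith
        _ = ((x ^ 24)⁻¹) ^ 2 := by field_simp
    calc _ ≤ x ^ 6 * (x ^ 24)⁻¹ := by gcongr
      _ = (x ^ 18)⁻¹ := by field_simp
      _ ≤ 1 := inv_le_one_of_one_le₀ (one_le_pow₀ (by linarith))
  have hq : 0 < qval N d := by
    have h1 : 0 < (d : ℝ) := lt_of_lt_of_le (by positivity) hd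
    have h2 : 2 * (d : ℝ) ≤ N := by exact_mod_cast hdom.two_d_le
    exact Real.sqrt_pos.mpr (div_pos (mul_pos h1 (by linarith)) hN0)
  by_contra! hcon
  refine hbad fun u v => ?_
  have hηim : (E + η * Complex.I : ℂ).im = η := by simp
  have hyim : (E + y * Complex.I : ℂ).im = y := by simp
  have hypos := hηpos.trans_le hyη
  refine (IsGreen.norm_le_of_smaller_im (Γ := 2) (M := s) hA.1 hq.ne' (by rwa [hηim]) (by simp)
    (by rwa [hηim, hyim]) (by rw [hηim, hyim, mul_comm]; exact min_le_left _ _)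
    (isGreen_greenM hA hq (z := E + y * Complex.I) (by rw [hyim]; exact hypos.ne'))
    (isGreen_greenM hA hq (by rw [hηim]; exact hηpos.ne')) (fun i j => ?_) u v).trans ?_
  · have h1 := hcon i j
    have h2 : ‖(if i = j then mSC (E + y * Complex.I) else 0 : ℂ)‖ ≤ 1 := by
      split_ifs
      · exact (mSC_spec (by rwa [hyim])).2.le
      · simp
    have h3 := norm_sub_norm_le (greenM N d A (E + y * Complex.I) i j)
      (if i = j then mSC (E + y * Complex.I) else 0)
    linarith
  · nlinarith

theorem APriori.base {τ δ θ : ℝ} : APriori τ δ θ θ := by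
  intro D hD
  filter_upwards [eventually_ge_atTop 1] with N hN d E η hdom
  have hN0 : (0 : ℝ) < N := by exact_mod_cast hN
  have hηpos : 0 < η := (Real.rpow_pos_of_pos hN0 _).trans_le hdom.le_im
  have hq : 0 < qval N d := by
    have h1 : 0 < (d : ℝ) := (Real.rpow_pos_of_pos hN0 τ).trans_le hdom.le_d
    have h2 : 2 * (d : ℝ) ≤ N := by exact_mod_cast hdom.two_d_le
    exact Real.sqrt_pos.mpr (div_pos (mul_pos h1 (by linarith)) hN0)
  have hηim : (E + η * Complex.I : ℂ).im = η := by simp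
  calc _ ≤ PrReg N d (fun _ => False) := PrReg_mono fun A hA hbad => hbad fun u v => by
        refine (IsGreen.norm_le_inv hA.1 hq.ne' (by rwa [hηim])
          (isGreen_greenM hA hq (by rw [hηim]; exact hηpos.ne')) u v).trans ?_
        rw [hηim, inv_le_comm₀ hηpos (by positivity), ← Real.rpow_neg hN0.le]
        exact hdom.scale_le
    _ = 0 := by simp [PrReg]
    _ ≤ _ := by positivity

theorem APriori.iterate {τ δ θ : ℝ} (hδ : 0 < δ) (hδτ : δ < τ / 10) (hθ : 0 < θ)
    (hθδ : 100 * θ ≤ δ) (j : ℕ) : APriori τ δ θ (θ + j * (θ / 2)) := by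
  induction j with
  | zero => simpa using APriori.base
  | succ j ih =>
    have := ih.step hδ hδτ hθ hθδ (by positivity)
    convert this using 1
    push_cast
    ring

end Bootstrap

end RandomRegular

/-- Weak local semicircle law (entrywise) for random `d`-regular graphs, `N^τ ≤ d ≤ N/2`. -/
theorem local_semicircle_law
    (τ δ : ℝ) (hτ : 0 < τ) (hδ : 0 < δ) (hδτ : δ < τ / 10)
    (ε D : ℝ) (hε : 0 < ε) (hD : 0 < D) :
    ∃ N₀ : ℕ, ∀ N, N₀ ≤ N → ∀ d : ℕ,
      (N : ℝ) ^ τ ≤ (d : ℝ) → 2 * d ≤ N → Even (d * N) →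
      ∀ E η : ℝ, |E| ≤ δ⁻¹ → (N : ℝ) ^ (-1 + δ : ℝ) ≤ η → η ≤ δ⁻¹ →
      PrReg N d (fun A => ∃ i j : Fin N,
        (N : ℝ) ^ ε * (((N : ℝ) * η) ^ (-(1 / 4) : ℝ) + (d : ℝ) ^ (-(1 / 4) : ℝ)) ≤
          ‖(greenM N d A (E + η * Complex.I) i j -
            if i = j then mSC (E + η * Complex.I) else 0 : ℂ)‖) ≤
        (N : ℝ) ^ (-D) := by
  set θ := min ε δ / 100 with hθdef
  have hθ : 0 < θ := by positivity
  have hθδ : 100 * θ ≤ δ := by linarith [min_le_right ε δ]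
  have hθε : 100 * θ ≤ ε := by linarith [min_le_left ε δ]
  obtain ⟨j, hj⟩ := exists_nat_ge (2 / θ)
  have hκ : 1 ≤ θ + j * (θ / 2) := by
    rw [div_le_iff₀ hθ] at hj
    linarith
  obtain ⟨N₀, hN₀⟩ := eventually_atTop.mp
    ((RandomRegular.APriori.iterate hδ hδτ hθ hθδ j).local_law hδ hδτ hθ hθδ hD)
  refine ⟨max N₀ 1, fun N hN d hd hdN _ E η hE hη hηδ => ?_⟩
  have hN1 : (1 : ℝ) ≤ N := by exact_mod_cast (le_max_right _ _).trans hN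
  have hηpos : 0 < η := (Real.rpow_pos_of_pos (by linarith) _).trans_le hη
  have hscale : (N : ℝ) ^ (-(θ + j * (θ / 2))) ≤ η :=
    (Real.rpow_le_rpow_of_exponent_le hN1 (by linarith)).trans hη
  refine (RandomRegular.PrReg_mono fun A hA => ?_).trans
    (hN₀ N ((le_max_left _ _).trans hN) d E η ⟨hd, hdN, hE, hη, hηδ, hscale⟩)
  rintro ⟨i, k, hik⟩
  refine ⟨i, k, le_trans ?_ hik⟩
  have hpow : ((N : ℝ) ^ θ) ^ 6 ≤ (N : ℝ) ^ ε := by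
    rw [← Real.rpow_natCast, ← Real.rpow_mul (by linarith)]
    apply Real.rpow_le_rpow_of_exponent_le hN1
    push_cast
    linarith
  gcongr
  exact RandomRegular.sqrt_ctrl_le hηpos.le

end
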